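/- Let R be a regular local ring and let M be a nonzero finitely generated R-module. Then M is Ext rigid: for every finitely generated R-module N, if Ext_R^n(M,N) = 0 for some n ≤ grade(M), then Ext_R^i(M,N) = 0 for all i ≤ n. -/

import Mathlib

open CategoryTheory IsLocalRing

universe u

/-- `extMod S n A B` is the `n`-th Ext module `Ext_S^n(A, B)` of `S`-modules `A` and `B`,
realized as an object of `ModuleCat S`. -/
noncomputable def extMod (S : Type u) [CommRing S] (n : ℕ)
    (A : Type u) [AddCommGroup A] [Module S A] (B : Type u) [AddCommGroup B] [Module S B] :
    ModuleCat.{u} S :=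
  ((Ext S (ModuleCat.{u} S) n).obj (Opposite.op (ModuleCat.of S A))).obj (ModuleCat.of S B)

/-- `moduleGrade S M = inf { n | Ext_S^n(M, S) ≠ 0 }`. -/
noncomputable def moduleGrade (S : Type u) [CommRing S]
    (M : Type u) [AddCommGroup M] [Module S M] : ℕ :=
  sInf {n : ℕ | ¬ Subsingleton (extMod S n M S)}

/-- A Noetherian local ring is regular if its maximal ideal can be generated by
`dim R` many elements. -/
def IsRegularLocal (R : Type u) [CommRing R] [IsLocalRing R] : Prop :=
  IsNoetherianRing R ∧ ∃ s : Finset R, Ideal.span (s : Set R) = maximalIdeal R ∧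
    ((s.card : ℕ∞) : WithBot ℕ∞) = ringKrullDim R

/-- A complex of finite free modules over `P`, given by matrices. -/
structure FreeCx (P : Type*) [CommRing P] where
  /-- the ranks -/
  rk : ℕ → ℕ
  /-- the differentials -/
  mat : ∀ i, Matrix (Fin (rk i)) (Fin (rk (i + 1))) P
  mul_mat : ∀ i, mat i * mat (i + 1) = 0

namespace FreeCx

variable {P : Type*} [CommRing P] (G : FreeCx P)
variable (A : Type*) [AddCommGroup A] [Module P A]
variable {B : Type*} [AddCommGroup B] [Module P B]
variable {C : Type*} [AddCommGroup C] [Module P C]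

/-- The differential of `G ⊗ A`. -/
def d (i : ℕ) : (Fin (G.rk (i + 1)) → A) →ₗ[P] (Fin (G.rk i) → A) :=
  LinearMap.pi fun j => ∑ k, G.mat i j k • LinearMap.proj k

variable {A}

lemma d_apply (i : ℕ) (v : Fin (G.rk (i + 1)) → A) (j : Fin (G.rk i)) :
    G.d A i v j = ∑ k, G.mat i j k • v k := by
  simp [d, LinearMap.sum_apply]

lemma d_d (i : ℕ) (v : Fin (G.rk (i + 1 + 1)) → A) : G.d A i (G.d A (i + 1) v) = 0 := by
  ext j
  simp only [d_apply, Finset.smul_sum, smul_smul, Pi.zero_apply]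
  rw [Finset.sum_comm]
  refine Finset.sum_eq_zero fun k _ => ?_
  rw [← Finset.sum_smul, ← Matrix.mul_apply, G.mul_mat, Matrix.zero_apply, zero_smul]

lemma d_map (f : A →ₗ[P] B) (i : ℕ) (v : Fin (G.rk (i + 1)) → A) :
    G.d B i (f ∘ v) = f ∘ (G.d A i v) := by
  ext j
  simp [d_apply]

variable (A)

/-- The homology of `G ⊗ A` at the spot `i + 1`. -/
abbrev T (i : ℕ) : Type _ :=
  LinearMap.ker (G.d A i) ⧸ (LinearMap.range (G.d A (i + 1))).submoduleOf (LinearMap.ker (G.d A i))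

variable {A}

/-- The class of a cycle. -/
def cls (i : ℕ) (v : Fin (G.rk (i + 1)) → A) (h : G.d A i v = 0) : G.T A i :=
  Submodule.Quotient.mk ⟨v, h⟩

lemma exists_cls {i : ℕ} (t : G.T A i) : ∃ v h, t = G.cls i v h := by
  obtain ⟨⟨v, h⟩, rfl⟩ := Submodule.Quotient.mk_surjective _ t
  exact ⟨v, h, rfl⟩

lemma cls_eq_zero {i : ℕ} {v : Fin (G.rk (i + 1)) → A} {h : G.d A i v = 0} :
    G.cls i v h = 0 ↔ ∃ w, G.d A (i + 1) w = v := by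
  rw [cls, Submodule.Quotient.mk_eq_zero]
  rfl

lemma cls_sub {i : ℕ} {v w : Fin (G.rk (i + 1)) → A} {h : G.d A i v = 0} {h' : G.d A i w = 0} :
    G.cls i v h - G.cls i w h' = G.cls i (v - w) (by rw [map_sub, h, h', sub_zero]) := rfl

lemma cls_smul {i : ℕ} {v : Fin (G.rk (i + 1)) → A} {h : G.d A i v = 0} (r : P) :
    r • G.cls i v h = G.cls i (r • v) (by rw [map_smul, h, smul_zero]) := rfl

/-- The map induced on homology. -/
def map (f : A →ₗ[P] B) (i : ℕ) : G.T A i →ₗ[P] G.T B i :=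
  Submodule.mapQ _ _
    (LinearMap.restrict (p := LinearMap.ker (G.d A i)) (q := LinearMap.ker (G.d B i))
      (f.compLeft (Fin (G.rk (i + 1)))) (by
        intro v hv
        have : G.d A i v = 0 := hv
        change G.d B i (f ∘ v) = 0
        rw [d_map, this]; ext; simp))
    (by
      rintro ⟨v, hv⟩ ⟨w, hw⟩
      refine ⟨f ∘ w, ?_⟩
      rw [d_map, hw]; rfl)

lemma comp_cycle (f : A →ₗ[P] B) {i : ℕ} {v : Fin (G.rk (i + 1)) → A} (h : G.d A i v = 0) :
    G.d B i (f ∘ v) = 0 := by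
  rw [d_map, h]; ext; simp

lemma map_cls (f : A →ₗ[P] B) {i : ℕ} {v : Fin (G.rk (i + 1)) → A} (h : G.d A i v = 0) :
    G.map f i (G.cls i v h) = G.cls i (f ∘ v) (G.comp_cycle f h) := rfl

lemma map_lsmul (r : P) (i : ℕ) (t : G.T A i) :
    G.map (LinearMap.lsmul P A r) i t = r • t := by
  obtain ⟨v, h, rfl⟩ := G.exists_cls t
  rfl

instance [IsNoetherianRing P] [Module.Finite P A] (i : ℕ) : Module.Finite P (G.T A i) := by
  infer_instance

lemma subsingleton_of_subsingleton [Subsingleton A] (i : ℕ) : Subsingleton (G.T A i) := by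
  infer_instance

lemma subsingleton_T_iff {i : ℕ} : Subsingleton (G.T A i) ↔
    ∀ v, G.d A i v = 0 → ∃ w, G.d A (i + 1) w = v := by
  constructor
  · intro h v hv
    exact (G.cls_eq_zero (h := hv)).1 (Subsingleton.elim _ _)
  · intro h
    refine subsingleton_of_forall_eq 0 fun t => ?_
    obtain ⟨v, hv, rfl⟩ := G.exists_cls t
    exact G.cls_eq_zero.2 (h v hv)

section LES

variable (f : A →ₗ[P] B) (g : B →ₗ[P] C) (hf : Function.Injective f) (hg : Function.Surjective g)
  (hfg : Function.Exact f g)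

include hfg in
lemma lift_comp {n : ℕ} (v : Fin n → B) (h : g ∘ v = 0) : ∃ w : Fin n → A, f ∘ w = v := by
  choose w hw using fun j => (hfg (v j)).1 (congrFun h j)
  exact ⟨w, funext hw⟩

include hg in
lemma lift_surj {n : ℕ} (v : Fin n → C) : ∃ w : Fin n → B, g ∘ w = v := by
  choose w hw using fun j => hg (v j)
  exact ⟨w, funext hw⟩

include hf hg hfg in
lemma exact_map (i : ℕ) : Function.Exact (G.map f i) (G.map g i) := by
  have hgf : g ∘ₗ f = 0 := hfg.linearMap_comp_eq_zero
  intro t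
  obtain ⟨v, h, rfl⟩ := G.exists_cls t
  constructor
  · intro h0
    rw [map_cls, cls_eq_zero] at h0
    obtain ⟨w, hw⟩ := h0
    obtain ⟨w', rfl⟩ := lift_surj g hg w
    rw [d_map] at hw
    obtain ⟨z, hz⟩ := lift_comp f g hfg (v - G.d B (i + 1) w') (by
      ext j; simpa [sub_eq_zero] using (congrFun hw j).symm)
    have hz0 : G.d A i z = 0 := by
      have : f ∘ (G.d A i z) = 0 := by rw [← d_map, hz, map_sub, h, d_d, sub_zero]
      ext j
      exact hf (by simpa using congrFun this j)
    refine ⟨G.cls i z hz0, ?_⟩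
    rw [map_cls, ← sub_eq_zero, cls_sub, cls_eq_zero]
    refine ⟨-w', ?_⟩
    rw [hz, map_neg]; abel
  · rintro ⟨s, hs⟩
    rw [← hs]
    obtain ⟨w, h', rfl⟩ := G.exists_cls s
    rw [map_cls, map_cls, cls_eq_zero]
    refine ⟨0, ?_⟩
    ext j
    simpa using (LinearMap.congr_fun hgf (w j)).symm

include hf hg hfg in
lemma exists_delta (i : ℕ) : ∃ δ : G.T C (i + 1) →ₗ[P] G.T A i,
    Function.Exact (G.map g (i + 1)) δ ∧ Function.Exact δ (G.map f i) := by
  have hgf : g ∘ₗ f = 0 := hfg.linearMap_comp_eq_zero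
  have hgf' : ∀ x, g (f x) = 0 := fun x => LinearMap.congr_fun hgf x
  have hinj : ∀ {n : ℕ} (v w : Fin n → A), f ∘ v = f ∘ w → v = w := fun v w h =>
    funext fun j => hf (congrFun h j)
  have ex : ∀ x : LinearMap.ker (G.d C (i + 1)), ∃ (y : Fin (G.rk (i + 1 + 1)) → B)
      (z : Fin (G.rk (i + 1)) → A), g ∘ y = x.1 ∧ f ∘ z = G.d B (i + 1) y ∧ G.d A i z = 0 := by
    rintro ⟨x, hx⟩
    have hx : G.d C (i + 1) x = 0 := hx
    obtain ⟨y, rfl⟩ := lift_surj g hg x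
    rw [d_map] at hx
    obtain ⟨z, hz⟩ := lift_comp f g hfg _ hx
    refine ⟨y, z, rfl, hz, ?_⟩
    apply hinj
    rw [← d_map, hz, d_d]; ext; simp
  choose y z hy hz hz0 using ex
  have key : ∀ (x : LinearMap.ker (G.d C (i + 1))) (y' : Fin (G.rk (i + 1 + 1)) → B)
      (z' : Fin (G.rk (i + 1)) → A) (h0 : G.d A i z' = 0) (_ : ∃ w, g ∘ y' - x.1 = G.d C (i + 1 + 1) w)
      (_ : f ∘ z' = G.d B (i + 1) y'),
      G.cls i (z x) (hz0 x) = G.cls i z' h0 := by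
    intro x y' z' h0 h1 h2
    obtain ⟨w, hw⟩ := h1
    obtain ⟨w', rfl⟩ := lift_surj g hg w
    rw [d_map] at hw
    obtain ⟨a, ha⟩ := lift_comp f g hfg (y x - y' + G.d B (i + 1 + 1) w') (by
      ext j
      have h1 := congrFun hw j
      have h2 := congrFun (hy x) j
      simp only [Pi.sub_apply, Function.comp_apply, Pi.add_apply, map_add, map_sub,
        Pi.zero_apply] at *
      rw [h2, ← h1]; abel)
    rw [← sub_eq_zero, cls_sub, cls_eq_zero]
    refine ⟨a, hinj _ _ ?_⟩
    rw [← d_map, ha, map_add, map_sub, d_d, add_zero, ← hz, ← h2]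
    ext; simp
  let δ₀ : LinearMap.ker (G.d C (i + 1)) →ₗ[P] G.T A i :=
    { toFun := fun x => G.cls i (z x) (hz0 x)
      map_add' := by
        intro a b
        refine key (a + b) (y a + y b) (z a + z b) (by rw [map_add, hz0, hz0, add_zero]) ⟨0, ?_⟩ ?_
        · ext j
          have h1 := congrFun (hy a) j
          have h2 := congrFun (hy b) j
          simp only [Function.comp_apply] at h1 h2
          simp [h1, h2]
        · rw [map_add, ← hz, ← hz]; ext; simp
      map_smul' := by
        intro r a
        refine key (r • a) (r • y a) (r • z a) (by rw [map_smul, hz0, smul_zero]) ⟨0, ?_⟩ ?_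
        · ext j
          have h1 := congrFun (hy a) j
          simp only [Function.comp_apply] at h1
          simp [h1]
        · rw [map_smul, ← hz]; ext; simp }
  have hδ₀ : ∀ x, δ₀ x = G.cls i (z x) (hz0 x) := fun x => rfl
  let δ : G.T C (i + 1) →ₗ[P] G.T A i := Submodule.liftQ _ δ₀ (by
    rintro ⟨x, hx⟩ ⟨w, hw⟩
    change δ₀ _ = 0
    rw [hδ₀, key ⟨x, hx⟩ 0 0 (map_zero _) ⟨-w, by rw [map_neg, hw]; ext; simp⟩
      (by rw [map_zero]; ext; simp)]
    exact G.cls_eq_zero.2 ⟨0, map_zero _⟩)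
  have hδ : ∀ x hx, δ (G.cls (i + 1) x hx) = G.cls i (z ⟨x, hx⟩) (hz0 ⟨x, hx⟩) := fun x hx => rfl
  refine ⟨δ, ?_, ?_⟩
  · intro t
    obtain ⟨v, h, rfl⟩ := G.exists_cls t
    constructor
    · intro h0
      rw [hδ, cls_eq_zero] at h0
      obtain ⟨w, hw⟩ := h0
      have h1 := hz ⟨v, h⟩
      rw [← hw, ← d_map] at h1
      refine ⟨G.cls (i + 1) (y ⟨v, h⟩ - f ∘ w) (by rw [map_sub, h1, sub_self]), ?_⟩
      rw [map_cls, ← sub_eq_zero, cls_sub, cls_eq_zero]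
      refine ⟨0, ?_⟩
      ext j
      have h2 := congrFun (hy ⟨v, h⟩) j
      simp only [Function.comp_apply] at h2
      simp [h2, hgf']
    · rintro ⟨s, hs⟩
      rw [← hs]
      obtain ⟨w, h', rfl⟩ := G.exists_cls s
      rw [map_cls, hδ, key _ w 0 (map_zero _) ⟨0, by simp⟩ (by rw [h']; ext; simp)]
      exact G.cls_eq_zero.2 ⟨0, map_zero _⟩
  · intro t
    obtain ⟨v, h, rfl⟩ := G.exists_cls t
    constructor
    · intro h0
      rw [map_cls, cls_eq_zero] at h0
      obtain ⟨w, hw⟩ := h0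
      have hc : G.d C (i + 1) (g ∘ w) = 0 := by
        rw [d_map, hw]; ext; simp [hgf']
      exact ⟨G.cls (i + 1) (g ∘ w) hc, by
        rw [hδ, key _ w v h ⟨0, by simp⟩ hw.symm]⟩
    · rintro ⟨s, hs⟩
      rw [← hs]
      obtain ⟨w, h', rfl⟩ := G.exists_cls s
      rw [hδ, map_cls, cls_eq_zero]
      exact ⟨y ⟨w, h'⟩, (hz _).symm⟩

include hg in
lemma map_zero_surjective (h0 : G.rk 0 = 0) : Function.Surjective (G.map g 0) := by
  intro t
  obtain ⟨v, h, rfl⟩ := G.exists_cls t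
  obtain ⟨w, rfl⟩ := lift_surj g hg v
  have : IsEmpty (Fin (G.rk 0)) := by rw [h0]; infer_instance
  exact ⟨G.cls 0 w (Subsingleton.elim _ _), rfl⟩

end LES

lemma map_map (g : B →ₗ[P] C) (f : A →ₗ[P] B) (i : ℕ) (t : G.T A i) :
    G.map g i (G.map f i t) = G.map (g ∘ₗ f) i t := by
  obtain ⟨v, h, rfl⟩ := G.exists_cls t
  rfl

lemma map_id (i : ℕ) (t : G.T A i) : G.map (LinearMap.id : A →ₗ[P] A) i t = t := by
  obtain ⟨v, h, rfl⟩ := G.exists_cls t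
  rfl

/-- Isomorphic modules have isomorphic homology. -/
def congr (e : A ≃ₗ[P] B) (i : ℕ) : G.T A i ≃ₗ[P] G.T B i where
  __ := G.map e.toLinearMap i
  invFun := G.map e.symm.toLinearMap i
  left_inv t := (G.map_map _ _ i t).trans (by
    rw [show e.symm.toLinearMap ∘ₗ e.toLinearMap = LinearMap.id by ext; simp, map_id])
  right_inv t := (G.map_map _ _ i t).trans (by
    rw [show e.toLinearMap ∘ₗ e.symm.toLinearMap = LinearMap.id by ext; simp, map_id])

end FreeCx

section KosChi

open Function Pointwise

variable {P : Type*} [CommRing P]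

/-- `H / (us) H` has finite length. -/
def KosFin : List P → ∀ (H : Type u) [AddCommGroup H] [Module P H], Prop
  | [], H, _, _ => Module.length P H ≠ ⊤
  | x :: us, H, _, _ => KosFin us (QuotSMulTop x H)

/-- The Koszul Euler characteristic of `H` with respect to `us`. -/
noncomputable def kosChi : List P → ∀ (H : Type u) [AddCommGroup H] [Module P H], ℤ
  | [], H, _, _ => ((Module.length P H).toNat : ℤ)
  | x :: us, H, _, _ => kosChi us (QuotSMulTop x H) - kosChi us (Submodule.torsionBy P H x)

variable {A B C : Type u} [AddCommGroup A] [Module P A] [AddCommGroup B] [Module P B]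
  [AddCommGroup C] [Module P C]

/-- The restriction to `x`-torsion. -/
def LinearMap.torsionByMap (x : P) (f : A →ₗ[P] B) :
    Submodule.torsionBy P A x →ₗ[P] Submodule.torsionBy P B x :=
  f.restrict fun a ha => by
    rw [Submodule.mem_torsionBy_iff] at ha ⊢
    rw [← map_smul, ha, map_zero]

/-- An isomorphism restricts to the `x`-torsion. -/
def LinearEquiv.torsionByCongr (x : P) (e : A ≃ₗ[P] B) :
    Submodule.torsionBy P A x ≃ₗ[P] Submodule.torsionBy P B x where
  __ := e.toLinearMap.torsionByMap x
  invFun := e.symm.toLinearMap.torsionByMap x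
  left_inv a := by ext; simp [LinearMap.torsionByMap]
  right_inv a := by ext; simp [LinearMap.torsionByMap]

lemma kosChi_congr (us : List P) (e : A ≃ₗ[P] B) : kosChi us A = kosChi us B := by
  induction us generalizing A B with
  | nil => simp only [kosChi, e.length_eq]
  | cons x us ih =>
    simp only [kosChi]
    rw [ih (QuotSMulTop.congr x e), ih (e.torsionByCongr x)]

lemma KosFin.of_surjective {us : List P} (h : KosFin us A) (f : A →ₗ[P] B) (hf : Surjective f) :
    KosFin us B := by
  induction us generalizing A B with
  | nil => exact ne_top_of_le_ne_top h (Module.length_le_of_surjective f hf)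
  | cons x us ih => exact ih h (QuotSMulTop.map x f) (QuotSMulTop.map_surjective x hf)

lemma KosFin.congr {us : List P} (h : KosFin us A) (e : A ≃ₗ[P] B) : KosFin us B :=
  h.of_surjective e.toLinearMap e.surjective

lemma KosFin.of_subsingleton (us : List P) [Subsingleton A] : KosFin us A := by
  induction us generalizing A with
  | nil => simp [KosFin, Module.length_eq_zero]
  | cons x us ih => exact ih

variable [IsNoetherianRing P]

omit [IsNoetherianRing P] in
lemma exact_quotient_smul_pow (x : P) (n : ℕ) :
    ∃ (f : QuotSMulTop x B →ₗ[P] B ⧸ (x ^ (n + 1) • (⊤ : Submodule P B)))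
      (g : (B ⧸ (x ^ (n + 1) • (⊤ : Submodule P B))) →ₗ[P] B ⧸ (x ^ n • (⊤ : Submodule P B))),
      Exact f g ∧ Surjective g := by
  have hle : x ^ (n + 1) • (⊤ : Submodule P B) ≤ x ^ n • (⊤ : Submodule P B) := by
    intro a ha
    obtain ⟨c, -, rfl⟩ := Submodule.mem_smul_pointwise_iff_exists _ _ _ |>.1 ha
    rw [pow_succ, mul_smul]
    exact Submodule.smul_mem_pointwise_smul _ _ _ trivial
  refine ⟨Submodule.mapQ (x • ⊤) (x ^ (n + 1) • (⊤ : Submodule P B))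
      (LinearMap.lsmul P B (x ^ n)) ?_, Submodule.factor hle, ?_,
      Submodule.factor_surjective hle⟩
  · rintro b hb
    obtain ⟨c, -, rfl⟩ := Submodule.mem_smul_pointwise_iff_exists _ _ _ |>.1 hb
    refine Submodule.mem_smul_pointwise_iff_exists _ _ _ |>.2 ⟨c, trivial, ?_⟩
    rw [LinearMap.lsmul_apply, smul_comm, pow_succ', mul_smul]
  · intro b
    obtain ⟨b, rfl⟩ := Submodule.Quotient.mk_surjective _ b
    rw [show (Submodule.factor hle) (Submodule.Quotient.mk b) = Submodule.Quotient.mk b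
      from rfl, Submodule.Quotient.mk_eq_zero, Submodule.mem_smul_pointwise_iff_exists]
    constructor
    · rintro ⟨c, -, rfl⟩
      exact ⟨Submodule.Quotient.mk c, rfl⟩
    · rintro ⟨c, hc⟩
      obtain ⟨c, rfl⟩ := Submodule.Quotient.mk_surjective _ c
      rw [Submodule.mapQ_apply, Submodule.Quotient.eq] at hc
      have h1 := Submodule.sub_mem _
        (Submodule.smul_mem_pointwise_smul c (x ^ n) ⊤ trivial) (hle hc)
      rw [LinearMap.lsmul_apply, sub_sub_cancel] at h1
      exact Submodule.mem_smul_pointwise_iff_exists _ _ _ |>.1 h1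

lemma exists_comap_smul_pow_le [Module.Finite P B] (x : P) (f : A →ₗ[P] B) (hf : Injective f) :
    ∃ n : ℕ, (x ^ n • (⊤ : Submodule P B)).comap f ≤ x • (⊤ : Submodule P A) := by
  obtain ⟨k, hk⟩ := Ideal.exists_pow_inf_eq_pow_smul (Ideal.span {x}) (LinearMap.range f)
  refine ⟨k + 1, fun a ha => ?_⟩
  have hk := hk (k + 1) (by omega)
  rw [Nat.add_sub_cancel_left, pow_one, Ideal.span_singleton_pow,
    Submodule.ideal_span_singleton_smul, Submodule.ideal_span_singleton_smul] at hk
  have : f a ∈ x ^ (k + 1) • (⊤ : Submodule P B) ⊓ LinearMap.range f := ⟨ha, a, rfl⟩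
  rw [hk] at this
  obtain ⟨b, hb, hb'⟩ := Submodule.mem_smul_pointwise_iff_exists _ _ _ |>.1 this
  obtain ⟨c, rfl⟩ := hb.2
  rw [← map_smul] at hb'
  rw [← hf hb']
  exact Submodule.smul_mem_pointwise_smul _ _ _ trivial

lemma KosFin.submodule_and_extension (us : List P) :
    (∀ (A B : Type u) [AddCommGroup A] [Module P A] [AddCommGroup B] [Module P B]
      [Module.Finite P B] (f : A →ₗ[P] B), Injective f → KosFin us B → KosFin us A) ∧
    (∀ (A B C : Type u) [AddCommGroup A] [Module P A] [AddCommGroup B] [Module P B]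
      [AddCommGroup C] [Module P C] [Module.Finite P B] (f : A →ₗ[P] B) (g : B →ₗ[P] C),
      Exact f g → Surjective g → KosFin us A → KosFin us C → KosFin us B) := by
  induction us with
  | nil =>
    refine ⟨fun A B _ _ _ _ _ f hf h => ?_, fun A B C _ _ _ _ _ _ _ f g hfg hg hA hC => ?_⟩
    · exact ne_top_of_le_ne_top h (Module.length_le_of_injective f hf)
    · have h1 := Module.length_eq_add_of_exact (LinearMap.range f).subtype g
        (Submodule.subtype_injective _) hg (by
          rw [LinearMap.exact_iff, Submodule.range_subtype, LinearMap.exact_iff.1 hfg])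
      have h2 := Module.length_le_of_surjective f.rangeRestrict f.surjective_rangeRestrict
      have h3 : Module.length P (LinearMap.range f) ≠ ⊤ := ne_top_of_le_ne_top hA h2
      have hC : Module.length P C ≠ ⊤ := hC
      change Module.length P B ≠ ⊤
      rw [h1]
      exact WithTop.add_ne_top.2 ⟨h3, hC⟩
  | cons x us ih =>
    obtain ⟨ih1, ih2⟩ := ih
    refine ⟨fun A B _ _ _ _ _ f hf h => ?_, fun A B C _ _ _ _ _ _ _ f g hfg hg hA hC => ?_⟩
    · have hpow : ∀ n : ℕ, KosFin us (B ⧸ (x ^ n • (⊤ : Submodule P B))) := by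
        intro n
        induction n with
        | zero =>
          have : Subsingleton (B ⧸ (x ^ 0 • (⊤ : Submodule P B))) := by
            rw [pow_zero, one_smul]; infer_instance
          exact KosFin.of_subsingleton us
        | succ n ihn =>
          obtain ⟨f', g', h1, h2⟩ := exact_quotient_smul_pow (B := B) x n
          exact ih2 _ _ _ f' g' h1 h2 h ihn
      obtain ⟨n, hle⟩ := exists_comap_smul_pow_le x f hf
      have h3 : Injective (Submodule.mapQ ((x ^ n • (⊤ : Submodule P B)).comap f)
          (x ^ n • (⊤ : Submodule P B)) f le_rfl) := by
        rw [← LinearMap.ker_eq_bot, Submodule.ker_mapQ, Submodule.mkQ_map_self]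
      have h4 := ih1 _ _ _ h3 (hpow n)
      change KosFin us (QuotSMulTop x A)
      exact KosFin.of_surjective h4 (Submodule.factor hle) (Submodule.factor_surjective hle)
    · change KosFin us (QuotSMulTop x B)
      exact ih2 _ _ _ (QuotSMulTop.map x f) (QuotSMulTop.map x g) (QuotSMulTop.map_exact x hfg hg)
        (QuotSMulTop.map_surjective x hg) hA hC

variable [Module.Finite P A] [Module.Finite P B] [Module.Finite P C]

omit [Module.Finite P A] in
lemma KosFin.of_injective {us : List P} (h : KosFin us B) (f : A →ₗ[P] B) (hf : Injective f) :
    KosFin us A :=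
  (KosFin.submodule_and_extension us).1 _ _ f hf h

omit [Module.Finite P A] [Module.Finite P C] in
lemma KosFin.of_exact {us : List P} (hA : KosFin us A) (hC : KosFin us C) (f : A →ₗ[P] B)
    (g : B →ₗ[P] C) (h : Exact f g) (hg : Surjective g) : KosFin us B :=
  (KosFin.submodule_and_extension us).2 _ _ _ f g h hg hA hC

lemma KosFin.torsionBy {x : P} {us : List P} (h : KosFin (x :: us) A) :
    KosFin us (Submodule.torsionBy P A x) := by
  have h1 : KosFin us (QuotSMulTop x (Submodule.torsionBy P A x)) :=
    KosFin.of_injective (us := x :: us) h (Submodule.torsionBy P A x).subtype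
      (Submodule.subtype_injective _)
  refine h1.congr (Submodule.quotEquivOfEqBot _ ?_)
  rw [eq_bot_iff]
  rintro a ha
  obtain ⟨b, -, rfl⟩ := Submodule.mem_smul_pointwise_iff_exists _ _ _ |>.1 ha
  ext
  simp

omit [IsNoetherianRing P] [Module.Finite P A] [Module.Finite P B] [Module.Finite P C] in
lemma SnakeLemma.exists_delta_torsionBy (x : P) (f : A →ₗ[P] B) (g : B →ₗ[P] C)
    (hf : Injective f) (hg : Surjective g) (hfg : Exact f g) :
    ∃ δ : Submodule.torsionBy P C x →ₗ[P] QuotSMulTop x A,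
      Exact (g.torsionByMap x) δ ∧ Exact δ (QuotSMulTop.map x f) := by
  have hι : ∀ (D : Type u) [AddCommGroup D] [Module P D],
      Exact (Submodule.torsionBy P D x).subtype (LinearMap.lsmul P D x) := by
    intro D _ _ d
    simp
  have hπ : ∀ (D : Type u) [AddCommGroup D] [Module P D],
      Exact (LinearMap.lsmul P D x) (Submodule.mkQ (x • (⊤ : Submodule P D))) := by
    intro D _ _ d
    rw [Submodule.mkQ_apply, Submodule.Quotient.mk_eq_zero, Submodule.mem_smul_pointwise_iff_exists]
    simp
  have h1 : f.comp (LinearMap.lsmul P A x) = (LinearMap.lsmul P B x).comp f := by ext; simp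
  have h2 : g.comp (LinearMap.lsmul P B x) = (LinearMap.lsmul P C x).comp g := by ext; simp
  exact ⟨SnakeLemma.δ' _ _ _ f g hfg f g hfg h1 h2 _ (hι C) _ (hπ A) hg hf,
    SnakeLemma.exact_δ'_right (ι₂ := (Submodule.torsionBy P B x).subtype) (hι₂ := hι B)
      (h₁ := h1) (h₂ := h2) (F := g.torsionByMap x) (hF := by ext; rfl)
      (hf := hfg) (hg := hfg) (hι₃ := hι C) (hπ₁ := hπ A) (hf₂ := hg) (hg₁ := hf) (h := Submodule.subtype_injective _),
    SnakeLemma.exact_δ'_left (π₂ := Submodule.mkQ (x • (⊤ : Submodule P B))) (hπ₂ := hπ B)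
      (h₁ := h1) (h₂ := h2) (G := QuotSMulTop.map x f) (hF := by ext; rfl)
      (hf := hfg) (hg := hfg) (hι₃ := hι C) (hπ₁ := hπ A) (hf₂ := hg) (hg₁ := hf) (h := Submodule.mkQ_surjective _)⟩

theorem kosChi_eq_add (us : List P) : ∀ (A B C : Type u) [AddCommGroup A] [Module P A]
    [AddCommGroup B] [Module P B] [AddCommGroup C] [Module P C] [Module.Finite P A]
    [Module.Finite P B] [Module.Finite P C] (f : A →ₗ[P] B) (g : B →ₗ[P] C),
    Injective f → Surjective g → Exact f g → KosFin us B →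
    kosChi us B = kosChi us A + kosChi us C := by
  induction us with
  | nil =>
    intro A B C _ _ _ _ _ _ _ _ _ f g hf hg hfg h
    have h1 := Module.length_eq_add_of_exact f g hf hg hfg
    have h : Module.length P B ≠ ⊤ := h
    rw [h1] at h
    replace h := WithTop.add_ne_top.1 h
    simp only [kosChi]
    rw [h1, ENat.toNat_add h.1 h.2, Nat.cast_add]
  | cons x us ih =>
    intro A B C _ _ _ _ _ _ _ _ _ f g hf hg hfg h
    have ker_range : ∀ (X Y : Type u) [AddCommGroup X] [Module P X] [AddCommGroup Y] [Module P Y]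
        [Module.Finite P X] [Module.Finite P Y] (φ : X →ₗ[P] Y), KosFin us X →
        kosChi us X = kosChi us (LinearMap.ker φ) + kosChi us (LinearMap.range φ) :=
      fun X Y _ _ _ _ _ _ φ hX => ih _ _ _ (LinearMap.ker φ).subtype φ.rangeRestrict
        (Submodule.subtype_injective _) φ.surjective_rangeRestrict (fun y => by
          rw [← Subtype.val_inj]; simp) hX
    have hA : KosFin (x :: us) A := h.of_injective f hf
    have hC : KosFin (x :: us) C := KosFin.of_surjective h g hg
    obtain ⟨δ, hδ1, hδ2⟩ := SnakeLemma.exists_delta_torsionBy x f g hf hg hfg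
    have e1 := ker_range _ _ (f.torsionByMap x) hA.torsionBy
    have e2 := ker_range _ _ (g.torsionByMap x) h.torsionBy
    have e3 := ker_range _ _ δ hC.torsionBy
    have e4 := ker_range _ _ (QuotSMulTop.map x f) hA
    have e5 := ker_range _ _ (QuotSMulTop.map x g) h
    have hx1 : Exact (f.torsionByMap x) (g.torsionByMap x) := by
      intro b
      constructor
      · intro hb
        obtain ⟨a, ha⟩ := (hfg b.1).1 (congrArg Subtype.val hb)
        refine ⟨⟨a, ?_⟩, Subtype.ext ha⟩
        rw [Submodule.mem_torsionBy_iff]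
        apply hf
        rw [map_smul, ha, map_zero, ← Submodule.mem_torsionBy_iff]
        exact b.2
      · rintro ⟨a, rfl⟩
        exact Subtype.ext (hfg.apply_apply_eq_zero a.1)
    have hx2 := QuotSMulTop.map_exact x hfg hg
    rw [LinearMap.exact_iff.1 hx1] at e2
    rw [LinearMap.exact_iff.1 hδ1] at e3
    rw [LinearMap.exact_iff.1 hδ2] at e4
    rw [LinearMap.exact_iff.1 hx2] at e5
    have e6 : kosChi us (LinearMap.range (QuotSMulTop.map x g)) = kosChi us (QuotSMulTop x C) :=
      kosChi_congr us (LinearEquiv.ofTop _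
        (LinearMap.range_eq_top.2 (QuotSMulTop.map_surjective x hg)))
    have e7 : kosChi us (LinearMap.ker (f.torsionByMap x)) = 0 := by
      have hinj : LinearMap.ker (f.torsionByMap x) = ⊥ := by
        rw [LinearMap.ker_eq_bot]
        exact fun a b hab => Subtype.ext (hf (congrArg Subtype.val hab))
      rw [hinj]
      have := ih PUnit PUnit PUnit (0 : PUnit.{u+1} →ₗ[P] PUnit.{u+1})
        (0 : PUnit.{u+1} →ₗ[P] PUnit.{u+1}) (fun _ _ _ => rfl) (fun _ => ⟨0, rfl⟩)
        (fun _ => by simp) (KosFin.of_subsingleton us)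
      have h2 : kosChi us (⊥ : Submodule P (Submodule.torsionBy P A x)) = kosChi us PUnit.{u+1} :=
        kosChi_congr us
          { toFun := fun _ => 0, map_add' := fun _ _ => rfl, map_smul' := fun _ _ => rfl
            invFun := fun _ => 0, left_inv := fun _ => Subsingleton.elim _ _
            right_inv := fun _ => Subsingleton.elim _ _ }
      omega
    simp only [kosChi]
    omega

end KosChi

section KosDefect

open Function Pointwise RingTheory.Sequence

variable {P : Type*} [CommRing P] [IsNoetherianRing P]
variable {A B C : Type u} [AddCommGroup A] [Module P A] [AddCommGroup B] [Module P B]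
  [AddCommGroup C] [Module P C] [Module.Finite P A] [Module.Finite P B]

lemma kosChi_of_subsingleton (us : List P) [Subsingleton A] : kosChi us A = 0 := by
  have := kosChi_eq_add us A A A 0 0 (fun _ _ _ => Subsingleton.elim _ _)
    (fun _ => ⟨0, Subsingleton.elim _ _⟩) (fun _ => by simp [Subsingleton.elim _ (0 : A)])
    (KosFin.of_subsingleton us)
  omega

lemma kosChi_quotSMulTop_eq (us : List P) (x : P) (h : KosFin us A) :
    kosChi us (QuotSMulTop x A) = kosChi us (Submodule.torsionBy P A x) := by
  have e1 := kosChi_eq_add us _ _ _ (Submodule.torsionBy P A x).subtype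
    (LinearMap.lsmul P A x).rangeRestrict (Submodule.subtype_injective _)
    (LinearMap.surjective_rangeRestrict _) (fun a => by rw [← Subtype.val_inj]; simp) h
  have e2 : _ = _ + kosChi us (QuotSMulTop x A) := kosChi_eq_add us _ _ _
    (LinearMap.range (LinearMap.lsmul P A x)).subtype
    (Submodule.mkQ (x • (⊤ : Submodule P A))) (Submodule.subtype_injective _)
    (Submodule.mkQ_surjective _) (fun a => by
      rw [Submodule.mkQ_apply, Submodule.Quotient.mk_eq_zero,
        Submodule.mem_smul_pointwise_iff_exists]
      simp) h
  omega

lemma exists_smul_pow_mem_stable (x : P) (p : Submodule P A) :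
    ∃ n : ℕ, ∀ a : A, x ^ (n + 1) • a ∈ p → x ^ n • a ∈ p := by
  have hmono : Monotone fun n : ℕ => p.comap (LinearMap.lsmul P A (x ^ n)) := by
    refine monotone_nat_of_le_succ fun n a ha => ?_
    simp only [Submodule.mem_comap, LinearMap.lsmul_apply] at ha ⊢
    rw [pow_succ', mul_smul]
    exact p.smul_mem x ha
  obtain ⟨n, hn⟩ := monotone_stabilizes_iff_noetherian.2 (inferInstance : IsNoetherian P A)
    ⟨_, hmono⟩
  refine ⟨n, fun a ha => ?_⟩
  have : a ∈ p.comap (LinearMap.lsmul P A (x ^ (n + 1))) := ha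
  have h2 := hn (n + 1) (by omega)
  simp only [OrderHom.coe_mk] at h2
  rw [← h2] at this
  exact this

lemma KosFin.of_torsionBy {us : List P} {x : P} (h : KosFin us (Submodule.torsionBy P A x))
    (n : ℕ) : KosFin us (Submodule.torsionBy P A (x ^ n)) := by
  induction n with
  | zero =>
    have : Subsingleton (Submodule.torsionBy P A (x ^ 0)) := by
      rw [pow_zero, Submodule.torsionBy_one]; infer_instance
    exact KosFin.of_subsingleton us
  | succ n ih =>
    let g : Submodule.torsionBy P A (x ^ (n + 1)) →ₗ[P] Submodule.torsionBy P A (x ^ n) :=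
      (LinearMap.lsmul P A x).restrict fun a ha => by
        rw [Submodule.mem_torsionBy_iff] at ha ⊢
        rw [LinearMap.lsmul_apply, ← mul_smul, ← pow_succ, ha]
    have hle : Submodule.torsionBy P A x ≤ Submodule.torsionBy P A (x ^ (n + 1)) := by
      intro a ha
      rw [Submodule.mem_torsionBy_iff] at ha ⊢
      rw [pow_succ, mul_smul, ha, smul_zero]
    refine KosFin.of_exact h (ih.of_injective (LinearMap.range g).subtype
      (Submodule.subtype_injective _)) (Submodule.inclusion hle) g.rangeRestrict ?_
      g.surjective_rangeRestrict
    rintro ⟨a, ha⟩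
    rw [← Subtype.val_inj, ← Subtype.val_inj]
    change x • a = 0 ↔ _
    constructor
    · intro h0
      exact ⟨⟨a, h0⟩, rfl⟩
    · rintro ⟨⟨b, hb⟩, hb'⟩
      have : b = a := congrArg Subtype.val hb'
      rw [← this]; exact hb

lemma KosFin.of_pow_smul_eq_zero {us : List P} {x : P} (h : KosFin (x :: us) A)
    (n : ℕ) (hn : ∀ a : A, x ^ n • a = 0) : KosFin us A := by
  refine (KosFin.of_torsionBy h.torsionBy n).congr (LinearEquiv.ofTop _ ?_)
  rw [eq_top_iff]
  exact fun a _ => hn a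

lemma kosChi_cons_eq_zero {us : List P} {x : P} (h : KosFin (x :: us) A)
    (n : ℕ) (hn : ∀ a : A, x ^ n • a = 0) : kosChi (x :: us) A = 0 := by
  simp only [kosChi]
  rw [kosChi_quotSMulTop_eq us x (h.of_pow_smul_eq_zero n hn), sub_self]

omit [IsNoetherianRing P] [Module.Finite P A] in
lemma subsingleton_torsionBy {x : P} (h : IsSMulRegular A x) :
    Subsingleton (Submodule.torsionBy P A x) := by
  refine ⟨fun a b => Subtype.ext (h ?_)⟩
  exact ((Submodule.mem_torsionBy_iff ..).1 a.2).trans ((Submodule.mem_torsionBy_iff ..).1 b.2).symm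

omit [Module.Finite P A] in
lemma kosChi_cons_of_isSMulRegular {us : List P} {x : P} (h : IsSMulRegular A x) :
    kosChi (x :: us) A = kosChi us (QuotSMulTop x A) := by
  have := subsingleton_torsionBy h
  simp only [kosChi]
  rw [kosChi_of_subsingleton us (A := Submodule.torsionBy P A x), sub_zero]

lemma kosChi_nonneg {us : List P} (h : KosFin us A) : 0 ≤ kosChi us A := by
  induction us generalizing A with
  | nil => exact Int.natCast_nonneg _
  | cons x us ih =>
    obtain ⟨n, hn⟩ := exists_smul_pow_mem_stable x (⊥ : Submodule P A)
    simp only [Submodule.mem_bot] at hn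
    set Γ := Submodule.torsionBy P A (x ^ n)
    have hreg : IsSMulRegular (A ⧸ Γ) x := by
      rw [isSMulRegular_quotient_iff_mem_of_smul_mem]
      intro a ha
      rw [Submodule.mem_torsionBy_iff] at ha ⊢
      apply hn
      rw [pow_succ, mul_smul, ha]
    have e := kosChi_eq_add (x :: us) _ _ _ Γ.subtype Γ.mkQ Γ.subtype_injective Γ.mkQ_surjective
      (fun a => by simp) h
    have hΓ : KosFin (x :: us) Γ := h.of_injective Γ.subtype Γ.subtype_injective
    rw [kosChi_cons_eq_zero hΓ n (fun a => Subtype.ext ((Submodule.mem_torsionBy_iff ..).1 a.2)),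
      zero_add, kosChi_cons_of_isSMulRegular (A := A ⧸ Γ) hreg] at e
    rw [e]
    have : KosFin (x :: us) (A ⧸ Γ) := KosFin.of_surjective h Γ.mkQ Γ.mkQ_surjective
    exact ih this

omit [IsNoetherianRing P] in
lemma subsingleton_of_quotSMulTop [IsLocalRing P] {x : P} (hx : x ∈ maximalIdeal P)
    (h : Subsingleton (QuotSMulTop x A)) : Subsingleton A := by
  rw [Submodule.Quotient.subsingleton_iff] at h
  rw [← Submodule.subsingleton_iff P, ← subsingleton_iff_bot_eq_top, eq_comm]
  refine Submodule.eq_bot_of_le_smul_of_le_jacobson_bot (Ideal.span {x}) _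
    (Module.finite_def.1 inferInstance) ?_ ?_
  · rw [Submodule.ideal_span_singleton_smul, h]
  · rw [IsLocalRing.jacobson_eq_maximalIdeal _ bot_ne_top, Ideal.span_singleton_le_iff_mem]
    exact hx

lemma subsingleton_of_kosChi_eq_zero [IsLocalRing P] {us : List P}
    (hus : ∀ x ∈ us, x ∈ maximalIdeal P) (hB : IsWeaklyRegular B us) (f : A →ₗ[P] B)
    (hf : Injective f) (hA : KosFin us A) (h0 : kosChi us A = 0) : Subsingleton A := by
  induction us generalizing A B with
  | nil =>
    have hA : Module.length P A ≠ ⊤ := hA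
    simp only [kosChi, Nat.cast_eq_zero, ENat.toNat_eq_zero, hA, or_false] at h0
    exact Module.length_eq_zero_iff.1 h0
  | cons x us ih =>
    rw [isWeaklyRegular_cons_iff] at hB
    obtain ⟨n, hn⟩ := exists_smul_pow_mem_stable x (LinearMap.range f)
    obtain ⟨L, hLdef⟩ : ∃ L : Submodule P B,
      L = (LinearMap.range f).comap (LinearMap.lsmul P B (x ^ n)) := ⟨_, rfl⟩
    have mem_L : ∀ b, b ∈ L ↔ x ^ n • b ∈ LinearMap.range f := fun b => by rw [hLdef]; rfl
    have : Module.Finite P L := Module.Finite.of_fg (IsNoetherian.noetherian L)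
    have hreg : IsSMulRegular B (x ^ n) := hB.1.pow n
    have hL : KosFin (x :: us) L := by
      have h1 : KosFin (x :: us) (LinearMap.range f) :=
        hA.congr (LinearEquiv.ofInjective f hf)
      refine h1.of_injective ((LinearMap.lsmul P B (x ^ n)).restrict (p := L)
        (q := LinearMap.range f) fun a ha => (mem_L a).1 ha) fun a b hab => Subtype.ext (hreg ?_)
      exact congrArg Subtype.val hab
    let i : A →ₗ[P] L := f.codRestrict L fun a => by
      rw [mem_L]
      rw [← map_smul]; exact ⟨_, rfl⟩
    have : Module.Finite P (L ⧸ LinearMap.range i) := Module.Finite.quotient P _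
    have hi : Injective i := fun a b hab => hf (congrArg Subtype.val hab)
    have e := kosChi_eq_add (x :: us) _ _ _ i (LinearMap.range i).mkQ hi
      (Submodule.mkQ_surjective _) (LinearMap.exact_map_mkQ_range i) hL
    have hLx : IsSMulRegular L x := hB.1.submodule L x
    have hQ : ∀ a : L ⧸ LinearMap.range i, x ^ n • a = 0 := by
      intro a
      obtain ⟨⟨a, haL⟩, rfl⟩ := Submodule.Quotient.mk_surjective _ a
      rw [← Submodule.Quotient.mk_smul, Submodule.Quotient.mk_eq_zero]
      obtain ⟨c, hc⟩ := (mem_L a).1 haL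
      exact ⟨c, Subtype.ext hc⟩
    rw [h0, kosChi_cons_eq_zero (KosFin.of_surjective hL _ (Submodule.mkQ_surjective _)) n hQ, add_zero,
      kosChi_cons_of_isSMulRegular hLx] at e
    · have hinj : Injective (QuotSMulTop.map x L.subtype) := by
        rw [← LinearMap.ker_eq_bot, LinearMap.ker_eq_bot']
        intro a ha
        obtain ⟨⟨a, haL⟩, rfl⟩ := Submodule.Quotient.mk_surjective _ a
        rw [QuotSMulTop.map_apply_mk, Submodule.Quotient.mk_eq_zero] at ha
        obtain ⟨b, -, hb⟩ := Submodule.mem_smul_pointwise_iff_exists _ _ _ |>.1 ha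
        have hb : x • b = a := hb
        have hbL : b ∈ L := by
          rw [mem_L]
          apply hn
          rw [pow_succ, mul_smul, hb]; exact (mem_L a).1 haL
        rw [Submodule.Quotient.mk_eq_zero]
        exact Submodule.mem_smul_pointwise_iff_exists _ _ _ |>.2 ⟨⟨b, hbL⟩, trivial, Subtype.ext hb⟩
      have h2 := ih (fun y hy => hus y (List.mem_cons_of_mem _ hy)) hB.2 _ hinj hL e
      have h3 : Subsingleton L := subsingleton_of_quotSMulTop (hus x List.mem_cons_self) h2
      exact hi.subsingleton

/-- `H / (us) H` is controlled by finite length modules at all stages. -/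
def KosGood : List P → ∀ (W : Type u) [AddCommGroup W] [Module P W], Prop
  | [], _, _, _ => True
  | x :: us, W, _, _ => KosGood us (QuotSMulTop x W) ∧ KosFin us (Submodule.torsionBy P W x)

/-- The failure of `us` to be a regular sequence on `W`. -/
noncomputable def kosDefect : List P → ∀ (W : Type u) [AddCommGroup W] [Module P W], ℤ
  | [], _, _, _ => 0
  | x :: us, W, _, _ => kosDefect us (QuotSMulTop x W) + kosChi us (Submodule.torsionBy P W x)

omit [IsNoetherianRing P] [Module.Finite P A] [Module.Finite P B] in
lemma KosGood.congr {us : List P} (h : KosGood us A) (e : A ≃ₗ[P] B) : KosGood us B := by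
  induction us generalizing A B with
  | nil => trivial
  | cons x us ih => exact ⟨ih h.1 (QuotSMulTop.congr x e), h.2.congr (e.torsionByCongr x)⟩

omit [IsNoetherianRing P] [Module.Finite P A] [Module.Finite P B] in
lemma kosDefect_congr (us : List P) (e : A ≃ₗ[P] B) : kosDefect us A = kosDefect us B := by
  induction us generalizing A B with
  | nil => rfl
  | cons x us ih =>
    simp only [kosDefect]
    rw [ih (QuotSMulTop.congr x e), kosChi_congr us (e.torsionByCongr x)]

lemma kosDefect_nonneg {us : List P} (h : KosGood us A) : 0 ≤ kosDefect us A := by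
  induction us generalizing A with
  | nil => exact le_rfl
  | cons x us ih => exact add_nonneg (ih h.1) (kosChi_nonneg h.2)

theorem isWeaklyRegular_of_kosDefect_eq_zero [IsLocalRing P] {us : List P}
    (hus : ∀ x ∈ us, x ∈ maximalIdeal P) (h : KosGood us A) (h0 : kosDefect us A = 0) :
    IsWeaklyRegular A us := by
  induction us generalizing A with
  | nil => exact IsWeaklyRegular.nil P A
  | cons x us ih =>
    have hus' : ∀ y ∈ us, y ∈ maximalIdeal P := fun y hy => hus y (List.mem_cons_of_mem _ hy)
    have h1 := kosDefect_nonneg h.1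
    have h2 := kosChi_nonneg h.2
    have h0 : kosDefect us (QuotSMulTop x A) + kosChi us (Submodule.torsionBy P A x) = 0 := h0
    have hreg := ih hus' h.1 (by omega)
    refine (isWeaklyRegular_cons_iff _ _ _).2 ⟨?_, hreg⟩
    obtain ⟨n, hn⟩ := exists_smul_pow_mem_stable x (⊥ : Submodule P A)
    simp only [Submodule.mem_bot] at hn
    obtain ⟨Γ, hΓ⟩ : ∃ Γ : Submodule P A, Γ = Submodule.torsionBy P A (x ^ (n + 1)) := ⟨_, rfl⟩
    have mem_Γ : ∀ a, a ∈ Γ ↔ x ^ n • a = 0 := fun a => by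
      rw [hΓ, Submodule.mem_torsionBy_iff]
      exact ⟨hn a, fun ha => by rw [pow_succ', mul_smul, ha, smul_zero]⟩
    have : Module.Finite P Γ := Module.Finite.of_fg (IsNoetherian.noetherian Γ)
    have hfin : KosFin us Γ := by
      rw [hΓ]; exact KosFin.of_torsionBy h.2 (n + 1)
    let e : Submodule.torsionBy P Γ x ≃ₗ[P] Submodule.torsionBy P A x :=
      { (Γ.subtype).torsionByMap x with
        invFun := fun a => ⟨⟨a, (mem_Γ a).2 (hn _ (by
          have := (Submodule.mem_torsionBy_iff ..).1 a.2
          rw [pow_succ, mul_smul, this, smul_zero]))⟩,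
            (Submodule.mem_torsionBy_iff ..).2 (Subtype.ext
              ((Submodule.mem_torsionBy_iff ..).1 a.2))⟩
        left_inv := fun a => rfl
        right_inv := fun a => rfl }
    have hchi : kosChi us (QuotSMulTop x Γ) = 0 := by
      rw [kosChi_quotSMulTop_eq us x hfin, kosChi_congr us e]
      omega
    have hinj : Injective (QuotSMulTop.map x Γ.subtype) := by
      rw [← LinearMap.ker_eq_bot, LinearMap.ker_eq_bot']
      intro a ha
      obtain ⟨⟨a, haΓ⟩, rfl⟩ := Submodule.Quotient.mk_surjective _ a
      rw [QuotSMulTop.map_apply_mk, Submodule.Quotient.mk_eq_zero] at ha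
      obtain ⟨b, -, hb⟩ := Submodule.mem_smul_pointwise_iff_exists _ _ _ |>.1 ha
      have hb : x • b = a := hb
      have hbΓ : b ∈ Γ := by
        rw [mem_Γ]
        apply hn
        rw [pow_succ, mul_smul, hb]; exact (mem_Γ a).1 haΓ
      rw [Submodule.Quotient.mk_eq_zero]
      exact Submodule.mem_smul_pointwise_iff_exists _ _ _ |>.2 ⟨⟨b, hbΓ⟩, trivial, Subtype.ext hb⟩
    have h2 := subsingleton_of_kosChi_eq_zero hus' hreg _ hinj
      (hfin.of_surjective (Submodule.mkQ _) (Submodule.mkQ_surjective _)) hchi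
    have h3 : Γ = ⊥ := Submodule.subsingleton_iff_eq_bot.1
      (subsingleton_of_quotSMulTop (hus x List.mem_cons_self) h2)
    intro a b hab
    rw [← sub_eq_zero, ← Submodule.mem_bot P, ← h3, mem_Γ]
    apply hn
    rw [pow_succ, mul_smul, smul_sub, sub_eq_zero.2 hab, smul_zero]

end KosDefect

namespace FreeCx

open Function Pointwise RingTheory.Sequence

variable {P : Type*} [CommRing P] (G : FreeCx P)

section

variable {A : Type u} [AddCommGroup A] [Module P A]

lemma exact_smul_mkQ (x : P) :
    Exact (LinearMap.lsmul P A x) (Submodule.mkQ (x • (⊤ : Submodule P A))) := by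
  intro a
  rw [Submodule.mkQ_apply, Submodule.Quotient.mk_eq_zero,
    Submodule.mem_smul_pointwise_iff_exists]
  simp

lemma exists_exact_quotSMulTop {x : P} (hx : IsSMulRegular A x) (i : ℕ) :
    ∃ (f : QuotSMulTop x (G.T A (i + 1)) →ₗ[P] G.T (QuotSMulTop x A) (i + 1))
      (g : G.T (QuotSMulTop x A) (i + 1) →ₗ[P] Submodule.torsionBy P (G.T A i) x),
      Injective f ∧ Surjective g ∧ Exact f g := by
  obtain ⟨δ, h1, h2⟩ := G.exists_delta (LinearMap.lsmul P A x)
    (Submodule.mkQ (x • (⊤ : Submodule P A))) hx (Submodule.mkQ_surjective _) (exact_smul_mkQ x) i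
  have h3 := G.exact_map (LinearMap.lsmul P A x)
    (Submodule.mkQ (x • (⊤ : Submodule P A))) hx (Submodule.mkQ_surjective _) (exact_smul_mkQ x)
    (i + 1)
  have hker : x • (⊤ : Submodule P (G.T A (i + 1))) =
      LinearMap.ker (G.map (Submodule.mkQ (x • (⊤ : Submodule P A))) (i + 1)) := by
    ext t
    rw [LinearMap.mem_ker, h3 t, Submodule.mem_smul_pointwise_iff_exists]
    simp [map_lsmul]
  refine ⟨Submodule.liftQ _ (G.map (Submodule.mkQ (x • (⊤ : Submodule P A))) (i + 1)) hker.le,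
    δ.codRestrict _ fun t => ?_, ?_, ?_, ?_⟩
  · rw [Submodule.mem_torsionBy_iff, ← map_lsmul]
    exact (h2 _).2 ⟨t, rfl⟩
  · rw [← LinearMap.ker_eq_bot]
    exact Submodule.ker_liftQ_eq_bot _ _ _ hker.ge
  · rintro ⟨t, ht⟩
    rw [Submodule.mem_torsionBy_iff, ← map_lsmul] at ht
    obtain ⟨s, hs⟩ := (h2 _).1 ht
    exact ⟨s, Subtype.ext hs⟩
  · intro t
    rw [← Subtype.val_inj]
    change δ t = 0 ↔ _
    rw [h1 t]
    constructor
    · rintro ⟨s, rfl⟩; exact ⟨Submodule.Quotient.mk s, rfl⟩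
    · rintro ⟨s, rfl⟩
      obtain ⟨s, rfl⟩ := Submodule.Quotient.mk_surjective _ s
      exact ⟨s, rfl⟩

lemma nonempty_quotSMulTop_equiv (h0 : G.rk 0 = 0) {x : P} (hx : IsSMulRegular A x) :
    Nonempty (QuotSMulTop x (G.T A 0) ≃ₗ[P] G.T (QuotSMulTop x A) 0) := by
  have h3 := G.exact_map (LinearMap.lsmul P A x)
    (Submodule.mkQ (x • (⊤ : Submodule P A))) hx (Submodule.mkQ_surjective _) (exact_smul_mkQ x) 0
  have hs := G.map_zero_surjective (Submodule.mkQ (x • (⊤ : Submodule P A)))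
    (Submodule.mkQ_surjective _) h0
  have hker : x • (⊤ : Submodule P (G.T A 0)) =
      LinearMap.ker (G.map (Submodule.mkQ (x • (⊤ : Submodule P A))) 0) := by
    ext t
    rw [LinearMap.mem_ker, h3 t, Submodule.mem_smul_pointwise_iff_exists]
    simp [map_lsmul]
  exact ⟨(Submodule.quotEquivOfEq _ _ hker).trans (LinearMap.quotKerEquivOfSurjective _ hs)⟩

lemma subsingleton_T_of_rk {i : ℕ} (h : G.rk (i + 1) = 0) : Subsingleton (G.T A i) := by
  rw [subsingleton_T_iff]
  have : IsEmpty (Fin (G.rk (i + 1))) := by rw [h]; infer_instance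
  exact fun v _ => ⟨0, Subsingleton.elim _ _⟩

end

variable [IsNoetherianRing P]
variable {A Z : Type u} [AddCommGroup A] [Module P A] [Module.Finite P A]
  [AddCommGroup Z] [Module P Z]

theorem sum_length_eq (h0 : G.rk 0 = 0) {K : ℕ} (hK : ∀ i, K ≤ i → G.rk (i + 1) = 0)
    (us : List P) (hA : IsWeaklyRegular A us)
    (e : (A ⧸ (Ideal.ofList us • ⊤ : Submodule P A)) ≃ₗ[P] Z)
    (hZ : ∀ i, Module.length P (G.T Z (i + 1)) ≠ ⊤) :
    (∀ i, KosFin us (G.T A (i + 1))) ∧ KosGood us (G.T A 0) ∧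
    ∑ i ∈ Finset.range K, (-1 : ℤ) ^ i * (Module.length P (G.T Z (i + 1))).toNat =
      ∑ i ∈ Finset.range K, (-1 : ℤ) ^ i * kosChi us (G.T A (i + 1)) + kosDefect us (G.T A 0) := by
  induction us generalizing A with
  | nil =>
    have e' : A ≃ₗ[P] Z := (Submodule.quotEquivOfEqBot _ (by simp)).symm.trans e
    refine ⟨fun i => ?_, trivial, ?_⟩
    · simp only [KosFin]
      rw [(G.congr e' (i + 1)).length_eq]; exact hZ i
    · simp only [kosDefect, kosChi, add_zero]
      refine Finset.sum_congr rfl fun i _ => ?_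
      rw [(G.congr e' (i + 1)).length_eq]
  | cons x us ih =>
    rw [isWeaklyRegular_cons_iff] at hA
    obtain ⟨f1, f2, f3⟩ := ih hA.2
      ((Submodule.quotOfListConsSMulTopEquivQuotSMulTopInner A x us).symm.trans e)
    choose f g hf hg hfg using G.exists_exact_quotSMulTop hA.1
    obtain ⟨e0⟩ := G.nonempty_quotSMulTop_equiv h0 hA.1
    have hb : ∀ i, KosFin us (Submodule.torsionBy P (G.T A i) x) := fun i =>
      (f1 i).of_surjective (g i) (hg i)
    refine ⟨fun i => (f1 i).of_injective (f i) (hf i), ⟨f2.congr e0.symm, hb 0⟩, ?_⟩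
    rw [f3]
    have h1 : ∀ i, kosChi us (G.T (QuotSMulTop x A) (i + 1)) =
        kosChi us (QuotSMulTop x (G.T A (i + 1))) +
          kosChi us (Submodule.torsionBy P (G.T A i) x) := fun i =>
      kosChi_eq_add us _ _ _ (f i) (g i) (hf i) (hg i) (hfg i) (f1 i)
    have h2 : kosChi us (Submodule.torsionBy P (G.T A K) x) = 0 := by
      have := G.subsingleton_T_of_rk (A := A) (hK K le_rfl)
      exact kosChi_of_subsingleton us
    have h3 : ∀ L, ∑ i ∈ Finset.range L,
        (-1 : ℤ) ^ i * (kosChi us (Submodule.torsionBy P (G.T A i) x) +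
          kosChi us (Submodule.torsionBy P (G.T A (i + 1)) x)) =
        kosChi us (Submodule.torsionBy P (G.T A 0) x) -
          (-1) ^ L * kosChi us (Submodule.torsionBy P (G.T A L) x) := by
      intro L
      induction L with
      | zero => simp
      | succ L ih => rw [Finset.sum_range_succ, ih]; ring
    have h3 := h3 K
    rw [h2, mul_zero, sub_zero] at h3
    simp only [kosChi, kosDefect]
    rw [kosDefect_congr us e0, ← h3, add_comm (kosDefect _ _), ← add_assoc,
      ← Finset.sum_add_distrib]
    congr 1
    refine Finset.sum_congr rfl fun i _ => ?_
    rw [h1]; ring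

omit [IsNoetherianRing P] [Module.Finite P A] in
lemma subsingleton_T_of_isWeaklyRegular (h0 : G.rk 0 = 0) (us : List P) (hA : IsWeaklyRegular A us)
    (e : (A ⧸ (Ideal.ofList us • ⊤ : Submodule P A)) ≃ₗ[P] Z)
    (h : ∀ i, Subsingleton (G.T A (i + 1))) (hT : IsWeaklyRegular (G.T A 0) us) (i : ℕ) :
    Subsingleton (G.T Z (i + 1)) := by
  induction us generalizing A with
  | nil =>
    have e' : A ≃ₗ[P] Z := (Submodule.quotEquivOfEqBot _ (by simp)).symm.trans e
    exact (G.congr e' (i + 1)).symm.injective.subsingleton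
  | cons x us ih =>
    rw [isWeaklyRegular_cons_iff] at hA hT
    choose f g hf hg hfg using G.exists_exact_quotSMulTop hA.1
    obtain ⟨e0⟩ := G.nonempty_quotSMulTop_equiv h0 hA.1
    refine ih hA.2
      ((Submodule.quotOfListConsSMulTopEquivQuotSMulTopInner A x us).symm.trans e)
      (fun j => ?_) ((e0.isWeaklyRegular_congr us).1 hT.2)
    have hs : Subsingleton (Submodule.torsionBy P (G.T A j) x) := by
      cases j with
      | zero => exact subsingleton_torsionBy hT.1
      | succ j => infer_instance
    refine subsingleton_of_forall_eq 0 fun t => ?_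
    obtain ⟨s, rfl⟩ := (hfg j t).1 (Subsingleton.elim _ _)
    rw [Subsingleton.elim s 0, map_zero]

theorem sum_length_nonneg_and [IsLocalRing P] (h0 : G.rk 0 = 0) {K : ℕ}
    (hK : ∀ i, K ≤ i → G.rk (i + 1) = 0)
    (us : List P) (hus : ∀ x ∈ us, x ∈ maximalIdeal P) (hA : IsWeaklyRegular A us)
    (e : (A ⧸ (Ideal.ofList us • ⊤ : Submodule P A)) ≃ₗ[P] Z)
    (h : ∀ i, Subsingleton (G.T A (i + 1)))
    (hZ : ∀ i, Module.length P (G.T Z (i + 1)) ≠ ⊤) :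
    0 ≤ ∑ i ∈ Finset.range K, (-1 : ℤ) ^ i * (Module.length P (G.T Z (i + 1))).toNat ∧
    (∑ i ∈ Finset.range K, (-1 : ℤ) ^ i * (Module.length P (G.T Z (i + 1))).toNat = 0 →
      ∀ i, Subsingleton (G.T Z (i + 1))) := by
  obtain ⟨h1, h2, h3⟩ := G.sum_length_eq h0 hK us hA e hZ
  have h5 : ∑ i ∈ Finset.range K, (-1 : ℤ) ^ i * kosChi us (G.T A (i + 1)) = 0 :=
    Finset.sum_eq_zero fun i _ => by rw [kosChi_of_subsingleton us, mul_zero]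
  rw [h5, zero_add] at h3
  rw [h3]
  exact ⟨kosDefect_nonneg h2, fun h4 => G.subsingleton_T_of_isWeaklyRegular h0 us hA e h
    (isWeaklyRegular_of_kosDefect_eq_zero hus h2 h4)⟩

end FreeCx

section FiniteLength

variable {Q : Type*} [CommRing Q] [IsNoetherianRing Q] [IsLocalRing Q]
variable {W : Type*} [AddCommGroup W] [Module Q W] [Module.Finite Q W]

lemma Module.length_ne_top_of_le_radical (J : Ideal Q) (hJ : maximalIdeal Q ≤ J.radical)
    (h : ∀ r ∈ J, ∀ w : W, r • w = 0) : Module.length Q W ≠ ⊤ := by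
  by_cases hJ1 : J = ⊤
  · have : Subsingleton W := subsingleton_of_forall_eq 0 fun w => by
      simpa using h 1 (by rw [hJ1]; trivial) w
    simp
  have : Nontrivial (Q ⧸ J) := Ideal.Quotient.nontrivial_iff.2 hJ1
  have : IsLocalRing (Q ⧸ J) := .of_surjective' _ Ideal.Quotient.mk_surjective
  have : IsArtinianRing (Q ⧸ J) := by
    rw [isArtinianRing_iff_isNilpotent_maximalIdeal]
    obtain ⟨n, hn⟩ := Ideal.exists_pow_le_of_le_radical_of_fg hJ (IsNoetherian.noetherian _)
    refine ⟨n, ?_⟩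
    rw [← IsLocalRing.map_maximalIdeal_of_surjective (Ideal.Quotient.mk J)
      Ideal.Quotient.mk_surjective, ← Ideal.map_pow, Ideal.zero_eq_bot, Ideal.map_eq_bot_iff_le_ker,
      Ideal.mk_ker]
    exact hn
  have htor : Module.IsTorsionBySet Q W J := fun w r => h r r.2 w
  let _ := htor.module
  have : IsScalarTower Q (Q ⧸ J) W := htor.isScalarTower
  have : Module.Finite (Q ⧸ J) W := Module.Finite.of_restrictScalars_finite Q _ _
  have : IsArtinian Q W := by
    let l : W →ₛₗ[Ideal.Quotient.mk J] W :=
      { toFun := id, map_add' := fun _ _ => rfl, map_smul' := fun _ _ => rfl }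
    exact (LinearMap.isArtinian_iff_of_bijective l Function.bijective_id).2 inferInstance
  exact Module.length_ne_top

end FiniteLength

namespace FreeCx

open Function Pointwise RingTheory.Sequence

section BaseChange

variable {P : Type*} [CommRing P] (G : FreeCx P) (Q : Type*) [CommRing Q] [Algebra P Q]

/-- Change of coefficients. -/
abbrev baseChange : FreeCx Q where
  rk := G.rk
  mat i := (G.mat i).map (algebraMap P Q)
  mul_mat i := by
    rw [← Matrix.map_mul, G.mul_mat, Matrix.map_zero _ (map_zero _)]

variable {Q} {A : Type*} [AddCommGroup A] [Module P A] [Module Q A] [IsScalarTower P Q A]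

lemma baseChange_d (i : ℕ) (v : Fin (G.rk (i + 1)) → A) :
    (G.baseChange Q).d A i v = G.d A i v := by
  refine funext fun j => ((G.baseChange Q).d_apply i v j).trans (Eq.trans ?_ (G.d_apply i v j).symm)
  exact Finset.sum_congr rfl fun k _ => algebraMap_smul Q _ _

lemma subsingleton_baseChange_T_iff (i : ℕ) :
    Subsingleton ((G.baseChange Q).T A i) ↔ Subsingleton (G.T A i) := by
  rw [subsingleton_T_iff, subsingleton_T_iff]
  constructor
  · intro h v hv
    obtain ⟨w, hw⟩ := h v ((G.baseChange_d (Q := Q) i v).trans hv)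
    exact ⟨w, (G.baseChange_d (Q := Q) (i + 1) w).symm.trans hw⟩
  · intro h v hv
    obtain ⟨w, hw⟩ := h v ((G.baseChange_d (Q := Q) i v).symm.trans hv)
    exact ⟨w, (G.baseChange_d (Q := Q) (i + 1) w).trans hw⟩

end BaseChange

section Localization

variable {P : Type*} [CommRing P] (G : FreeCx P) (S : Submonoid P) 
variable {D E : Type*} [AddCommGroup D] [Module P D] [AddCommGroup E] [Module P E]
  (f : D →ₗ[P] E) [IsLocalizedModule S f]

include f in
lemma exists_smul_eq_comp {n : ℕ} (v : Fin n → E) : ∃ s ∈ S, ∃ w : Fin n → D, s • v = f ∘ w := by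
  choose x hx using fun j => IsLocalizedModule.surj S f (v j)
  refine ⟨∏ j, ((x j).2 : P), S.prod_mem fun j _ => (x j).2.2,
    fun j => (∏ k ∈ Finset.univ.erase j, ((x k).2 : P)) • (x j).1, ?_⟩
  ext j
  simp only [Pi.smul_apply, comp_apply, map_smul]
  rw [← hx j, ← Finset.prod_erase_mul _ _ (Finset.mem_univ j), mul_smul]
  rfl

lemma exists_smul_eq_zero {n : ℕ} (w : Fin n → D) (h : f ∘ w = 0) : ∃ s ∈ S, s • w = 0 := by
  choose x hx using fun j => (IsLocalizedModule.eq_zero_iff S f).1 (congrFun h j)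
  refine ⟨∏ j, (x j : P), S.prod_mem fun j _ => (x j).2, ?_⟩
  ext j
  rw [Pi.smul_apply, ← Finset.prod_erase_mul _ _ (Finset.mem_univ j), mul_smul]
  have : (x j : P) • w j = 0 := hx j
  rw [this, smul_zero, Pi.zero_apply]

include f in
lemma smul_injective_of_isLocalizedModule {s : P} (hs : s ∈ S) {n : ℕ} {v w : Fin n → E}
    (h : s • v = s • w) : v = w := by
  ext j
  exact IsLocalizedModule.smul_injective f (⟨s, hs⟩ : S) (congrFun h j)

include f in
lemma exists_unit_smul {s : P} (hs : s ∈ S) {n : ℕ} (v : Fin n → E) :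
    ∃ w : Fin n → E, s • w = v := by
  have := fun e => (Module.End.isUnit_iff _).1 (IsLocalizedModule.map_units f (⟨s, hs⟩ : S)) |>.2 e
  choose w hw using fun j => this (v j)
  exact ⟨w, funext hw⟩

include f in
lemma exists_smul_cls_eq {i : ℕ} (t : G.T E i) : ∃ s ∈ S, ∃ t', s • t = G.map f i t' := by
  obtain ⟨v, hv, rfl⟩ := G.exists_cls t
  obtain ⟨s, hs, w, hw⟩ := exists_smul_eq_comp S f v
  have : f ∘ (G.d D i w) = 0 := by
    rw [← d_map, ← hw, map_smul, hv, smul_zero]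
  obtain ⟨s', hs', h'⟩ := exists_smul_eq_zero S f _ this
  refine ⟨s' * s, S.mul_mem hs' hs, G.cls i (s' • w) (by rw [map_smul, h']), ?_⟩
  rw [map_cls, cls_smul]
  congr 1
  rw [mul_smul, hw]
  ext; simp

include f in
lemma eq_zero_of_smul {i : ℕ} {s : P} (hs : s ∈ S) {t : G.T E i} (h : s • t = 0) : t = 0 := by
  obtain ⟨v, hv, rfl⟩ := G.exists_cls t
  rw [cls_smul, cls_eq_zero] at h
  obtain ⟨w, hw⟩ := h
  obtain ⟨w', rfl⟩ := exists_unit_smul S f hs w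
  rw [cls_eq_zero]
  refine ⟨w', smul_injective_of_isLocalizedModule S f hs ?_⟩
  rw [← hw, map_smul]

lemma exists_smul_eq_zero_of_map {i : ℕ} {t : G.T D i} (h : G.map f i t = 0) :
    ∃ s ∈ S, s • t = 0 := by
  obtain ⟨v, hv, rfl⟩ := G.exists_cls t
  rw [map_cls, cls_eq_zero] at h
  obtain ⟨w, hw⟩ := h
  obtain ⟨s, hs, w', hw'⟩ := exists_smul_eq_comp S f w
  have h1 : f ∘ (s • v - G.d D (i + 1) w') = 0 := by
    have : f ∘ (s • v) = f ∘ (G.d D (i + 1) w') := by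
      rw [← d_map, ← hw', map_smul, hw]
      ext; simp
    ext j
    have := congrFun this j
    simp only [comp_apply] at this
    simp only [comp_apply, Pi.sub_apply, map_sub, this, sub_self, Pi.zero_apply]
  obtain ⟨s', hs', h'⟩ := exists_smul_eq_zero S f _ h1
  refine ⟨s' * s, S.mul_mem hs' hs, ?_⟩
  rw [cls_smul, cls_eq_zero]
  refine ⟨s' • w', ?_⟩
  rw [map_smul, eq_comm, ← sub_eq_zero, mul_smul, ← smul_sub, h']

variable (Q : Type*) [CommRing Q] [Algebra P Q] [Module Q E] [IsScalarTower P Q E]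

include S f in
lemma subsingleton_T_of_isLocalizedModule {i : ℕ} (h : Subsingleton (G.T D i)) :
    Subsingleton (G.T E i) := by
  refine subsingleton_of_forall_eq 0 fun t => ?_
  obtain ⟨s, hs, t', ht'⟩ := G.exists_smul_cls_eq S f t
  rw [Subsingleton.elim t' 0, map_zero] at ht'
  exact G.eq_zero_of_smul S f hs ht'

include S f in
lemma baseChange_smul_eq_zero {i : ℕ} {r : P} (h : ∀ t : G.T D i, r • t = 0)
    (t : (G.baseChange Q).T E i) : algebraMap P Q r • t = 0 := by
  obtain ⟨v, hv, rfl⟩ := (G.baseChange Q).exists_cls t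
  have hv' : G.d E i v = 0 := (G.baseChange_d (Q := Q) i v).symm.trans hv
  have h1 : r • G.cls i v hv' = 0 := by
    obtain ⟨s, hs, t', ht'⟩ := G.exists_smul_cls_eq S f (G.cls i v hv')
    refine G.eq_zero_of_smul S f hs ?_
    rw [smul_comm, ht', ← map_smul, h, map_zero]
  rw [cls_smul, cls_eq_zero] at h1
  obtain ⟨w, hw⟩ := h1
  rw [cls_smul, cls_eq_zero]
  refine ⟨w, (G.baseChange_d (Q := Q) (i + 1) w).trans (hw.trans ?_)⟩
  ext j
  exact (algebraMap_smul Q r (v j)).symm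

end Localization

section RigidityStep

variable {P : Type*} [CommRing P] (G : FreeCx P)

lemma toNat_length_eq {M₁ M₂ M₃ M₄ M₅ : Type*} [AddCommGroup M₁] [Module P M₁] [AddCommGroup M₂]
    [Module P M₂] [AddCommGroup M₃] [Module P M₃] [AddCommGroup M₄] [Module P M₄] [AddCommGroup M₅]
    [Module P M₅] (a : M₁ →ₗ[P] M₂) (f : M₂ →ₗ[P] M₃) (g : M₃ →ₗ[P] M₄) (b : M₄ →ₗ[P] M₅)
    (h1 : Exact a f) (h2 : Exact f g) (h3 : Exact g b)
    (hM₂ : Module.length P M₂ ≠ ⊤) (hM₄ : Module.length P M₄ ≠ ⊤) :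
    Module.length P M₃ ≠ ⊤ ∧ ((Module.length P M₃).toNat : ℤ) =
      (Module.length P M₂).toNat - (Module.length P (LinearMap.range a)).toNat +
      ((Module.length P M₄).toNat - (Module.length P (LinearMap.range b)).toNat) := by
  have e1 := Module.length_eq_add_of_exact (LinearMap.range a).subtype f.rangeRestrict
    (Submodule.subtype_injective _) f.surjective_rangeRestrict (fun m => by
      rw [← Subtype.val_inj]; simpa using h1 m)
  have e2 := Module.length_eq_add_of_exact (LinearMap.range f).subtype g.rangeRestrict
    (Submodule.subtype_injective _) g.surjective_rangeRestrict (fun m => by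
      rw [← Subtype.val_inj]; simpa using h2 m)
  have e3 := Module.length_eq_add_of_exact (LinearMap.range g).subtype b.rangeRestrict
    (Submodule.subtype_injective _) b.surjective_rangeRestrict (fun m => by
      rw [← Subtype.val_inj]; simpa using h3 m)
  rw [e1] at hM₂
  rw [e3] at hM₄
  rw [e2, e1, e3]
  obtain ⟨h4, h5⟩ := WithTop.add_ne_top.1 hM₂
  obtain ⟨h6, h7⟩ := WithTop.add_ne_top.1 hM₄
  refine ⟨WithTop.add_ne_top.2 ⟨h5, h6⟩, ?_⟩
  rw [ENat.toNat_add h5 h6, ENat.toNat_add h4 h5, ENat.toNat_add h6 h7]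
  push_cast; ring

variable [IsNoetherianRing P] [IsLocalRing P]
variable {A D Z D' F : Type u} [AddCommGroup A] [Module P A] [Module.Finite P A]
  [AddCommGroup D] [Module P D] [AddCommGroup Z] [Module P Z]
  [AddCommGroup D'] [Module P D'] [AddCommGroup F] [Module P F]

theorem subsingleton_T_of_length_ne_top (h0 : G.rk 0 = 0) {K : ℕ}
    (hK : ∀ i, K ≤ i → G.rk (i + 1) = 0)
    (us : List P) (hus : ∀ x ∈ us, x ∈ maximalIdeal P) (hA : IsWeaklyRegular A us)
    (e : (A ⧸ (Ideal.ofList us • ⊤ : Submodule P A)) ≃ₗ[P] Z)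
    (hTA : ∀ i, Subsingleton (G.T A (i + 1)))
    (f : D →ₗ[P] Z) (g : Z →ₗ[P] D') (hf : Injective f) (hg : Surjective g) (hfg : Exact f g)
    (p : D' →ₗ[P] F) (q : F →ₗ[P] D) (hp : Injective p) (hq : Surjective q) (hpq : Exact p q)
    (hTF : ∀ i, Subsingleton (G.T F (i + 1)))
    (hlen : ∀ i, Module.length P (G.T D (i + 1)) ≠ ⊤)
    (hT1 : Subsingleton (G.T D 1)) (i : ℕ) : Subsingleton (G.T D (i + 1)) := by
  choose δ hδ1 hδ2 using G.exists_delta f g hf hg hfg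
  choose ε hε1 hε2 using G.exists_delta p q hp hq hpq
  have hεb : ∀ i, Bijective (ε (i + 1)) := by
    intro i
    refine ⟨?_, fun t => (hε2 (i + 1) t).1 (Subsingleton.elim _ _)⟩
    rw [← LinearMap.ker_eq_bot, LinearMap.ker_eq_bot']
    intro t ht
    obtain ⟨s, rfl⟩ := (hε1 (i + 1) t).1 ht
    rw [Subsingleton.elim s 0, map_zero]
  have hlen' : ∀ i, Module.length P (G.T D' (i + 1)) = Module.length P (G.T D (i + 1 + 1)) :=
    fun i => (LinearEquiv.ofBijective _ (hεb i)).length_eq.symm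
  have key := fun i => toNat_length_eq (δ (i + 1)) (G.map f (i + 1)) (G.map g (i + 1)) (δ i)
    (hδ2 (i + 1)) (G.exact_map f g hf hg hfg (i + 1)) (hδ1 i) (hlen i)
    (by rw [hlen']; exact hlen (i + 1))
  obtain ⟨t, ht⟩ : ∃ t : ℕ → ℤ, ∀ i, t i = (Module.length P (G.T D (i + 1))).toNat :=
    ⟨_, fun _ => rfl⟩
  obtain ⟨r, hr⟩ : ∃ r : ℕ → ℤ, ∀ i, r i = (Module.length P (LinearMap.range (δ i))).toNat :=
    ⟨_, fun _ => rfl⟩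
  have hsum : ∀ L, ∑ i ∈ Finset.range L,
      (-1 : ℤ) ^ i * (Module.length P (G.T Z (i + 1))).toNat =
        t 0 - (-1) ^ L * t L - (r 0 - (-1) ^ L * r L) := by
    intro L
    induction L with
    | zero => simp
    | succ L ih =>
      rw [Finset.sum_range_succ, ih, (key L).2, hlen', ← ht, ← ht, ← hr, ← hr]; ring
  have htK : t K = 0 := by
    have := G.subsingleton_T_of_rk (A := D) (hK (K + 1) (by omega))
    rw [ht, Module.length_eq_zero]; rfl
  have hrK : r K = 0 := by
    have := G.subsingleton_T_of_rk (A := D) (hK K le_rfl)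
    rw [hr, Module.length_eq_zero]; rfl
  have ht0 : t 0 = 0 := by
    rw [ht]; simp
  have hs := hsum K
  rw [htK, hrK, ht0] at hs
  obtain ⟨h1, h2⟩ := G.sum_length_nonneg_and h0 hK us hus hA e hTA (fun i => (key i).1)
  have hr0 : 0 ≤ r 0 := by rw [hr]; exact Int.natCast_nonneg _
  have hr0' : r 0 = 0 := by linarith
  have hTZ := h2 (by linarith)
  have hδinj : ∀ i, Injective (δ i) := by
    intro i
    rw [← LinearMap.ker_eq_bot, LinearMap.ker_eq_bot']
    intro t ht
    obtain ⟨s, rfl⟩ := (hδ1 i t).1 ht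
    rw [Subsingleton.elim s 0, map_zero]
  have hfin : Module.length P (LinearMap.range (δ 0)) ≠ ⊤ := by
    rw [(LinearEquiv.ofInjective _ (hδinj 0)).symm.length_eq, hlen']
    exact hlen 1
  have h2' : Subsingleton (G.T D 2) := by
    rw [hr, Nat.cast_eq_zero, ENat.toNat_eq_zero, or_iff_left hfin, Module.length_eq_zero_iff] at hr0'
    have := (LinearEquiv.ofInjective _ (hδinj 0)).injective.subsingleton
    exact (hεb 0).1.subsingleton
  have hstep : ∀ i, Subsingleton (G.T D (i + 1)) → Subsingleton (G.T D (i + 1 + 2)) := by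
    intro i hi
    have := (hδinj (i + 1)).subsingleton
    exact (hεb (i + 1)).1.subsingleton
  have : ∀ i, Subsingleton (G.T D (i + 1)) ∧ Subsingleton (G.T D (i + 1 + 1)) := by
    intro i
    induction i with
    | zero => exact ⟨hT1, h2'⟩
    | succ i ih => exact ⟨ih.2, hstep i ih.1⟩
  exact (this i).1

end RigidityStep

end FreeCx

namespace FreeCx

open Function Pointwise RingTheory.Sequence

section RigidityLocalized

variable {P : Type u} [CommRing P] (G : FreeCx P)

lemma smul_T_eq_zero {A : Type*} [AddCommGroup A] [Module P A] {r : P} (h : ∀ a : A, r • a = 0)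
    {i : ℕ} (t : G.T A i) : r • t = 0 := by
  obtain ⟨v, hv, rfl⟩ := G.exists_cls t
  rw [cls_smul, cls_eq_zero]
  exact ⟨0, by rw [map_zero]; ext; simp [h]⟩

lemma localized'_ofList_smul_top {A : Type u} [AddCommGroup A] [Module P A] (S : Submonoid P)
    (us : List P) : (Ideal.ofList us • ⊤ : Submodule P A).localized S =
      (Ideal.ofList (us.map (algebraMap P (Localization S))) • ⊤ :
        Submodule (Localization S) (LocalizedModule S A)) := by
  change Submodule.localized' (Localization S) S (LocalizedModule.mkLinearMap S A) _ = _
  rw [Submodule.localized'_smul, Submodule.localized'_top]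
  congr 1
  rw [Ideal.ofList, Ideal.ofList]
  erw [Submodule.localized'_span]
  congr 1
  ext; simp

lemma not_annihilator_pi_le {K : ℕ} {E : Fin K → Type*} [∀ j, AddCommGroup (E j)]
    [∀ j, Module P (E j)] [∀ j, Module.Finite P (E j)] {𝔓 : Ideal P} [𝔓.IsPrime]
    (h : ∀ j (t : E j), ∃ s ∈ 𝔓.primeCompl, s • t = 0) :
    ¬ Module.annihilator P (∀ j, E j) ≤ 𝔓 := by
  intro hle
  refine Module.notMem_support_iff (p := ⟨𝔓, inferInstance⟩).2 ?_
    ((Module.mem_support_iff_of_finite (p := ⟨𝔓, inferInstance⟩)).2 hle)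
  rw [LocalizedModule.subsingleton_iff]
  intro t
  choose s hs hst using fun j => h j (t j)
  refine ⟨∏ j, s j, 𝔓.primeCompl.prod_mem fun j _ => hs j, ?_⟩
  ext1 j
  rw [Pi.smul_apply, ← Finset.prod_erase_mul _ _ (Finset.mem_univ j), mul_smul, hst, smul_zero,
    Pi.zero_apply]

variable [IsNoetherianRing P]
variable {A D Z D' F : Type u} [AddCommGroup A] [Module P A] [Module.Finite P A]
  [AddCommGroup D] [Module P D] [Module.Finite P D] [AddCommGroup Z] [Module P Z]
  [AddCommGroup D'] [Module P D'] [AddCommGroup F] [Module P F]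

theorem subsingleton_T_localized (h0 : G.rk 0 = 0) {K : ℕ}
    (hK : ∀ i, K ≤ i → G.rk (i + 1) = 0)
    (us : List P) (hA : IsWeaklyRegular A us)
    (e : (A ⧸ (Ideal.ofList us • ⊤ : Submodule P A)) ≃ₗ[P] Z)
    (hTA : ∀ i, Subsingleton (G.T A (i + 1)))
    (f : D →ₗ[P] Z) (g : Z →ₗ[P] D') (hf : Injective f) (hg : Surjective g) (hfg : Exact f g)
    (p : D' →ₗ[P] F) (q : F →ₗ[P] D) (hp : Injective p) (hq : Surjective q) (hpq : Exact p q)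
    (hTF : ∀ i, Subsingleton (G.T F (i + 1)))
    (hT1 : Subsingleton (G.T D 1))
    (𝔓 : Ideal P) [𝔓.IsPrime] (huI : ∀ x ∈ us, x ∈ 𝔓) (I : Ideal P)
    (hmin : ∀ q : Ideal P, q.IsPrime → I ≤ q → q ≤ 𝔓 → 𝔓 ≤ q)
    (hI : ∀ r ∈ I, ∀ j, ∀ t : G.T D (j + 1), r • t = 0) (i : ℕ) :
    Subsingleton ((G.baseChange (Localization 𝔓.primeCompl)).T
      (LocalizedModule 𝔓.primeCompl D) (i + 1)) := by
  let S := 𝔓.primeCompl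
  let Q := Localization S
  have hQ : IsLocalRing Q := inferInstanceAs (IsLocalRing (Localization.AtPrime 𝔓))
  have hloc : IsLocalization.AtPrime Q 𝔓 := inferInstanceAs
    (IsLocalization.AtPrime (Localization.AtPrime 𝔓) 𝔓)
  have hmax : maximalIdeal Q ≤ (I.map (algebraMap P Q)).radical := by
    rw [Ideal.radical_eq_sInf]
    refine le_sInf fun q ⟨hq1, hq2⟩ => ?_
    have h1 : I ≤ q.comap (algebraMap P Q) := Ideal.map_le_iff_le_comap.1 hq1
    have hle : q.comap (algebraMap P Q) ≤ 𝔓 := by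
      rw [← IsLocalization.AtPrime.under_maximalIdeal Q 𝔓]
      exact Ideal.comap_mono (IsLocalRing.le_maximalIdeal hq2.ne_top)
    have h2 := hmin _ inferInstance h1 hle
    rw [← IsLocalization.map_under S Q (maximalIdeal Q), Ideal.map_le_iff_le_comap,
      IsLocalization.AtPrime.under_maximalIdeal Q 𝔓]
    exact h2
  have hsub : ∀ (X : Type u) [AddCommGroup X] [Module P X], ∀ j, Subsingleton (G.T X j) →
      Subsingleton ((G.baseChange Q).T (LocalizedModule S X) j) := fun X _ _ j h =>
    (G.subsingleton_baseChange_T_iff j).2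
      (G.subsingleton_T_of_isLocalizedModule S (LocalizedModule.mkLinearMap S X) h)
  have : IsNoetherianRing Q := IsLocalization.isNoetherianRing S Q inferInstance
  exact (G.baseChange Q).subsingleton_T_of_length_ne_top h0 hK
    (us.map (algebraMap P Q)) (by
      intro x hx
      obtain ⟨y, hy, rfl⟩ := List.mem_map.1 hx
      rw [IsLocalization.AtPrime.to_map_mem_maximal_iff Q 𝔓]
      exact huI y hy)
    (hA.of_isLocalizedModule Q S (LocalizedModule.mkLinearMap S A))
    ((Submodule.quotEquivOfEq _ _ (localized'_ofList_smul_top S us).symm).trans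
      ((localizedQuotientEquiv S (Ideal.ofList us • ⊤ : Submodule P A)).trans
        (LinearEquiv.ofBijective (LocalizedModule.map S e.toLinearMap)
          ⟨LocalizedModule.map_injective S _ e.injective,
            LocalizedModule.map_surjective S _ e.surjective⟩)))
    (fun j => hsub A _ (hTA j))
    (LocalizedModule.map S f) (LocalizedModule.map S g) (LocalizedModule.map_injective S _ hf)
    (LocalizedModule.map_surjective S _ hg) (LocalizedModule.map_exact S _ _ hfg)
    (LocalizedModule.map S p) (LocalizedModule.map S q) (LocalizedModule.map_injective S _ hp)
    (LocalizedModule.map_surjective S _ hq) (LocalizedModule.map_exact S _ _ hpq)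
    (fun j => hsub F _ (hTF j))
    (fun j => Module.length_ne_top_of_le_radical (I.map (algebraMap P Q)) hmax (by
      intro r hr t
      suffices I.map (algebraMap P Q) ≤ Module.annihilator Q
          ((G.baseChange Q).T (LocalizedModule S D) (j + 1)) from
        Module.mem_annihilator.1 (this hr) t
      rw [Ideal.map_le_iff_le_comap]
      intro r hr
      rw [Ideal.mem_comap, Module.mem_annihilator]
      exact G.baseChange_smul_eq_zero S (LocalizedModule.mkLinearMap S D) Q (hI r hr j)))
    (hsub D _ hT1) i

theorem subsingleton_T_of_exact [IsLocalRing P] (h0 : G.rk 0 = 0) {K : ℕ}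
    (hK : ∀ i, K ≤ i → G.rk (i + 1) = 0)
    (us : List P) (hA : IsWeaklyRegular A us)
    (e : (A ⧸ (Ideal.ofList us • ⊤ : Submodule P A)) ≃ₗ[P] Z)
    (hTA : ∀ i, Subsingleton (G.T A (i + 1)))
    (f : D →ₗ[P] Z) (g : Z →ₗ[P] D') (hf : Injective f) (hg : Surjective g) (hfg : Exact f g)
    (p : D' →ₗ[P] F) (q : F →ₗ[P] D) (hp : Injective p) (hq : Surjective q) (hpq : Exact p q)
    (hTF : ∀ i, Subsingleton (G.T F (i + 1)))
    (hT1 : Subsingleton (G.T D 1)) (i : ℕ) : Subsingleton (G.T D (i + 1)) := by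
  by_contra hi
  have hiK : i < K := by
    by_contra h
    exact hi (G.subsingleton_T_of_rk (hK _ (by omega)))
  obtain ⟨I, hI⟩ : ∃ I : Ideal P, I = Module.annihilator P (∀ j : Fin K, G.T D (j + 1)) :=
    ⟨_, rfl⟩
  have mem_I : ∀ r ∈ I, ∀ j, ∀ t : G.T D (j + 1), r • t = 0 := by
    intro r hr j t
    by_cases hj : j < K
    · rw [hI, Module.mem_annihilator] at hr
      have := congrFun (hr (Pi.single (M := fun j : Fin K => G.T D (j + 1)) ⟨j, hj⟩ t)) ⟨j, hj⟩
      simpa using this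
    · have := G.subsingleton_T_of_rk (A := D) (hK (j + 1) (by omega))
      exact Subsingleton.elim _ _
  have hI1 : I ≠ ⊤ := by
    intro h
    refine hi (subsingleton_of_forall_eq 0 fun t => ?_)
    simpa using mem_I 1 (by rw [h]; trivial) i t
  obtain ⟨𝔓, h𝔓⟩ := Ideal.nonempty_minimalPrimes hI1
  have : 𝔓.IsPrime := h𝔓.1.1
  have huI : ∀ x ∈ us, x ∈ I := by
    intro x hx
    rw [hI, Module.mem_annihilator]
    intro t
    ext1 j
    refine G.smul_T_eq_zero (fun d => hf ?_) (t j)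
    rw [map_smul, map_zero]
    obtain ⟨z, hz⟩ := e.surjective (f d)
    obtain ⟨a, rfl⟩ := Submodule.Quotient.mk_surjective _ z
    rw [← hz, ← map_smul, ← Submodule.Quotient.mk_smul, (Submodule.Quotient.mk_eq_zero _).2,
      map_zero]
    exact Submodule.smul_mem_smul (Ideal.subset_span hx) trivial
  have hex : ∀ j (t : G.T D (j + 1)), ∃ s ∈ 𝔓.primeCompl, s • t = 0 := by
    intro j t
    have := (G.subsingleton_baseChange_T_iff (A := LocalizedModule 𝔓.primeCompl D) (j + 1)).1
      (G.subsingleton_T_localized h0 hK us hA e hTA f g hf hg hfg p q hp hq hpq hTF hT1 𝔓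
        (fun x hx => h𝔓.1.2 (huI x hx)) I (fun q h1 h2 h3 => h𝔓.2 ⟨h1, h2⟩ h3) mem_I j)
    exact G.exists_smul_eq_zero_of_map 𝔓.primeCompl (LocalizedModule.mkLinearMap 𝔓.primeCompl D)
      (Subsingleton.elim _ _)
  have hI𝔓 := h𝔓.1.2
  rw [hI] at hI𝔓
  have hfin : ∀ j : Fin K, Module.Finite P (G.T D (j + 1)) := fun j => inferInstance
  exact not_annihilator_pi_le (E := fun j : Fin K => G.T D (j + 1)) (𝔓 := 𝔓)
    (fun j t => hex j t) hI𝔓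

end RigidityLocalized

end FreeCx

namespace MvPowerSeries

open scoped MvPowerSeries.WithPiTopology

lemma ringHom_ext_of_continuous {σ R S : Type*} [CommRing R] [TopologicalSpace R] [CommRing S]
    [TopologicalSpace S] [T2Space S] {f g : MvPowerSeries σ R →+* S} (hf : Continuous f)
    (hg : Continuous g) (hC : ∀ r, f (C r) = g (C r)) (hX : ∀ i, f (X i) = g (X i)) : f = g := by
  have h : f.comp MvPolynomial.coeToMvPowerSeries.ringHom =
      g.comp MvPolynomial.coeToMvPowerSeries.ringHom :=
    MvPolynomial.ringHom_ext (fun r => by simpa using hC r) (fun i => by simpa using hX i)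
  exact DFunLike.coe_injective (WithPiTopology.denseRange_toMvPowerSeries.equalizer hf hg
    (congrArg DFunLike.coe h))

lemma exists_reflection (d : ℕ) {S : Type*} [CommRing S] [UniformSpace S] [IsUniformAddGroup S]
    [IsTopologicalRing S] [IsLinearTopology S S] [CompleteSpace S] [T2Space S] (a : Fin d → S)
    (ha : ∀ i, IsTopologicallyNilpotent (a i)) :
    ∃ τ : MvPowerSeries (Fin d) S →+* MvPowerSeries (Fin d) S, Continuous τ ∧
      (∀ s, τ (C s) = C s) ∧ (∀ i, τ (X i) = C (a i) - X i) ∧ τ.comp τ = RingHom.id _ := by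
  have ha : HasEval (fun i : Fin d => (C (a i) - X i : MvPowerSeries (Fin d) S)) := by
    refine ⟨fun i => ?_, by rw [Filter.cofinite_eq_bot]; exact Filter.tendsto_bot⟩
    rw [sub_eq_add_neg]
    refine IsTopologicallyNilpotent.add ?_
      (WithPiTopology.isTopologicallyNilpotent_of_constantCoeff_zero (by simp))
    exact (ha i).map (φ := (C : S →+* MvPowerSeries (Fin d) S)) WithPiTopology.continuous_C
  have hC := WithPiTopology.continuous_C (σ := Fin d) (R := S)
  obtain ⟨τ, hτ, hτC, hτX⟩ : ∃ τ : MvPowerSeries (Fin d) S →+* MvPowerSeries (Fin d) S,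
      Continuous τ ∧ (∀ s, τ (C s) = C s) ∧ ∀ i, τ (X i) = C (a i) - X i :=
    ⟨eval₂Hom hC ha, by rw [coe_eval₂Hom]; exact continuous_eval₂ hC ha,
      fun i => by rw [coe_eval₂Hom, eval₂_C], fun i => by rw [coe_eval₂Hom, eval₂_X]⟩
  refine ⟨τ, hτ, hτC, hτX, ringHom_ext_of_continuous (hτ.comp hτ) continuous_id
    (fun r => ?_) fun i => ?_⟩
  · simp [hτC]
  · simp [hτX, hτC]

lemma exists_diagonal_reflection (V : Type*) [CommRing V] (d : ℕ) :
    ∃ τ : MvPowerSeries (Fin d) (MvPowerSeries (Fin d) V) →+*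
      MvPowerSeries (Fin d) (MvPowerSeries (Fin d) V),
      (∀ s, τ (C s) = C s) ∧ (∀ i, τ (X i) = C (X i) - X i) ∧ τ.comp τ = RingHom.id _ ∧
      ∀ g : MvPowerSeries (Fin d) V,
        constantCoeff (τ (map (C : V →+* MvPowerSeries (Fin d) V) g)) = g := by
  let _ : UniformSpace V := ⊥
  have : DiscreteTopology V := ⟨rfl⟩
  have : CompleteSpace V := inferInstance
  obtain ⟨τ, hτ, hτC, hτX, hττ⟩ := exists_reflection d (S := MvPowerSeries (Fin d) V) X
    fun i => WithPiTopology.isTopologicallyNilpotent_of_constantCoeff_zero (by simp)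
  refine ⟨τ, hτC, hτX, hττ, fun g => ?_⟩
  refine DFunLike.congr_fun (f := ((constantCoeff (σ := Fin d)).comp τ).comp
    (map (C : V →+* MvPowerSeries (Fin d) V))) (g := RingHom.id _) ?_ g
  refine ringHom_ext_of_continuous ?_ continuous_id (fun r => ?_) fun i => ?_
  · refine (WithPiTopology.continuous_constantCoeff _).comp (hτ.comp ?_)
    refine continuous_pi fun n => ?_
    exact (WithPiTopology.continuous_C (σ := Fin d)).comp (WithPiTopology.continuous_coeff V n)
  · change constantCoeff (τ (map C (C r))) = C r
    rw [map_C, hτC, constantCoeff_C]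
  · change constantCoeff (τ (map C (X i))) = X i
    rw [map_X, hτX]
    simp

end MvPowerSeries

namespace Module.Flat

open TensorProduct Pointwise RingTheory.Sequence

section RegularSequence

variable {R : Type*} [CommRing R] {A : Type*} [AddCommGroup A] [Module R A]

lemma exists_lTensor_span_singleton_sup {I J : Ideal R} {y : R} (hJ : J = I ⊔ Ideal.span {y})
    (hIJ : I ≤ J) (hy : y ∈ J) (t : A ⊗[R] J) :
    ∃ (s : A ⊗[R] I) (a : A), t = (Submodule.inclusion hIJ).lTensor A s + a ⊗ₜ ⟨y, hy⟩ := by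
  induction t using TensorProduct.induction_on with
  | zero => exact ⟨0, 0, by simp⟩
  | tmul a j =>
    obtain ⟨j, hj⟩ := j
    obtain ⟨i, hi, z, hz, h⟩ := Submodule.mem_sup.1 (hJ ▸ hj)
    obtain ⟨r, rfl⟩ := Ideal.mem_span_singleton'.1 hz
    refine ⟨a ⊗ₜ ⟨i, hi⟩, r • a, ?_⟩
    rw [LinearMap.lTensor_tmul, TensorProduct.smul_tmul, ← TensorProduct.tmul_add]
    congr 1
    exact Subtype.ext h.symm
  | add t₁ t₂ h₁ h₂ =>
    obtain ⟨s₁, a₁, rfl⟩ := h₁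
    obtain ⟨s₂, a₂, rfl⟩ := h₂
    exact ⟨s₁ + s₂, a₁ + a₂, by rw [map_add, TensorProduct.add_tmul]; abel⟩

/-- Tensoring `0 → (I : y) → I × R → I + (y) → 0`. -/
lemma exists_lTensor_of_add_eq_zero {I J C : Ideal R} {y : R} (hJ : J = I ⊔ Ideal.span {y})
    (hIJ : I ≤ J) (hy : y ∈ J) (hC : ∀ c, c ∈ C ↔ y * c ∈ I) (m : C →ₗ[R] I)
    (hm : ∀ c, (m c : R) = y * c) (s : A ⊗[R] I) (a : A)
    (h : (Submodule.inclusion hIJ).lTensor A s + a ⊗ₜ ⟨y, hy⟩ = 0) :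
    ∃ c : A ⊗[R] C, m.lTensor A c = s ∧ a ⊗ₜ (1 : R) = - (C.subtype).lTensor A c := by
  let f : C →ₗ[R] (I × R) := m.prod (-C.subtype)
  let g : (I × R) →ₗ[R] J := (Submodule.inclusion hIJ).coprod (LinearMap.toSpanSingleton R J ⟨y, hy⟩)
  have hfg : Function.Exact f g := by
    intro x
    constructor
    · intro hx
      have hx' : (x.1 : R) + x.2 * y = 0 := by simpa [g] using congrArg Subtype.val hx
      have : y * -x.2 = x.1 := by linear_combination -hx'
      refine ⟨⟨-x.2, (hC _).2 (this ▸ x.1.2)⟩, Prod.ext (Subtype.ext ?_) ?_⟩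
      · simpa [f, hm] using this
      · simp [f]
    · rintro ⟨c, rfl⟩
      refine Subtype.ext ?_
      simp [f, g, hm, mul_comm]
  have hg : Function.Surjective g := by
    rintro ⟨j, hj⟩
    obtain ⟨i, hi, z, hz, h⟩ := Submodule.mem_sup.1 (hJ ▸ hj)
    obtain ⟨r, rfl⟩ := Ideal.mem_span_singleton'.1 hz
    exact ⟨(⟨i, hi⟩, r), Subtype.ext (by simpa [g] using h)⟩
  obtain ⟨c, hc⟩ := (_root_.lTensor_exact A hfg hg
    ((LinearMap.inl R I R).lTensor A s + a ⊗ₜ (0, 1))).1 (by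
      have h1 : g ∘ₗ LinearMap.inl R I R = Submodule.inclusion hIJ := LinearMap.coprod_inl _ _
      have h2 : g (0, 1) = ⟨y, hy⟩ := by
        rw [LinearMap.coprod_apply, map_zero, zero_add, LinearMap.toSpanSingleton_apply, one_smul]
      rw [map_add, ← LinearMap.lTensor_comp_apply, LinearMap.lTensor_tmul, h1, h2]
      exact h)
  refine ⟨c, ?_, ?_⟩
  · have := congrArg ((LinearMap.fst R I R).lTensor A) hc
    rw [map_add, ← LinearMap.lTensor_comp_apply, ← LinearMap.lTensor_comp_apply,
      LinearMap.fst_comp_inl] at this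
    simpa [f, LinearMap.fst_prod] using this
  · have := congrArg ((LinearMap.snd R I R).lTensor A) hc
    rw [map_add, ← LinearMap.lTensor_comp_apply, ← LinearMap.lTensor_comp_apply,
      LinearMap.snd_comp_inl] at this
    simpa [f, LinearMap.snd_prod, LinearMap.lTensor_neg] using this.symm

lemma lTensor_subtype_injective_sup {I J : Ideal R} {y : R} (hJ : J = I ⊔ Ideal.span {y})
    (hy : IsSMulRegular (A ⧸ (I • ⊤ : Submodule R A)) y)
    (hI : Function.Injective (I.subtype.lTensor A)) : Function.Injective (J.subtype.lTensor A) := by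
  have hIJ : I ≤ J := hJ ▸ le_sup_left
  have hyJ : y ∈ J := hJ ▸ Ideal.mem_sup_right (Ideal.mem_span_singleton_self y)
  have hcomp : ∀ s, J.subtype.lTensor A ((Submodule.inclusion hIJ).lTensor A s) =
      I.subtype.lTensor A s := fun s => by
    rw [← LinearMap.lTensor_comp_apply]; rfl
  have hrange : ∀ a ∈ (I • ⊤ : Submodule R A), ∃ s : A ⊗[R] I,
      I.subtype.lTensor A s = a ⊗ₜ (1 : R) := by
    intro a ha
    refine Submodule.smul_induction_on ha (fun i hi a _ => ⟨a ⊗ₜ ⟨i, hi⟩, ?_⟩) ?_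
    · rw [LinearMap.lTensor_tmul, TensorProduct.smul_tmul]
      simp
    · rintro _ _ ⟨s₁, h₁⟩ ⟨s₂, h₂⟩
      exact ⟨s₁ + s₂, by rw [map_add, h₁, h₂, TensorProduct.add_tmul]⟩
  have hmem : ∀ s : A ⊗[R] I, TensorProduct.rid R A (I.subtype.lTensor A s) ∈
      (I • ⊤ : Submodule R A) := by
    intro s
    induction s using TensorProduct.induction_on with
    | zero => simp
    | tmul a i => simpa using Submodule.smul_mem_smul i.2 (Submodule.mem_top (x := a))
    | add s t hs ht => rw [map_add, map_add]; exact add_mem hs ht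
  rw [injective_iff_map_eq_zero]
  intro t ht
  obtain ⟨s, a, rfl⟩ := exists_lTensor_span_singleton_sup hJ hIJ hyJ t
  rw [map_add, hcomp, LinearMap.lTensor_tmul] at ht
  have ha : a ∈ (I • ⊤ : Submodule R A) := by
    rw [← Submodule.Quotient.mk_eq_zero]
    refine hy.right_eq_zero_of_smul ?_
    rw [← Submodule.Quotient.mk_smul, Submodule.Quotient.mk_eq_zero]
    have h1 := congrArg (TensorProduct.rid R A) ht
    rw [map_add, map_zero] at h1
    have h2 := hmem s
    rw [eq_neg_of_add_eq_zero_left h1, neg_mem_iff] at h2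
    simpa using h2
  obtain ⟨s', hs'⟩ := hrange a ha
  have key : ∀ s' : A ⊗[R] I, ((TensorProduct.rid R A (I.subtype.lTensor A s')) ⊗ₜ ⟨y, hyJ⟩ :
      A ⊗[R] J) = (Submodule.inclusion hIJ).lTensor A (y • s') := by
    intro s'
    induction s' using TensorProduct.induction_on with
    | zero => simp
    | tmul a i =>
      rw [LinearMap.lTensor_tmul, ← TensorProduct.tmul_smul, LinearMap.lTensor_tmul,
        TensorProduct.rid_tmul, TensorProduct.smul_tmul]
      congr 1
      exact Subtype.ext (mul_comm _ _)
    | add s t hs ht => rw [map_add, map_add, TensorProduct.add_tmul, hs, ht, smul_add, map_add]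
  have hk := key s'
  rw [hs', TensorProduct.rid_tmul, one_smul] at hk
  rw [hk, ← map_add]
  have h0 : s + y • s' = 0 := by
    refine hI ?_
    rw [map_add, map_smul, hs', map_zero, ← ht]
    rw [← TensorProduct.tmul_smul, smul_eq_mul, mul_one]
    rfl
  rw [h0, map_zero]

lemma lTensor_subtype_injective_ofList (xs : List R) (h : IsWeaklyRegular A xs) :
    Function.Injective ((Ideal.ofList xs).subtype.lTensor A) := by
  induction xs using List.reverseRecOn with
  | nil =>
    rw [Ideal.ofList_nil]
    rw [injective_iff_map_eq_zero]
    intro t _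
    have : Subsingleton (A ⊗[R] (⊥ : Ideal R)) := inferInstance
    exact Subsingleton.elim _ _
  | append_singleton xs x ih =>
    rw [isWeaklyRegular_append_iff] at h
    refine lTensor_subtype_injective_sup (I := Ideal.ofList xs) (y := x) (by simp) ?_ (ih h.1)
    simpa using h.2

lemma finite_tensorProduct {B : Type*} [CommRing B] [Algebra R B] [Module B A]
    [IsScalarTower R B A] [Module.Finite B A] (L : Type*) [AddCommGroup L] [Module R L]
    [Module.Finite R L] : Module.Finite B (A ⊗[R] L) := by
  obtain ⟨n, f, hf⟩ := Module.Finite.exists_fin' R L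
  refine Module.Finite.of_surjective
    ((TensorProduct.AlgebraTensorModule.lTensor B A f) ∘ₗ
      (TensorProduct.piScalarRight R B A (Fin n)).symm.toLinearMap) ?_
  exact (LinearMap.lTensor_surjective A hf).comp (LinearEquiv.surjective _)

theorem of_isWeaklyRegular [IsNoetherianRing R] [IsLocalRing R] {B : Type*} [CommRing B]
    [IsNoetherianRing B] [Algebra R B] [Module B A] [IsScalarTower R B A] [Module.Finite B A]
    (hB : ∀ x ∈ maximalIdeal R, algebraMap R B x ∈ Ideal.jacobson (⊥ : Ideal B))
    (xs : List R) (hxs : Ideal.ofList xs = maximalIdeal R) (h : IsWeaklyRegular A xs) :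
    Module.Flat R A := by
  rw [Module.Flat.iff_lTensor_injective']
  intro I
  induction I using IsNoetherian.induction with
  | hgt I ih =>
  by_cases hI : maximalIdeal R ≤ I
  · by_cases hI1 : I = ⊤
    · subst hI1
      have : Function.Bijective (Submodule.subtype (⊤ : Ideal R)) :=
        ⟨Subtype.val_injective, fun x => ⟨⟨x, trivial⟩, rfl⟩⟩
      exact ((LinearEquiv.ofBijective _ this).lTensor A).injective
    · have hIm : I = Ideal.ofList xs :=
        ((maximalIdeal.isMaximal R).eq_of_le hI1 hI).symm.trans hxs.symm
      rw [hIm]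
      exact lTensor_subtype_injective_ofList xs h
  obtain ⟨y, hym, hyI⟩ := Set.not_subset.1 hI
  obtain ⟨J, hJ⟩ : ∃ J, J = I ⊔ Ideal.span {y} := ⟨_, rfl⟩
  have hIJ : I ≤ J := hJ ▸ le_sup_left
  have hyJ : y ∈ J := hJ ▸ Ideal.mem_sup_right (Ideal.mem_span_singleton_self y)
  have hJinj := ih J (lt_of_le_of_ne hIJ fun h => hyI (h ▸ hyJ))
  obtain ⟨C, hC⟩ : ∃ C : Ideal R, ∀ c, c ∈ C ↔ y * c ∈ I :=
    ⟨I.comap (LinearMap.mulLeft R y), fun c => Iff.rfl⟩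
  have hIC : I ≤ C := fun i hi => (hC i).2 (Ideal.mul_mem_left I _ hi)
  let m : C →ₗ[R] I := (LinearMap.mulLeft R y).restrict fun c hc => (hC c).1 hc
  have key : ∀ t : A ⊗[R] I, I.subtype.lTensor A t = 0 →
      ∃ c : A ⊗[R] C, m.lTensor A c = t ∧ C.subtype.lTensor A c = 0 := by
    intro t ht
    obtain ⟨c, hc1, hc2⟩ := exists_lTensor_of_add_eq_zero hJ hIJ hyJ hC m (fun _ => rfl) t 0 (by
      rw [TensorProduct.zero_tmul, add_zero]
      refine hJinj ?_
      rw [← LinearMap.lTensor_comp_apply, map_zero, ← ht]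
      rfl)
    exact ⟨c, hc1, by simpa using hc2.symm⟩
  rcases hIC.lt_or_eq with hlt | rfl
  · rw [injective_iff_map_eq_zero]
    intro t ht
    obtain ⟨c, rfl, hc⟩ := key t ht
    rw [ih C hlt (hc.trans (map_zero _).symm), map_zero]
  let μ := TensorProduct.AlgebraTensorModule.lTensor B A I.subtype
  have hfin : Module.Finite B (A ⊗[R] I) := finite_tensorProduct _
  have hm : ∀ c : A ⊗[R] I, m.lTensor A c = algebraMap R B y • c := by
    intro c
    rw [algebraMap_smul]
    induction c using TensorProduct.induction_on with
    | zero => simp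
    | tmul a i =>
      rw [LinearMap.lTensor_tmul, ← TensorProduct.tmul_smul]
      rfl
    | add s t hs ht => rw [map_add, hs, ht, smul_add]
  have hker : LinearMap.ker μ = ⊥ := by
    refine Submodule.eq_bot_of_le_smul_of_le_jacobson_bot (Ideal.span {algebraMap R B y}) _
      (IsNoetherian.noetherian _) ?_ ((Ideal.span_singleton_le_iff_mem _).2 (hB y hym))
    intro t ht
    obtain ⟨c, rfl, hc⟩ := key t ht
    rw [hm]
    exact Submodule.smul_mem_smul (Ideal.mem_span_singleton_self _) hc
  rw [injective_iff_map_eq_zero]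
  exact fun t ht => (Submodule.mem_bot B).1 (hker ▸ (show t ∈ LinearMap.ker μ from ht))

end RegularSequence

end Module.Flat

namespace MvPowerSeries

open RingTheory.Sequence Pointwise

noncomputable section Hat

variable {ι κ S : Type*} [CommRing S]

/-- The power series with the given coefficients. -/
def ofCoeff (c : (ι →₀ ℕ) → S) : MvPowerSeries ι S := c

lemma coeff_ofCoeff (c : (ι →₀ ℕ) → S) (n : ι →₀ ℕ) : coeff n (ofCoeff c) = c n := rfl

/-- The vectors of power series all of whose coefficients lie in `Z`. -/
def hat (ι : Type*) (Z : Submodule S (κ → S)) :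
    Submodule (MvPowerSeries ι S) (κ → MvPowerSeries ι S) where
  carrier := {w | ∀ n, (fun j => coeff n (w j)) ∈ Z}
  zero_mem' n := Z.zero_mem
  add_mem' {v w} hv hw n := Z.add_mem (hv n) (hw n)
  smul_mem' b w hw n := by
    classical
    have : (fun j => coeff n ((b • w) j)) = ∑ p ∈ Finset.HasAntidiagonal.antidiagonal n,
        coeff p.1 b • (fun j => coeff p.2 (w j)) := by
      funext j
      simp [coeff_mul, Finset.sum_apply]
    rw [this]
    exact Z.sum_mem fun p _ => Z.smul_mem _ (hw p.2)

lemma C_comp_mem_hat {Z : Submodule S (κ → S)} {z : κ → S} (hz : z ∈ Z) :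
    (fun j => C (z j)) ∈ hat ι Z := by
  classical
  intro n
  by_cases hn : n = 0
  · simpa [hn] using hz
  · convert Z.zero_mem using 1
    funext j
    simp [coeff_C, hn]

lemma exists_sum_of_mem_hat {Z : Submodule S (κ → S)} {m : ℕ} {z : Fin m → κ → S}
    (hz : Submodule.span S (Set.range z) = Z) {w : κ → MvPowerSeries ι S} (hw : w ∈ hat ι Z) :
    ∃ b : Fin m → MvPowerSeries ι S, w = ∑ k, b k • fun j => C (z k j) := by
  have h : ∀ n, ∃ c : Fin m → S, ∑ k, c k • z k = fun j => coeff n (w j) := fun n =>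
    (Submodule.mem_span_range_iff_exists_fun S).1 (hz ▸ hw n)
  choose c hc using h
  refine ⟨fun k => ofCoeff fun n => c n k, ?_⟩
  funext j
  ext n
  have := congrFun (hc n) j
  simp only [Finset.sum_apply, Pi.smul_apply, smul_eq_mul] at this ⊢
  rw [map_sum, ← this]
  refine Finset.sum_congr rfl fun k _ => ?_
  rw [coeff_mul_C, coeff_ofCoeff]

lemma map_mem_hat [IsNoetherianRing S] [Finite κ] {Z : Submodule S (κ → S)}
    (τ : MvPowerSeries ι S →+* MvPowerSeries ι S) (hτ : ∀ s, τ (C s) = C s)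
    {w : κ → MvPowerSeries ι S} (hw : w ∈ hat ι Z) : (fun j => τ (w j)) ∈ hat ι Z := by
  have := Fintype.ofFinite κ
  obtain ⟨m, z, hz⟩ := Submodule.fg_iff_exists_fin_generating_family.1 (IsNoetherian.noetherian Z)
  obtain ⟨b, rfl⟩ := exists_sum_of_mem_hat hz hw
  have : (fun j => τ ((∑ k, b k • fun j => C (z k j) : κ → MvPowerSeries ι S) j)) =
      ∑ k, τ (b k) • fun j => (C (z k j) : MvPowerSeries ι S) := by
    funext j
    simp [Finset.sum_apply, hτ]
  rw [this]
  exact Submodule.sum_mem _ fun k _ => Submodule.smul_mem _ _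
    (C_comp_mem_hat (hz ▸ Submodule.subset_span ⟨k, rfl⟩))

lemma coeff_X_mul' [DecidableEq ι] (j : ι) (f : MvPowerSeries ι S) (n : ι →₀ ℕ) :
    coeff n (X j * f) = if n j = 0 then 0 else coeff (n - Finsupp.single j 1) f := by
  rw [X, coeff_monomial_mul, one_mul]
  by_cases h : n j = 0
  · rw [if_pos h, if_neg]
    rw [Finsupp.single_le_iff]
    omega
  · rw [if_neg h, if_pos]
    rw [Finsupp.single_le_iff]
    omega

lemma mem_ofList_X_smul_top_hat {Z : Submodule S (κ → S)} (l : List ι) (w : hat ι Z) :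
    w ∈ (Ideal.ofList (l.map (X : ι → MvPowerSeries ι S)) • ⊤ : Submodule (MvPowerSeries ι S) (hat ι Z)) ↔
      ∀ n : ι →₀ ℕ, (∀ j ∈ l, n j = 0) → ∀ k, coeff n (w.1 k) = 0 := by
  classical
  induction l generalizing w with
  | nil =>
    simp only [List.map_nil, Ideal.ofList_nil, Submodule.bot_smul, Submodule.mem_bot]
    refine ⟨fun h => by simp [h], fun h => Subtype.ext (funext fun k => ext fun n => ?_)⟩
    simpa using h n (by simp) k
  | cons j l ih =>
    rw [List.map_cons, Ideal.ofList_cons, Submodule.sup_smul]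
    constructor
    · rw [Submodule.mem_sup]
      rintro ⟨a, ha, b, hb, rfl⟩ n hn k
      rw [Submodule.ideal_span_singleton_smul, Submodule.mem_smul_pointwise_iff_exists] at ha
      obtain ⟨a, -, rfl⟩ := ha
      have h1 := (ih b).1 hb n (fun i hi => hn i (List.mem_cons_of_mem _ hi)) k
      have h2 : coeff n (X j * a.1 k) = 0 := by
        rw [coeff_X_mul', if_pos (hn j List.mem_cons_self)]
      simp only [Submodule.coe_add, Submodule.coe_smul, Pi.add_apply, Pi.smul_apply, smul_eq_mul,
        map_add, h1, h2, add_zero]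
    · intro h
      let w0 : hat ι Z := ⟨fun k => ofCoeff fun n => if n j = 0 then coeff n (w.1 k) else 0, fun n => by
        by_cases hn : n j = 0
        · convert w.2 n using 2 with k
          exact if_pos hn
        · convert Z.zero_mem using 1
          funext k
          exact if_neg hn⟩
      let w1 : hat ι Z := ⟨fun k => ofCoeff fun n => coeff (n + Finsupp.single j 1) (w.1 k), fun n => w.2 _⟩
      have hw0 : ∀ k n, coeff n (w0.1 k) = if n j = 0 then coeff n (w.1 k) else 0 :=
        fun _ _ => rfl
      have hw1 : ∀ k n, coeff n (w1.1 k) = coeff (n + Finsupp.single j 1) (w.1 k) :=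
        fun _ _ => rfl
      have hw : w = (X j : MvPowerSeries ι S) • w1 + w0 := by
        refine Subtype.ext (funext fun k => ext fun n => ?_)
        simp only [Submodule.coe_add, Submodule.coe_smul, Pi.add_apply, Pi.smul_apply, smul_eq_mul,
          map_add, coeff_X_mul', hw0, hw1]
        by_cases hn : n j = 0
        · simp [hn]
        · rw [if_neg hn, if_neg hn, add_zero, tsub_add_cancel_of_le]
          rw [Finsupp.single_le_iff]
          omega
      rw [hw]
      refine Submodule.add_mem_sup (Submodule.smul_mem_smul
        (Ideal.mem_span_singleton_self _) trivial) ((ih w0).2 fun n hn k => ?_)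
      rw [hw0]
      by_cases hj : n j = 0
      · rw [if_pos hj]
        exact h n (by simpa [hj] using hn) k
      · rw [if_neg hj]

lemma isWeaklyRegular_map_X_hat (Z : Submodule S (κ → S)) {l : List ι} (hl : l.Nodup) :
    IsWeaklyRegular (hat ι Z) (l.map (X : ι → MvPowerSeries ι S)) := by
  classical
  induction l using List.reverseRecOn with
  | nil => exact IsWeaklyRegular.nil _ _
  | append_singleton l j ih =>
    rw [List.map_append, isWeaklyRegular_append_iff]
    have hjl : j ∉ l := by
      intro hj
      exact (List.nodup_append.1 hl).2.2 j hj j (by simp) rfl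
    refine ⟨ih (List.nodup_append.1 hl).1, ?_⟩
    rw [List.map_singleton, isWeaklyRegular_singleton_iff, isSMulRegular_iff_right_eq_zero_of_smul]
    intro w
    obtain ⟨w, rfl⟩ := Submodule.Quotient.mk_surjective _ w
    rw [← Submodule.Quotient.mk_smul, Submodule.Quotient.mk_eq_zero, Submodule.Quotient.mk_eq_zero,
      mem_ofList_X_smul_top_hat, mem_ofList_X_smul_top_hat]
    intro h n hn k
    have := h (n + Finsupp.single j 1) (fun i hi => by
      have : j ≠ i := fun e => hjl (e ▸ hi)
      simp [hn i hi, this]) k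
    have h2 : coeff (n + Finsupp.single j 1) (X j * w.1 k) = 0 := this
    rw [coeff_X_mul', if_neg (by simp)] at h2
    simpa using h2

/-- The constant term, as an additive map. -/
def hatConst (Z : Submodule S (κ → S)) : hat ι Z →+ Z where
  toFun w := ⟨fun k => constantCoeff (w.1 k), w.2 0⟩
  map_zero' := Subtype.ext (funext fun _ => by simp)
  map_add' _ _ := Subtype.ext (funext fun _ => by simp)

lemma hatConst_smul (Z : Submodule S (κ → S)) (b : MvPowerSeries ι S) (w : hat ι Z) :
    hatConst Z (b • w) = constantCoeff b • hatConst Z w :=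
  Subtype.ext (funext fun _ => by simp [hatConst])

lemma hatConst_surjective (Z : Submodule S (κ → S)) :
    Function.Surjective (hatConst (ι := ι) Z) := fun z =>
  ⟨⟨_, C_comp_mem_hat z.2⟩, Subtype.ext (funext fun _ => by simp [hatConst])⟩

lemma hatConst_eq_zero_iff (Z : Submodule S (κ → S)) {l : List ι} (hl : ∀ i, i ∈ l) (w : hat ι Z) :
    hatConst Z w = 0 ↔ w ∈ (Ideal.ofList (l.map (X : ι → MvPowerSeries ι S)) • ⊤ :
      Submodule (MvPowerSeries ι S) (hat ι Z)) := by
  rw [mem_ofList_X_smul_top_hat]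
  constructor
  · intro h n hn k
    have h0 : n = 0 := Finsupp.ext fun i => hn i (hl i)
    rw [h0]
    exact congrFun (congrArg Subtype.val h) k
  · intro h
    exact Subtype.ext (funext fun k => h 0 (by simp) k)

end Hat

end MvPowerSeries

namespace RingTheory.Sequence

open Pointwise

section SemilinearReduction

variable {B S A Z : Type*} [CommRing B] [CommRing S] [AddCommGroup A] [Module B A]
  [AddCommGroup Z] [Module S Z]

lemma map_mem_ofList_smul_top (ε : B →+* S) (E : A →+ Z) (hE : ∀ b a, E (b • a) = ε b • E a)
    (us : List B) {a : A} (ha : a ∈ (Ideal.ofList us • ⊤ : Submodule B A)) :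
    E a ∈ (Ideal.ofList (us.map ε) • ⊤ : Submodule S Z) := by
  refine Submodule.smul_induction_on ha (fun b hb a _ => ?_) fun x y hx hy => ?_
  · rw [hE, ← Ideal.map_ofList]
    exact Submodule.smul_mem_smul (Ideal.mem_map_of_mem _ hb) trivial
  · rw [map_add]
    exact add_mem hx hy

lemma isWeaklyRegular_append_singleton_of_ker {us : List B} (hu : IsWeaklyRegular A us)
    (E : A →+ Z) (hker : ∀ a, E a = 0 ↔ a ∈ (Ideal.ofList us • ⊤ : Submodule B A)) {h : B} {c : S}
    (hE : ∀ a, E (h • a) = c • E a) (hc : IsSMulRegular Z c) : IsWeaklyRegular A (us ++ [h]) := by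
  rw [isWeaklyRegular_append_iff, isWeaklyRegular_singleton_iff,
    isSMulRegular_iff_right_eq_zero_of_smul]
  refine ⟨hu, fun a => ?_⟩
  obtain ⟨a, rfl⟩ := Submodule.Quotient.mk_surjective _ a
  rw [← Submodule.Quotient.mk_smul, Submodule.Quotient.mk_eq_zero, Submodule.Quotient.mk_eq_zero,
    ← hker, ← hker, hE]
  exact hc.right_eq_zero_of_smul

lemma isWeaklyRegular_quotSMulTop_of_ker [IsLocalRing B] [IsNoetherianRing B] [Module.Finite B A]
    {us : List B} (hu : IsWeaklyRegular A us)
    (E : A →+ Z) (hker : ∀ a, E a = 0 ↔ a ∈ (Ideal.ofList us • ⊤ : Submodule B A)) {h : B} {c : S}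
    (hE : ∀ a, E (h • a) = c • E a) (hc : IsSMulRegular Z c) (hus : ∀ u ∈ us, u ∈ maximalIdeal B)
    (hh : h ∈ maximalIdeal B) :
    IsWeaklyRegular (QuotSMulTop h A) (us.map (Ideal.Quotient.mk (Ideal.span {h}))) := by
  refine ((isWeaklyRegular_cons_iff' A h us).1 ?_).2
  refine isWeaklyRegular_of_perm_of_subset_maximalIdeal
    (isWeaklyRegular_append_singleton_of_ker hu E hker hE hc) (List.perm_append_singleton _ _) ?_
  intro r hr
  rw [List.mem_append, List.mem_singleton] at hr
  rcases hr with hr | rfl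
  exacts [hus r hr, hh]

lemma exists_quotSMulTop_of_ker {us : List B} (ε : B →+* S) (E : A →+ Z)
    (hE : ∀ b a, E (b • a) = ε b • E a) (hsurj : Function.Surjective E)
    (hker : ∀ a, E a = 0 ↔ a ∈ (Ideal.ofList us • ⊤ : Submodule B A)) (h : B) :
    ∃ E' : QuotSMulTop h A →+ QuotSMulTop (ε h) Z, Function.Surjective E' ∧
      (∀ (b : B) a, E' (b • a) = ε b • E' a) ∧
      ∀ a, E' a = 0 ↔ a ∈ (Ideal.ofList (us.map (Ideal.Quotient.mk (Ideal.span {h}))) • ⊤ :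
        Submodule (B ⧸ Ideal.span {h}) (QuotSMulTop h A)) := by
  have hmem : ∀ a ∈ h • (⊤ : Submodule B A),
      (Submodule.mkQ (ε h • (⊤ : Submodule S Z))).toAddMonoidHom.comp E a = 0 := by
    intro a ha
    obtain ⟨a, -, rfl⟩ := (Submodule.mem_smul_pointwise_iff_exists _ _ _).1 ha
    refine (Submodule.Quotient.mk_eq_zero _).2 ?_
    rw [hE]
    exact Submodule.smul_mem_pointwise_smul _ _ _ trivial
  let E' : QuotSMulTop h A →+ QuotSMulTop (ε h) Z :=
    QuotientAddGroup.lift (h • (⊤ : Submodule B A)).toAddSubgroup _ hmem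
  have hE' : ∀ a, E' (Submodule.Quotient.mk a) = Submodule.Quotient.mk (E a) := fun _ => rfl
  refine ⟨E', fun z => ?_, fun b a => ?_, fun a => ⟨fun ha => ?_, fun ha => ?_⟩⟩
  · obtain ⟨z, rfl⟩ := Submodule.Quotient.mk_surjective _ z
    obtain ⟨a, rfl⟩ := hsurj z
    exact ⟨Submodule.Quotient.mk a, rfl⟩
  · obtain ⟨a, rfl⟩ := Submodule.Quotient.mk_surjective _ a
    rw [← Submodule.Quotient.mk_smul, hE', hE', hE, Submodule.Quotient.mk_smul]
  · obtain ⟨a, rfl⟩ := Submodule.Quotient.mk_surjective _ a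
    rw [hE', Submodule.Quotient.mk_eq_zero] at ha
    obtain ⟨z, -, hz⟩ := (Submodule.mem_smul_pointwise_iff_exists _ _ _).1 ha
    obtain ⟨a', rfl⟩ := hsurj z
    have h1 : a - h • a' ∈ (Ideal.ofList us • ⊤ : Submodule B A) := by
      rw [← hker, map_sub, hE, hz, sub_self]
    have h2 := map_mem_ofList_smul_top (Ideal.Quotient.mk (Ideal.span {h}))
      (Submodule.mkQ (h • (⊤ : Submodule B A))).toAddMonoidHom (fun b a => rfl) us h1
    have h3 : (Submodule.mkQ (h • (⊤ : Submodule B A))).toAddMonoidHom (a - h • a') =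
        Submodule.Quotient.mk a := by
      refine (Submodule.Quotient.eq _).2 ?_
      rw [sub_sub_cancel_left, neg_mem_iff]
      exact Submodule.smul_mem_pointwise_smul _ _ _ trivial
    rwa [h3] at h2
  · refine Submodule.smul_induction_on ha (fun b hb a _ => ?_) fun x y hx hy => ?_
    · obtain ⟨a, rfl⟩ := Submodule.Quotient.mk_surjective _ a
      rw [← Ideal.map_ofList, Ideal.mem_map_iff_of_surjective _ Ideal.Quotient.mk_surjective] at hb
      obtain ⟨b, hb, rfl⟩ := hb
      change E' (Submodule.Quotient.mk (b • a)) = 0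
      rw [hE', (hker _).2 (Submodule.smul_mem_smul hb trivial), Submodule.Quotient.mk_zero]
    · rw [map_add, hx, hy, add_zero]

end SemilinearReduction

end RingTheory.Sequence

namespace FreeCx

open TensorProduct Pointwise RingTheory.Sequence

section DiagonalReduction

lemma piScalarRight_lTensor_d {R : Type*} [CommRing R] (G : FreeCx R) (A : Type*) [AddCommGroup A]
    [Module R A] (i : ℕ) (t : A ⊗[R] (Fin (G.rk (i + 1)) → R)) :
    piScalarRight R R A _ ((G.d R i).lTensor A t) = G.d A i (piScalarRight R R A _ t) := by
  induction t using TensorProduct.induction_on with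
  | zero => simp
  | tmul a v =>
    ext j
    simp [d_apply, Finset.sum_smul, mul_smul]
  | add s t hs ht => simp only [map_add, hs, ht]

lemma subsingleton_T_of_flat {R : Type*} [CommRing R] (G : FreeCx R) {i : ℕ}
    (h : Subsingleton (G.T R i)) (A : Type*) [AddCommGroup A] [Module R A] [Module.Flat R A] :
    Subsingleton (G.T A i) := by
  rw [subsingleton_T_iff] at h ⊢
  have hex : Function.Exact (G.d R (i + 1)) (G.d R i) := fun v =>
    ⟨h v, by rintro ⟨w, rfl⟩; exact G.d_d i w⟩
  intro v hv
  have h1 := (Module.Flat.lTensor_exact A hex) ((piScalarRight R R A _).symm v)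
  obtain ⟨t, ht⟩ := h1.1 (by
    apply (piScalarRight R R A _).injective
    rw [piScalarRight_lTensor_d, LinearEquiv.apply_symm_apply, hv, map_zero])
  refine ⟨piScalarRight R R A _ t, ?_⟩
  rw [← piScalarRight_lTensor_d, ht, LinearEquiv.apply_symm_apply]

lemma subsingleton_T_pi {R : Type*} [CommRing R] (G : FreeCx R) {i : ℕ} {κ : Type*} {A : Type*}
    [AddCommGroup A] [Module R A] (h : Subsingleton (G.T A i)) : Subsingleton (G.T (κ → A) i) := by
  rw [subsingleton_T_iff] at h ⊢
  intro v hv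
  have : ∀ k, ∃ w, G.d A (i + 1) w = fun j => v j k := fun k => h _ (by
    ext j
    have := congrFun (congrFun hv j) k
    simpa [d_apply, Finset.sum_apply] using this)
  choose w hw using this
  refine ⟨fun j k => w k j, ?_⟩
  ext j k
  rw [← congrFun (hw k) j]
  simp [d_apply, Finset.sum_apply]

/-- Tor rigidity over `R`, reduced to a module over a larger ring `B` retracting onto `R`. -/
theorem subsingleton_T_of_retract {R B : Type u} [CommRing R] [IsLocalRing R] [IsNoetherianRing R]
    [CommRing B] [IsLocalRing B] [IsNoetherianRing B] [Algebra R B] [Algebra B R]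
    (hev : ∀ r : R, algebraMap B R (algebraMap R B r) = r)
    (hB : ∀ x ∈ maximalIdeal R, algebraMap R B x ∈ maximalIdeal B)
    (xs : List R) (hxs : Ideal.ofList xs = maximalIdeal R) (us : List B)
    {A : Type u} [AddCommGroup A] [Module B A] [Module.Finite B A]
    (hx : IsWeaklyRegular A (xs.map (algebraMap R B))) (hu : IsWeaklyRegular A us)
    {Z D D' F : Type u} [AddCommGroup Z] [Module R Z] [AddCommGroup D] [Module R D]
    [Module.Finite R D] [AddCommGroup D'] [Module R D'] [AddCommGroup F] [Module R F]
    (E : A →+ Z) (hE : Function.Surjective E) (hEsmul : ∀ (b : B) a, E (b • a) =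
      algebraMap B R b • E a)
    (hEker : ∀ a, E a = 0 ↔ a ∈ (Ideal.ofList us • ⊤ : Submodule B A))
    (f : D →ₗ[R] Z) (g : Z →ₗ[R] D') (hf : Function.Injective f) (hg : Function.Surjective g)
    (hfg : Function.Exact f g)
    (p : D' →ₗ[R] F) (q : F →ₗ[R] D) (hp : Function.Injective p) (hq : Function.Surjective q)
    (hpq : Function.Exact p q)
    (G : FreeCx R) (h0 : G.rk 0 = 0) {K : ℕ} (hK : ∀ i, K ≤ i → G.rk (i + 1) = 0)
    (hTR : ∀ i, Subsingleton (G.T R (i + 1))) (hTF : ∀ i, Subsingleton (G.T F (i + 1)))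
    (hT1 : Subsingleton (G.T D 1)) (i : ℕ) : Subsingleton (G.T D (i + 1)) := by
  let _ : Module R A := Module.compHom A (algebraMap R B)
  have : IsScalarTower R B A := IsScalarTower.of_algebraMap_smul fun _ _ => rfl
  have hflat : Module.Flat R A := Module.Flat.of_isWeaklyRegular (B := B)
    (fun x hx => (IsLocalRing.jacobson_eq_maximalIdeal (⊥ : Ideal B) bot_ne_top).symm ▸ hB x hx) xs hxs
    ((isWeaklyRegular_map_algebraMap_iff B A xs).1 hx)
  let _ : Module B Z := Module.compHom Z (algebraMap B R)
  let _ : Module B D := Module.compHom D (algebraMap B R)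
  let _ : Module B D' := Module.compHom D' (algebraMap B R)
  let _ : Module B F := Module.compHom F (algebraMap B R)
  have : IsScalarTower B R Z := IsScalarTower.of_algebraMap_smul fun _ _ => rfl
  have : IsScalarTower B R D := IsScalarTower.of_algebraMap_smul fun _ _ => rfl
  have : IsScalarTower B R D' := IsScalarTower.of_algebraMap_smul fun _ _ => rfl
  have : IsScalarTower B R F := IsScalarTower.of_algebraMap_smul fun _ _ => rfl
  have : IsScalarTower R B Z := IsScalarTower.of_algebraMap_smul fun r x =>
    (algebraMap_smul R (algebraMap R B r) x).symm.trans (by rw [hev])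
  have : IsScalarTower R B D := IsScalarTower.of_algebraMap_smul fun r x =>
    (algebraMap_smul R (algebraMap R B r) x).symm.trans (by rw [hev])
  have : IsScalarTower R B F := IsScalarTower.of_algebraMap_smul fun r x =>
    (algebraMap_smul R (algebraMap R B r) x).symm.trans (by rw [hev])
  have : Module.Finite B D := by
    obtain ⟨s, hs⟩ := Module.Finite.fg_top (R := R) (M := D)
    refine ⟨⟨s, ?_⟩⟩
    rw [← Submodule.restrictScalars_eq_top_iff R, eq_top_iff, ← hs, Submodule.span_le]
    exact Submodule.subset_span
  let E' : A →ₗ[B] Z := { E with map_smul' := hEsmul }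
  have hE' : LinearMap.ker E' = (Ideal.ofList us • ⊤ : Submodule B A) :=
    Submodule.ext fun a => hEker a
  let e : (A ⧸ (Ideal.ofList us • ⊤ : Submodule B A)) ≃ₗ[B] Z :=
    (Submodule.quotEquivOfEq _ _ hE'.symm).trans (E'.quotKerEquivOfSurjective hE)
  rw [← G.subsingleton_baseChange_T_iff (Q := B)] at hT1 ⊢
  refine (G.baseChange B).subsingleton_T_of_exact h0 hK us hu e (fun i => ?_)
    (f.restrictScalars B) (g.restrictScalars B) hf hg hfg
    (p.restrictScalars B) (q.restrictScalars B) hp hq hpq (fun i => ?_) hT1 i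
  · rw [G.subsingleton_baseChange_T_iff]
    exact G.subsingleton_T_of_flat (hTR i) A
  · rw [G.subsingleton_baseChange_T_iff]
    exact hTF i

end DiagonalReduction

end FreeCx

namespace MvPowerSeries

open RingTheory.Sequence Pointwise

section Diagonal

lemma X_mem_maximalIdeal {ι S : Type*} [CommRing S] [IsLocalRing S] (i : ι) :
    (X i : MvPowerSeries ι S) ∈ maximalIdeal (MvPowerSeries ι S) := by
  rw [mem_maximalIdeal, mem_nonunits_iff, isUnit_iff_constantCoeff, constantCoeff_X]
  exact not_isUnit_zero

lemma exists_diagonal_hat {V : Type*} [CommRing V] [IsLocalRing V] [IsNoetherianRing V] (d : ℕ)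
    {κ : Type*} [Finite κ] (Z : Submodule (MvPowerSeries (Fin d) V) (κ → MvPowerSeries (Fin d) V)) :
    ∃ (ε : MvPowerSeries (Fin d) (MvPowerSeries (Fin d) V) →+* MvPowerSeries (Fin d) V)
      (us : List (MvPowerSeries (Fin d) (MvPowerSeries (Fin d) V))) (E : hat (Fin d) Z →+ Z),
      (∀ f, ε (map C f) = f) ∧ (∀ u ∈ us, u ∈ maximalIdeal _) ∧
      Function.Surjective E ∧ (∀ b w, E (b • w) = ε b • E w) ∧
      (∀ w, E w = 0 ↔ w ∈ (Ideal.ofList us • ⊤ :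
        Submodule (MvPowerSeries (Fin d) (MvPowerSeries (Fin d) V)) (hat (Fin d) Z))) ∧
      IsWeaklyRegular (hat (Fin d) Z) us := by
  obtain ⟨τ, hτC, hτX, hττ, hτ⟩ := exists_diagonal_reflection V d
  have hττ' : ∀ f, τ (τ f) = f := fun f => RingHom.congr_fun hττ f
  let T : hat (Fin d) Z ≃+ hat (Fin d) Z :=
    { toFun := fun w => ⟨fun k => τ (w.1 k), map_mem_hat τ hτC w.2⟩
      invFun := fun w => ⟨fun k => τ (w.1 k), map_mem_hat τ hτC w.2⟩
      left_inv := fun w => Subtype.ext (funext fun k => hττ' _)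
      right_inv := fun w => Subtype.ext (funext fun k => hττ' _)
      map_add' := fun v w => Subtype.ext (funext fun k => map_add τ _ _) }
  have hT : ∀ b w, T (b • w) = τ b • T w := fun b w =>
    Subtype.ext (funext fun k => map_mul τ _ _)
  have hTT : ∀ w, T (T w) = w := T.left_inv
  let Xs : List (MvPowerSeries (Fin d) (MvPowerSeries (Fin d) V)) := (List.finRange d).map X
  have hus : (Xs.map τ).map τ = Xs := by
    rw [List.map_map]
    conv_rhs => rw [← List.map_id Xs]
    exact List.map_congr_left fun f _ => hττ' f
  refine ⟨constantCoeff.comp τ, Xs.map τ, (hatConst Z).comp T.toAddMonoidHom, hτ, ?_, ?_, ?_, ?_, ?_⟩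
  · intro u hu
    simp only [Xs, List.map_map, List.mem_map] at hu
    obtain ⟨i, -, rfl⟩ := hu
    rw [Function.comp_apply, hτX, mem_maximalIdeal, mem_nonunits_iff, isUnit_iff_constantCoeff,
      map_sub, constantCoeff_C, constantCoeff_X, sub_zero]
    exact X_mem_maximalIdeal i
  · exact (hatConst_surjective Z).comp T.surjective
  · intro b w
    change hatConst Z (T (b • w)) = _
    rw [hT, hatConst_smul]
    rfl
  · intro w
    change hatConst Z (T w) = 0 ↔ _
    rw [hatConst_eq_zero_iff Z (List.mem_finRange)]
    constructor
    · intro h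
      have := map_mem_ofList_smul_top τ T.toAddMonoidHom hT _ h
      rwa [show T.toAddMonoidHom (T w) = w from hTT w] at this
    · intro h
      have := map_mem_ofList_smul_top τ T.toAddMonoidHom hT _ h
      rwa [hus] at this
  · refine (T.isWeaklyRegular_congr ?_).1 (isWeaklyRegular_map_X_hat Z (List.nodup_finRange d))
    rw [List.forall₂_map_right_iff, List.forall₂_same]
    exact fun b _ w => hT b w

lemma mem_ofList_X_iff {ι S : Type*} [CommRing S] {l : List ι} (hl : ∀ i, i ∈ l)
    (f : MvPowerSeries ι S) : f ∈ Ideal.ofList (l.map X) ↔ constantCoeff f = 0 := by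
  constructor
  · intro h
    refine Submodule.span_induction ?_ (map_zero _) (fun x y _ _ hx hy => ?_) (fun a x _ hx => ?_) h
    · rintro x hx
      obtain ⟨i, -, rfl⟩ := List.mem_map.1 hx
      exact constantCoeff_X i
    · rw [map_add, hx, hy, add_zero]
    · rw [smul_eq_mul, map_mul, hx, mul_zero]
  · intro h
    have h1 : (⟨fun _ => f, fun _ => trivial⟩ : hat ι (⊤ : Submodule S (Unit → S))) ∈
        (Ideal.ofList (l.map (X : ι → MvPowerSeries ι S)) • ⊤ :
          Submodule (MvPowerSeries ι S) (hat ι (⊤ : Submodule S (Unit → S)))) := by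
      rw [← hatConst_eq_zero_iff _ hl]
      exact Subtype.ext (funext fun _ => h)
    have h2 : ∀ w ∈ (Ideal.ofList (l.map (X : ι → MvPowerSeries ι S)) • ⊤ :
        Submodule (MvPowerSeries ι S) (hat ι (⊤ : Submodule S (Unit → S)))),
        w.1 () ∈ Ideal.ofList (l.map (X : ι → MvPowerSeries ι S)) := fun w hw =>
      Submodule.smul_induction_on hw (fun b hb a _ => Ideal.mul_mem_right _ _ hb)
        fun x y hx hy => add_mem hx hy
    exact h2 _ h1

lemma ofList_X_map_mk {V : Type*} [CommRing V] [IsLocalRing V] {d : ℕ}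
    {g : MvPowerSeries (Fin d) V} (hg : Ideal.span {constantCoeff g} = maximalIdeal V)
    [IsLocalRing (MvPowerSeries (Fin d) V ⧸ Ideal.span {g})] :
    Ideal.ofList (((List.finRange d).map X).map (Ideal.Quotient.mk (Ideal.span {g}))) =
      maximalIdeal (MvPowerSeries (Fin d) V ⧸ Ideal.span {g}) := by
  rw [← Ideal.map_ofList]
  have hloc : IsLocalHom (Ideal.Quotient.mk (Ideal.span {g})) :=
    IsLocalHom.of_surjective _ Ideal.Quotient.mk_surjective
  apply le_antisymm
  · rw [Ideal.map_le_iff_le_comap]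
    intro f hf
    rw [mem_ofList_X_iff List.mem_finRange] at hf
    rw [Ideal.mem_comap, mem_maximalIdeal, mem_nonunits_iff, isUnit_map_iff,
      isUnit_iff_constantCoeff, hf]
    exact not_isUnit_zero
  · intro f hf
    obtain ⟨f, rfl⟩ := Ideal.Quotient.mk_surjective f
    rw [mem_maximalIdeal, mem_nonunits_iff, isUnit_map_iff, isUnit_iff_constantCoeff] at hf
    have : constantCoeff f ∈ maximalIdeal V := hf
    rw [← hg, Ideal.mem_span_singleton'] at this
    obtain ⟨v, hv⟩ := this
    have h1 : f - C v * g ∈ Ideal.ofList ((List.finRange d).map X) := by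
      rw [mem_ofList_X_iff List.mem_finRange, map_sub, map_mul, constantCoeff_C, hv, sub_self]
    have h2 := Ideal.mem_map_of_mem (Ideal.Quotient.mk (Ideal.span {g})) h1
    rwa [map_sub, map_mul, Ideal.Quotient.eq_zero_iff_mem.2 (Ideal.mem_span_singleton_self g),
      mul_zero, sub_zero] at h2

end Diagonal

end MvPowerSeries

section Presentation

open Pointwise

/-- From a presentation over `S/(g)`, the exact sequence `0 → D → Z/gZ → ker q → 0`, where `Z` is
the kernel of `S^a → D`. -/
lemma exists_exact_quotSMulTop_of_presentation {S : Type u} [CommRing S] {g : S}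
    (hg : IsSMulRegular S g) {κ : Type} {D : Type u} [AddCommGroup D] [Module (S ⧸ Ideal.span {g}) D]
    (q : (κ → S ⧸ Ideal.span {g}) →ₗ[S ⧸ Ideal.span {g}] D) (hq : Function.Surjective q) :
    ∃ (Z : Submodule S (κ → S)) (f : D →ₗ[S ⧸ Ideal.span {g}] QuotSMulTop g Z)
      (p : QuotSMulTop g Z →ₗ[S ⧸ Ideal.span {g}] LinearMap.ker q),
      Function.Injective f ∧ Function.Surjective p ∧ Function.Exact f p := by
  let r : (κ → S) → (κ → S ⧸ Ideal.span {g}) := fun v k => Ideal.Quotient.mk _ (v k)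
  have hr : Function.Surjective r := fun w =>
    ⟨fun k => (Ideal.Quotient.mk_surjective (w k)).choose,
      funext fun k => (Ideal.Quotient.mk_surjective (w k)).choose_spec⟩
  have hradd : ∀ v w, r (v + w) = r v + r w := fun v w => rfl
  have hrsmul : ∀ (s : S) w, r (s • w) = Ideal.Quotient.mk (Ideal.span {g}) s • r w := fun v w => rfl
  have hrg : ∀ v, r v = 0 ↔ ∃ w, v = g • w := by
    intro v
    constructor
    · intro h
      have : ∀ k, ∃ w, w * g = v k := fun k => Ideal.mem_span_singleton'.1
        (Ideal.Quotient.eq_zero_iff_mem.1 (congrFun h k))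
      choose w hw using this
      exact ⟨w, funext fun k => by simp [← hw k, mul_comm]⟩
    · rintro ⟨w, rfl⟩
      rw [hrsmul, Ideal.Quotient.eq_zero_iff_mem.2 (Ideal.mem_span_singleton_self g), zero_smul]
  let Z : Submodule S (κ → S) :=
    { carrier := {v | q (r v) = 0}
      zero_mem' := by
        change q (r 0) = 0
        rw [(hrg 0).2 ⟨0, by simp⟩, map_zero]
      add_mem' := fun {v w} (hv : q (r v) = 0) (hw : q (r w) = 0) => by
        change q (r (v + w)) = 0
        rw [hradd, map_add, hv, hw, add_zero]
      smul_mem' := fun s w (hw : q (r w) = 0) => by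
        change q (r (s • w)) = 0
        rw [hrsmul, map_smul, hw, smul_zero] }
  have hZ : ∀ v, v ∈ Z ↔ q (r v) = 0 := fun _ => Iff.rfl
  have hgZ : ∀ v, g • v ∈ Z := fun v => by rw [hZ, (hrg _).2 ⟨v, rfl⟩, map_zero]
  let c : (κ → S) → QuotSMulTop g Z := fun v => Submodule.Quotient.mk ⟨g • v, hgZ v⟩
  have hc : ∀ v, c v = 0 ↔ v ∈ Z := by
    intro v
    refine (Submodule.Quotient.mk_eq_zero _).trans ⟨fun h => ?_, fun h => ?_⟩
    · obtain ⟨z, -, hz⟩ := (Submodule.mem_smul_pointwise_iff_exists _ _ _).1 h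
      have : (z : κ → S) = v := funext fun k => hg (congrFun (congrArg Subtype.val hz) k)
      exact this ▸ z.2
    · exact Submodule.smul_mem_pointwise_smul (⟨v, h⟩ : Z) g ⊤ trivial
  have hcadd : ∀ v w, c (v + w) = c v + c w := by
    intro v w
    rw [← Submodule.Quotient.mk_add]
    exact congrArg Submodule.Quotient.mk (Subtype.ext (smul_add g v w))
  have hcsmul : ∀ (s : S) w, c (s • w) = Ideal.Quotient.mk (Ideal.span {g}) s • c w := by
    intro s w
    refine Eq.trans ?_ (Submodule.Quotient.mk_smul _ s _)
    exact congrArg Submodule.Quotient.mk (Subtype.ext (smul_comm g s w))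
  have hcongr : ∀ v w, q (r v) = q (r w) → c v = c w := by
    intro v w h
    have h1 : v - w ∈ Z := by
      have : r v = r (v - w) + r w := by rw [← hradd, sub_add_cancel]
      rw [hZ, ← add_eq_right (b := q (r w)), ← map_add, ← this, h]
    have h2 : c v = c (v - w) + c w := by rw [← hcadd, sub_add_cancel]
    rw [h2, (hc _).2 h1, zero_add]
  have hs : ∀ x : D, ∃ v, q (r v) = x := fun x => by
    obtain ⟨w, rfl⟩ := hq x
    obtain ⟨v, rfl⟩ := hr w
    exact ⟨v, rfl⟩
  choose s hs using hs
  let f : D →ₗ[S ⧸ Ideal.span {g}] QuotSMulTop g Z :=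
    { toFun := fun x => c (s x)
      map_add' := fun x y => by
        rw [← hcadd]
        exact hcongr _ _ (by rw [hs, hradd, map_add, hs, hs])
      map_smul' := fun a x => by
        obtain ⟨a, rfl⟩ := Ideal.Quotient.mk_surjective a
        rw [RingHom.id_apply, ← hcsmul]
        exact hcongr _ _ (by rw [hs, hrsmul, map_smul, hs]) }
  have hf : ∀ x, f x = c (s x) := fun _ => rfl
  let p0 : Z →+ LinearMap.ker q :=
    { toFun := fun v => ⟨r v.1, v.2⟩
      map_zero' := Subtype.ext ((hrg 0).2 ⟨0, by simp⟩)
      map_add' := fun v w => rfl }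
  have hp0 : ∀ v ∈ g • (⊤ : Submodule S Z), p0 v = 0 := by
    intro v hv
    obtain ⟨z, -, rfl⟩ := (Submodule.mem_smul_pointwise_iff_exists _ _ _).1 hv
    exact Subtype.ext ((hrg _).2 ⟨z, rfl⟩)
  let p : QuotSMulTop g Z →ₗ[S ⧸ Ideal.span {g}] LinearMap.ker q :=
    { QuotientAddGroup.lift (g • (⊤ : Submodule S Z)).toAddSubgroup p0 hp0 with
      map_smul' := fun a x => by
        obtain ⟨a, rfl⟩ := Ideal.Quotient.mk_surjective a
        obtain ⟨x, rfl⟩ := Submodule.Quotient.mk_surjective _ x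
        rfl }
  have hp : ∀ z, p (Submodule.Quotient.mk z) = ⟨r z.1, z.2⟩ := fun _ => rfl
  refine ⟨Z, f, p, ?_, ?_, ?_⟩
  · rw [injective_iff_map_eq_zero]
    intro x hx
    rw [hf, hc, hZ, hs] at hx
    exact hx
  · rintro ⟨w, hw⟩
    obtain ⟨v, rfl⟩ := hr w
    exact ⟨Submodule.Quotient.mk ⟨v, hw⟩, rfl⟩
  · intro z
    obtain ⟨⟨z, hz⟩, rfl⟩ := Submodule.Quotient.mk_surjective _ z
    refine Iff.trans (Subtype.ext_iff.trans (hrg z)) ?_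
    constructor
    · rintro ⟨w, rfl⟩
      exact ⟨q (r w), (hcongr _ _ (hs _)).trans rfl⟩
    · rintro ⟨x, hx⟩
      rw [hf, ← sub_eq_zero, ← Submodule.Quotient.mk_sub, Submodule.Quotient.mk_eq_zero] at hx
      obtain ⟨y, -, hy⟩ := (Submodule.mem_smul_pointwise_iff_exists _ _ _).1 hx
      refine ⟨s x - y.1, ?_⟩
      have := congrArg Subtype.val hy
      rw [smul_sub]
      exact (sub_eq_iff_eq_add.2 (sub_eq_iff_eq_add'.1 this.symm)).symm

end Presentation

namespace FreeCx

open RingTheory.Sequence Pointwise MvPowerSeries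

/-- Tor rigidity over `V⟦X₁, …, X_d⟧/(g)`, where the constant coefficient of `g` is a nonzero
generator of the maximal ideal of the local domain `V`. -/
theorem subsingleton_T_of_hypersurface {V : Type u} [CommRing V] [IsDomain V] [IsLocalRing V]
    [IsNoetherianRing V] {d : ℕ} {g : MvPowerSeries (Fin d) V} (hg0 : constantCoeff g ≠ 0)
    (hg : Ideal.span {constantCoeff g} = maximalIdeal V)
    {D : Type u} [AddCommGroup D] [Module (MvPowerSeries (Fin d) V ⧸ Ideal.span {g}) D]
    [Module.Finite (MvPowerSeries (Fin d) V ⧸ Ideal.span {g}) D]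
    (G : FreeCx (MvPowerSeries (Fin d) V ⧸ Ideal.span {g})) (h0 : G.rk 0 = 0) {K : ℕ}
    (hK : ∀ i, K ≤ i → G.rk (i + 1) = 0)
    (hTR : ∀ i, Subsingleton (G.T (MvPowerSeries (Fin d) V ⧸ Ideal.span {g}) (i + 1)))
    (hT1 : Subsingleton (G.T D 1)) (i : ℕ) : Subsingleton (G.T D (i + 1)) := by
  have hgV : constantCoeff g ∈ maximalIdeal V := hg ▸ Ideal.mem_span_singleton_self _
  have hgS : g ∈ maximalIdeal (MvPowerSeries (Fin d) V) := by
    rw [mem_maximalIdeal, mem_nonunits_iff, isUnit_iff_constantCoeff]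
    exact hgV
  obtain ⟨h, hh⟩ : ∃ h : MvPowerSeries (Fin d) (MvPowerSeries (Fin d) V),
    h = MvPowerSeries.map (C : V →+* MvPowerSeries (Fin d) V) g := ⟨_, rfl⟩
  have hh0 : constantCoeff h = C (constantCoeff g) := by
    rw [hh, ← coeff_zero_eq_constantCoeff_apply, coeff_map, coeff_zero_eq_constantCoeff_apply]
  have hhB : h ∈ maximalIdeal (MvPowerSeries (Fin d) (MvPowerSeries (Fin d) V)) := by
    rw [mem_maximalIdeal, mem_nonunits_iff, isUnit_iff_constantCoeff, hh0,
      isUnit_iff_constantCoeff, constantCoeff_C]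
    exact hgV
  have hg' : g ≠ 0 := fun e => hg0 (by rw [e, map_zero])
  obtain ⟨a, q, hq⟩ :=
    Module.Finite.exists_fin' (MvPowerSeries (Fin d) V ⧸ Ideal.span {g}) D
  obtain ⟨Z, f, p, hf, hp, hfp⟩ := exists_exact_quotSMulTop_of_presentation
    (IsSMulRegular.of_ne_zero hg') q hq
  obtain ⟨ε, us, E, hε, hus, hE, hEsmul, hEker, hEreg⟩ := exists_diagonal_hat d Z
  have hZreg : ∀ {s : MvPowerSeries (Fin d) V}, s ≠ 0 → IsSMulRegular Z s := fun hs =>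
    IsSMulRegular.of_ne_zero hs
  have hεh : ε h = g := hh ▸ hε g
  have hCg : (C (constantCoeff g) : MvPowerSeries (Fin d) V) ≠ 0 := fun e =>
    hg0 (by rw [← constantCoeff_C (σ := Fin d) (constantCoeff g), e, map_zero])
  have hu := isWeaklyRegular_quotSMulTop_of_ker hEreg E hEker (h := h) (c := g)
    (fun w => by rw [hEsmul, hεh]) (hZreg hg') hus hhB
  have hx := isWeaklyRegular_quotSMulTop_of_ker
    (isWeaklyRegular_map_X_hat Z (List.nodup_finRange d)) (hatConst Z)
    (hatConst_eq_zero_iff Z List.mem_finRange) (h := h) (c := C (constantCoeff g))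
    (fun w => by rw [hatConst_smul, hh0]) (hZreg hCg)
    (by
      intro u hu
      obtain ⟨i, -, rfl⟩ := List.mem_map.1 hu
      exact X_mem_maximalIdeal i) hhB
  have hE' := exists_quotSMulTop_of_ker ε E hEsmul hE hEker h
  rw [hεh] at hE'
  obtain ⟨E', hE', hE'smul, hE'ker⟩ := hE'
  have hmap : Ideal.span {g} ≤ (Ideal.span {h}).comap
      (MvPowerSeries.map (C : V →+* MvPowerSeries (Fin d) V)) := by
    rw [Ideal.span_singleton_le_iff_mem, Ideal.mem_comap, ← hh]
    exact Ideal.mem_span_singleton_self h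
  have hmap' : Ideal.span {h} ≤ (Ideal.span {g}).comap ε := by
    rw [Ideal.span_singleton_le_iff_mem, Ideal.mem_comap, hεh]
    exact Ideal.mem_span_singleton_self g
  let _ : Algebra (MvPowerSeries (Fin d) V ⧸ Ideal.span {g})
      (MvPowerSeries (Fin d) (MvPowerSeries (Fin d) V) ⧸ Ideal.span {h}) :=
    (Ideal.quotientMap _ _ hmap).toAlgebra
  let _ : Algebra (MvPowerSeries (Fin d) (MvPowerSeries (Fin d) V) ⧸ Ideal.span {h})
      (MvPowerSeries (Fin d) V ⧸ Ideal.span {g}) :=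
    (Ideal.quotientMap _ _ hmap').toAlgebra
  have hρ : ∀ f, algebraMap (MvPowerSeries (Fin d) V ⧸ Ideal.span {g})
      (MvPowerSeries (Fin d) (MvPowerSeries (Fin d) V) ⧸ Ideal.span {h})
      (Ideal.Quotient.mk _ f) = Ideal.Quotient.mk _ (MvPowerSeries.map C f) := fun _ => rfl
  have hev : ∀ f, algebraMap (MvPowerSeries (Fin d) (MvPowerSeries (Fin d) V) ⧸ Ideal.span {h})
      (MvPowerSeries (Fin d) V ⧸ Ideal.span {g})
      (Ideal.Quotient.mk _ f) = Ideal.Quotient.mk _ (ε f) := fun _ => rfl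
  have : Nontrivial (MvPowerSeries (Fin d) V ⧸ Ideal.span {g}) :=
    Ideal.Quotient.nontrivial_iff.2 fun e => (Ideal.eq_top_iff_one _).1
      (top_le_iff.1 (e ▸ (Ideal.span_singleton_le_iff_mem _).2 hgS)) |> 
      (Ideal.ne_top_iff_one _).1 (maximalIdeal.isMaximal _).ne_top
  have : Nontrivial (MvPowerSeries (Fin d) (MvPowerSeries (Fin d) V) ⧸ Ideal.span {h}) :=
    Ideal.Quotient.nontrivial_iff.2 fun e => (Ideal.eq_top_iff_one _).1
      (top_le_iff.1 (e ▸ (Ideal.span_singleton_le_iff_mem _).2 hhB)) |> 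
      (Ideal.ne_top_iff_one _).1 (maximalIdeal.isMaximal _).ne_top
  have : IsLocalRing (MvPowerSeries (Fin d) V ⧸ Ideal.span {g}) :=
    .of_surjective' (Ideal.Quotient.mk _) Ideal.Quotient.mk_surjective
  have : IsLocalRing (MvPowerSeries (Fin d) (MvPowerSeries (Fin d) V) ⧸ Ideal.span {h}) :=
    .of_surjective' (Ideal.Quotient.mk _) Ideal.Quotient.mk_surjective
  have : IsLocalHom (Ideal.Quotient.mk (Ideal.span {g})) :=
    IsLocalHom.of_surjective _ Ideal.Quotient.mk_surjective
  have : IsLocalHom (Ideal.Quotient.mk (Ideal.span {h})) :=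
    IsLocalHom.of_surjective _ Ideal.Quotient.mk_surjective
  have : Module.Finite (MvPowerSeries (Fin d) (MvPowerSeries (Fin d) V) ⧸ Ideal.span {h})
      (QuotSMulTop h (hat (Fin d) Z)) :=
    Module.Finite.of_restrictScalars_finite (MvPowerSeries (Fin d) (MvPowerSeries (Fin d) V)) _ _
  refine subsingleton_T_of_retract
    (B := MvPowerSeries (Fin d) (MvPowerSeries (Fin d) V) ⧸ Ideal.span {h})
    (F := Fin a → MvPowerSeries (Fin d) V ⧸ Ideal.span {g}) (fun r => ?_) (fun r hr => ?_)
    _ (ofList_X_map_mk hg) _ ?_ hu E' hE' (fun b w => ?_) hE'ker f p hf hp hfp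
    (LinearMap.ker q).subtype q (Submodule.subtype_injective _) hq
    (LinearMap.exact_subtype_ker_map q) G h0 hK hTR (fun i => G.subsingleton_T_pi (hTR i)) hT1 i
  · obtain ⟨r, rfl⟩ := Ideal.Quotient.mk_surjective r
    rw [hρ, hev, hε]
  · obtain ⟨r, rfl⟩ := Ideal.Quotient.mk_surjective r
    rw [mem_maximalIdeal, mem_nonunits_iff, isUnit_map_iff, isUnit_iff_constantCoeff] at hr
    rw [hρ, mem_maximalIdeal, mem_nonunits_iff, isUnit_map_iff, isUnit_iff_constantCoeff,
      ← coeff_zero_eq_constantCoeff_apply, coeff_map, coeff_zero_eq_constantCoeff_apply,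
      isUnit_iff_constantCoeff, constantCoeff_C]
    exact hr
  · rw [List.map_map, List.map_map] at *
    convert hx using 2
    funext i
    simp only [Function.comp_apply]
    rw [hρ, map_X]
  · obtain ⟨b, rfl⟩ := Ideal.Quotient.mk_surjective b
    rw [hev]
    exact hE'smul b w

end FreeCx

section

open scoped Pointwise

theorem Ideal.ringKrullDim_le_length_of_ofList_eq {R : Type u} [CommRing R] [IsLocalRing R]
    [IsNoetherianRing R] {l : List R} (h : Ideal.ofList l = maximalIdeal R) :
    ringKrullDim R ≤ l.length := by
  classical
  refine (ringKrullDim_le_spanFinrank_maximalIdeal R).trans ?_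
  have h1 : (maximalIdeal R).spanFinrank ≤ l.length := by
    rw [← h, Ideal.ofList]
    refine (Submodule.spanFinrank_span_le_ncard_of_finite l.finite_toSet).trans ?_
    have : {r | r ∈ l} = (l.toFinset : Set R) := by ext; simp
    rw [this, Set.ncard_coe_finset]
    exact l.toFinset_card_le
  exact_mod_cast h1

theorem WithBot.ENat.le_of_add_one_le_add_one {a : WithBot ℕ∞} {n : ℕ}
    (h : ((n + 1 : ℕ) : WithBot ℕ∞) ≤ a + 1) : (n : WithBot ℕ∞) ≤ a := by
  induction a using WithBot.recBotCoe with
  | bot => simp at h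
  | coe a =>
    induction a using ENat.recTopCoe with
    | top => exact le_top
    | coe a => norm_cast at h ⊢; omega

theorem Ideal.Quotient.ofList_map_mk_eq_maximalIdeal {R : Type u} [CommRing R] [IsLocalRing R]
    (I : Ideal R) [IsLocalRing (R ⧸ I)] {l : List R} (h : Ideal.ofList l = maximalIdeal R) :
    Ideal.ofList (l.map (Ideal.Quotient.mk I)) = maximalIdeal (R ⧸ I) := by
  rw [← Ideal.map_ofList, h]
  exact map_maximalIdeal_of_surjective _ Ideal.Quotient.mk_surjective

theorem QuotSMulTop.isWeaklyRegular_self_iff {R : Type u} [CommRing R] (x : R)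
    (l : List (R ⧸ Ideal.span {x})) :
    RingTheory.Sequence.IsWeaklyRegular (QuotSMulTop x R) l ↔
      RingTheory.Sequence.IsWeaklyRegular (R ⧸ Ideal.span {x}) l := by
  have h : x • (⊤ : Submodule R R) = Ideal.span {x} := by
    ext y
    rw [Submodule.mem_smul_pointwise_iff_exists, Ideal.mem_span_singleton']
    simp [mul_comm]
  let e := Submodule.quotEquivOfEq _ _ h
  refine LinearEquiv.isWeaklyRegular_congr (R := R ⧸ Ideal.span {x})
    { e with map_smul' := fun r m => ?_ } l
  obtain ⟨r, rfl⟩ := Ideal.Quotient.mk_surjective r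
  exact e.map_smul r m

theorem IsLocalRing.of_quotient_of_le {R : Type u} [CommRing R] [IsLocalRing R]
    {I : Ideal R} (h : I ≤ maximalIdeal R) : IsLocalRing (R ⧸ I) := by
  have : Nontrivial (R ⧸ I) := Ideal.Quotient.nontrivial_iff.mpr
    fun e => (maximalIdeal.isMaximal R).ne_top (top_le_iff.mp (e ▸ h))
  exact IsLocalRing.of_surjective' _ Ideal.Quotient.mk_surjective

theorem IsLocalRing.le_ringKrullDim_quotient_span_singleton {R : Type u} [CommRing R]
    [IsLocalRing R] [IsNoetherianRing R] {x : R} (hx : x ∈ maximalIdeal R) {n : ℕ}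
    (h : ((n + 1 : ℕ) : WithBot ℕ∞) ≤ ringKrullDim R) :
    (n : WithBot ℕ∞) ≤ ringKrullDim (R ⧸ Ideal.span {x}) := by
  have := ringKrullDim_le_ringKrullDim_quotSMulTop_succ hx
  have h' : x • (⊤ : Ideal R) = Ideal.span {x} := by
    ext y
    rw [Submodule.mem_smul_pointwise_iff_exists, Ideal.mem_span_singleton']
    simp [mul_comm]
  rw [h'] at this
  exact WithBot.ENat.le_of_add_one_le_add_one (h.trans this)

theorem Ideal.exists_isPrime_le_ringKrullDim_quotient {R : Type u} [CommRing R] {n : ℕ}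
    (h : (n : WithBot ℕ∞) ≤ ringKrullDim R) :
    ∃ Q : Ideal R, Q.IsPrime ∧ (n : WithBot ℕ∞) ≤ ringKrullDim (R ⧸ Q) := by
  obtain ⟨l, hl⟩ := Order.le_krullDim_iff.mp h
  refine ⟨l.head.asIdeal, l.head.isPrime, ?_⟩
  rw [ringKrullDim_quotient]
  refine Order.le_krullDim_iff.mpr ⟨⟨l.length, fun i => ⟨l i, ?_⟩, fun i => l.step i⟩, hl⟩
  exact (l.head_le i : l.head.asIdeal ≤ (l i).asIdeal)

theorem IsLocalRing.isDomain_and_isWeaklyRegular_of_length_le (n : ℕ) :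
    ∀ (R : Type u) [CommRing R] [IsLocalRing R] [IsNoetherianRing R] (l : List R),
      l.length = n → Ideal.ofList l = maximalIdeal R → (n : WithBot ℕ∞) ≤ ringKrullDim R →
      IsDomain R ∧ RingTheory.Sequence.IsWeaklyRegular R l := by
  induction n with
  | zero =>
    intro R _ _ _ l hl h _
    obtain rfl := List.length_eq_zero_iff.mp hl
    rw [Ideal.ofList_nil] at h
    have : (⊥ : Ideal R).IsPrime := h ▸ (maximalIdeal.isMaximal R).isPrime
    exact ⟨IsDomain.of_bot_isPrime R, RingTheory.Sequence.IsWeaklyRegular.nil R R⟩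
  | succ n ih =>
    intro R _ _ _ l hl h hd
    obtain ⟨x, l, rfl⟩ : ∃ x l', l = x :: l' := by
      cases l with
      | nil => simp at hl
      | cons x l => exact ⟨x, l, rfl⟩
    have hl' : l.length = n := by simpa using hl
    have hx : x ∈ maximalIdeal R := h ▸ Ideal.subset_span (by simp)
    have hloc : IsLocalRing (R ⧸ Ideal.span {x}) :=
      IsLocalRing.of_quotient_of_le ((Ideal.span_singleton_le_iff_mem _).mpr hx)
    have hgen : ∀ I : Ideal R, x ∈ I → ∀ [IsLocalRing (R ⧸ I)],
        Ideal.ofList (l.map (Ideal.Quotient.mk I)) = maximalIdeal (R ⧸ I) := by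
      intro I hI _
      rw [← Ideal.Quotient.ofList_map_mk_eq_maximalIdeal I h, List.map_cons, Ideal.ofList_cons,
        Ideal.Quotient.eq_zero_iff_mem.mpr hI]
      simp
    have hgS := hgen _ (Ideal.mem_span_singleton_self x)
    obtain ⟨hdom, hwr⟩ := ih (R ⧸ Ideal.span {x}) _ (by simpa using hl') hgS
      (IsLocalRing.le_ringKrullDim_quotient_span_singleton hx hd)
    have hdS : ringKrullDim (R ⧸ Ideal.span {x}) ≤ n := by
      simpa [hl'] using Ideal.ringKrullDim_le_length_of_ofList_eq hgS
    obtain ⟨Q, hQ, hQd⟩ := Ideal.exists_isPrime_le_ringKrullDim_quotient hd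
    have hQloc : IsLocalRing (R ⧸ Q) :=
      IsLocalRing.of_quotient_of_le (IsLocalRing.le_maximalIdeal hQ.ne_top)
    have hlt : ¬ (((n + 1 : ℕ) : WithBot ℕ∞) ≤ n) := by
      intro h; norm_cast at h; omega
    have hxQ : x ∉ Q := by
      intro hxQ
      have := Ideal.ringKrullDim_le_length_of_ofList_eq (hgen Q hxQ)
      rw [List.length_map, hl'] at this
      exact hlt (hQd.trans this)
    have hQx : Q ≤ Ideal.span {x} := by
      intro q hq
      by_contra hqx
      let f : R ⧸ Ideal.span {x} →+* (R ⧸ Q) ⧸ Ideal.span {Ideal.Quotient.mk Q x} :=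
        Ideal.Quotient.lift _ ((Ideal.Quotient.mk _).comp (Ideal.Quotient.mk Q)) (by
          intro a ha
          obtain ⟨b, rfl⟩ := Ideal.mem_span_singleton'.mp ha
          rw [RingHom.comp_apply, Ideal.Quotient.eq_zero_iff_mem, map_mul]
          exact Ideal.mul_mem_left _ _ (Ideal.mem_span_singleton_self _))
      have hf : Function.Surjective f := Ideal.Quotient.lift_surjective_of_surjective _ _
        (Ideal.Quotient.mk_surjective.comp Ideal.Quotient.mk_surjective)
      have h1 := ringKrullDim_succ_le_of_surjective f hf (r := Ideal.Quotient.mk _ q)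
        (mem_nonZeroDivisors_of_ne_zero fun e => hqx (Ideal.Quotient.eq_zero_iff_mem.mp e)) (by
          have : Ideal.Quotient.mk Q q = 0 := Ideal.Quotient.eq_zero_iff_mem.mpr hq
          simp [f, this])
      have hx' : Ideal.Quotient.mk Q x ∈ maximalIdeal (R ⧸ Q) := by
        rw [← map_maximalIdeal_of_surjective _ Ideal.Quotient.mk_surjective]
        exact Ideal.mem_map_of_mem _ hx
      have h2 := IsLocalRing.le_ringKrullDim_quotient_span_singleton hx' hQd
      refine hlt (le_trans ?_ (h1.trans hdS))
      push_cast
      gcongr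
    have hQ0 : Q = ⊥ := by
      refine Submodule.eq_bot_of_le_smul_of_le_jacobson_bot (maximalIdeal R) Q
        (IsNoetherian.noetherian Q) ?_ (IsLocalRing.maximalIdeal_le_jacobson ⊥)
      intro q hq
      obtain ⟨b, rfl⟩ := Ideal.mem_span_singleton'.mp (hQx hq)
      have : b ∈ Q := (hQ.mem_or_mem hq).resolve_right hxQ
      rw [mul_comm, ← smul_eq_mul]
      exact Submodule.smul_mem_smul hx this
    subst hQ0
    have := IsDomain.of_bot_isPrime R
    refine ⟨this, (RingTheory.Sequence.isWeaklyRegular_cons_iff' R x l).mpr ⟨?_, ?_⟩⟩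
    · exact IsSMulRegular.of_ne_zero fun e => hxQ e
    · exact (QuotSMulTop.isWeaklyRegular_self_iff x _).mpr hwr

end

open scoped Pointwise in
theorem RingTheory.Sequence.IsWeaklyRegular.append_of_exact {R : Type u} [CommRing R] {x : R}
    (l : List R) : ∀ {K F L : Type u} [AddCommGroup K] [Module R K] [AddCommGroup F] [Module R F]
    [AddCommGroup L] [Module R L] {f : K →ₗ[R] F} {g : F →ₗ[R] L},
    Function.Injective f → Function.Exact f g → Function.Surjective g →
    RingTheory.Sequence.IsWeaklyRegular L l → RingTheory.Sequence.IsWeaklyRegular F (l ++ [x]) →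
    RingTheory.Sequence.IsWeaklyRegular K (l ++ [x]) := by
  induction l with
  | nil =>
    intro K F L _ _ _ _ _ _ f g hf _ _ _ hF
    rw [List.nil_append, RingTheory.Sequence.isWeaklyRegular_cons_iff] at hF ⊢
    exact ⟨fun a b h => hf (hF.1 (by simpa using congrArg f h)),
      RingTheory.Sequence.IsWeaklyRegular.nil _ _⟩
  | cons y l ih =>
    intro K F L _ _ _ _ _ _ f g hf hfg hg hL hF
    rw [List.cons_append, RingTheory.Sequence.isWeaklyRegular_cons_iff] at hF ⊢
    rw [RingTheory.Sequence.isWeaklyRegular_cons_iff] at hL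
    refine ⟨fun a b h => hf (hF.1 (by simpa using congrArg f h)), ?_⟩
    refine ih (f := QuotSMulTop.map y f) (g := QuotSMulTop.map y g) ?_
      (QuotSMulTop.map_exact y hfg hg) (QuotSMulTop.map_surjective y hg) hL.2 hF.2
    rw [injective_iff_map_eq_zero]
    intro a ha
    obtain ⟨a, rfl⟩ := Submodule.Quotient.mk_surjective _ a
    change Submodule.Quotient.mk (f a) = 0 at ha
    rw [Submodule.Quotient.mk_eq_zero, Submodule.mem_smul_pointwise_iff_exists] at ha
    obtain ⟨b, -, hb⟩ := ha
    have hgb : g b = 0 := hL.1 (by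
      simp only [smul_zero]
      rw [← map_smul, hb, hfg.apply_apply_eq_zero])
    obtain ⟨c, rfl⟩ := (hfg b).mp hgb
    rw [← map_smul] at hb
    rw [Submodule.Quotient.mk_eq_zero, ← hf hb]
    exact Submodule.smul_mem_pointwise_smul _ _ _ trivial

theorem RingTheory.Sequence.IsWeaklyRegular.free_of_ofList_eq (n : ℕ) :
    ∀ (R : Type u) [CommRing R] [IsLocalRing R] [IsNoetherianRing R] (M : Type u) [AddCommGroup M]
      [Module R M] [Module.Finite R M] (l : List R), l.length = n →
      Ideal.ofList l = maximalIdeal R → RingTheory.Sequence.IsWeaklyRegular M l →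
      Module.Free R M := by
  induction n with
  | zero =>
    intro R _ _ _ M _ _ _ l hl h _
    obtain rfl := List.length_eq_zero_iff.mp hl
    rw [Ideal.ofList_nil] at h
    let _ := (IsLocalRing.isField_iff_maximalIdeal_eq.mpr h.symm).toField
    exact Module.Free.of_divisionRing R M
  | succ n ih =>
    intro R _ _ _ M _ _ _ l hl h hM
    obtain ⟨x, l, rfl⟩ : ∃ x l', l = x :: l' := by
      cases l with
      | nil => simp at hl
      | cons x l => exact ⟨x, l, rfl⟩
    have hl' : l.length = n := by simpa using hl
    have hx : x ∈ maximalIdeal R := h ▸ Ideal.subset_span (by simp)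
    have hloc : IsLocalRing (R ⧸ Ideal.span {x}) :=
      IsLocalRing.of_quotient_of_le ((Ideal.span_singleton_le_iff_mem _).mpr hx)
    have hgS : Ideal.ofList (l.map (Ideal.Quotient.mk (Ideal.span {x}))) =
        maximalIdeal (R ⧸ Ideal.span {x}) := by
      rw [← Ideal.Quotient.ofList_map_mk_eq_maximalIdeal _ h, List.map_cons, Ideal.ofList_cons,
        Ideal.Quotient.eq_zero_iff_mem.mpr (Ideal.mem_span_singleton_self x)]
      simp
    rw [RingTheory.Sequence.isWeaklyRegular_cons_iff'] at hM
    have hfp : Module.FinitePresentation R M := Module.finitePresentation_of_finite R M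
    have hfin : Module.Finite (R ⧸ Ideal.span {x}) (QuotSMulTop x M) :=
      Module.Finite.of_restrictScalars_finite R _ _
    exact (Module.free_quotSMulTop_iff_free R M (IsLocalRing.maximalIdeal_le_jacobson ⊥ hx)
      hM.1).mp (ih _ _ _ (by simpa using hl') hgS hM.2)

theorem Module.Finite.exists_fin_surjective_of_free (R : Type u) [CommRing R] [Nontrivial R]
    (M : Type u) [AddCommGroup M] [Module R M] [Module.Finite R M] :
    ∃ (b : ℕ) (π : (Fin b → R) →ₗ[R] M), Function.Surjective π ∧
      (Module.Free R M → Function.Injective π) := by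
  by_cases h : Module.Free R M
  · let e := (Module.finBasis R M).equivFun.symm
    exact ⟨_, e.toLinearMap, e.surjective, fun _ => e.injective⟩
  · obtain ⟨b, π, hπ⟩ := Module.Finite.exists_fin' R M
    exact ⟨b, π, hπ, fun h' => absurd h' h⟩

theorem FreeCx.d_eq_toLin' {P : Type*} [CommRing P] (G : FreeCx P) (i : ℕ)
    (v : Fin (G.rk (i + 1)) → P) : G.d P i v = (G.mat i).toLin' v := by
  ext j
  rw [FreeCx.d_apply, Matrix.toLin'_apply]
  rfl

/-- Modules over a regular local ring have finite free resolutions. -/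
theorem FreeCx.exists_resolution {R : Type u} [CommRing R] [IsLocalRing R] [IsNoetherianRing R]
    {l : List R} (hl : Ideal.ofList l = maximalIdeal R)
    (hreg : RingTheory.Sequence.IsWeaklyRegular R l)
    (N : Type u) [AddCommGroup N] [Module R N] [Module.Finite R N] :
    ∃ (G : FreeCx R) (π : (Fin (G.rk 1) → R) →ₗ[R] N), G.rk 0 = 0 ∧
      (∃ K, ∀ i, K ≤ i → G.rk (i + 1) = 0) ∧ (∀ i, Subsingleton (G.T R (i + 1))) ∧
      Function.Surjective π ∧ LinearMap.ker π = LinearMap.range (G.d R 1) := by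
  have step : ∀ s : (Σ b : ℕ, Submodule R (Fin b → R)), ∃ (s' : Σ b : ℕ, Submodule R (Fin b → R))
      (φ : (Fin s'.1 → R) →ₗ[R] (Fin s.1 → R)), LinearMap.range φ = s.2 ∧
        LinearMap.ker φ = s'.2 ∧ (Module.Free R s.2 → s'.2 = ⊥) := by
    rintro ⟨b, L⟩
    obtain ⟨b', π, hπ, hπ'⟩ := Module.Finite.exists_fin_surjective_of_free R L
    refine ⟨⟨b', LinearMap.ker π⟩, L.subtype ∘ₗ π, ?_, ?_, fun h => ?_⟩
    · rw [LinearMap.range_comp, LinearMap.range_eq_top.mpr hπ, Submodule.map_top,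
        Submodule.range_subtype]
    · rw [LinearMap.ker_comp, Submodule.ker_subtype, Submodule.comap_bot]
    · exact LinearMap.ker_eq_bot.mpr (hπ' h)
  choose next φ hr hk hfree using step
  obtain ⟨b₀, π, hπ, -⟩ := Module.Finite.exists_fin_surjective_of_free R N
  let seq : ℕ → (Σ b : ℕ, Submodule R (Fin b → R)) :=
    fun i => Nat.rec ⟨b₀, LinearMap.ker π⟩ (fun _ s => next s) i
  let ψ : ∀ i, (Fin (seq (i + 1)).1 → R) →ₗ[R] (Fin (seq i).1 → R) := fun i => φ (seq i)
  have hψr : ∀ i, LinearMap.range (ψ i) = (seq i).2 := fun i => hr (seq i)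
  have hψk : ∀ i, LinearMap.ker (ψ i) = (seq (i + 1)).2 := fun i => hk (seq i)
  have hψf : ∀ i, Module.Free R (seq i).2 → (seq (i + 1)).2 = ⊥ := fun i => hfree (seq i)
  have hF : ∀ k, RingTheory.Sequence.IsWeaklyRegular (Fin k → R) l := fun k =>
    ((TensorProduct.rid R (Fin k → R)).isWeaklyRegular_congr l).mp hreg.isWeaklyRegular_lTensor
  have hwr : ∀ i, i ≤ l.length → RingTheory.Sequence.IsWeaklyRegular (seq i).2 (l.take i) := by
    intro i
    induction i with
    | zero => intro _; rw [List.take_zero]; exact RingTheory.Sequence.IsWeaklyRegular.nil _ _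
    | succ i ih =>
      intro hi
      have hF' : RingTheory.Sequence.IsWeaklyRegular (Fin (seq (i + 1)).1 → R)
          (l.take i ++ [l[i]]) := by
        rw [List.take_append_getElem]
        have := hF (seq (i + 1)).1
        rw [← List.take_append_drop (i + 1) l,
          RingTheory.Sequence.isWeaklyRegular_append_iff] at this
        exact this.1
      have := RingTheory.Sequence.IsWeaklyRegular.append_of_exact (x := l[i]) (l.take i)
        (f := (seq (i + 1)).2.subtype) (g := ((ψ i).codRestrict (seq i).2 fun c => by
          rw [← hψr i]; exact LinearMap.mem_range_self _ c)) (Submodule.subtype_injective _)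
        (by
          rw [LinearMap.exact_iff, LinearMap.ker_codRestrict, hψk, Submodule.range_subtype])
        (by
          rw [← LinearMap.range_eq_top, LinearMap.range_codRestrict, hψr]
          exact Submodule.comap_subtype_self _) (ih (by omega)) hF'
      rwa [List.take_append_getElem] at this
  have hbot : ∀ i, l.length < i → (seq i).2 = ⊥ := by
    intro i hi
    induction i, hi using Nat.le_induction with
    | base =>
      refine hψf _ (RingTheory.Sequence.IsWeaklyRegular.free_of_ofList_eq l.length R _ l rfl hl ?_)
      have := hwr l.length le_rfl
      rwa [List.take_length] at this
    | succ i hi ih =>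
      refine hψf _ ?_
      rw [ih]
      infer_instance
  have hzero : ∀ i, l.length + 2 ≤ i → (seq i).1 = 0 := by
    intro i hi
    obtain ⟨i, rfl⟩ : ∃ j, i = j + 1 := ⟨i - 1, by omega⟩
    by_contra hne
    have h1 : LinearMap.ker (ψ i) = ⊥ := (hψk i).trans (hbot (i + 1) (by omega))
    have h2 : LinearMap.range (ψ i) = ⊥ := (hψr i).trans (hbot i (by omega))
    have : NeZero (seq (i + 1)).1 := ⟨hne⟩
    have h3 : ψ i 1 = 0 := by
      rw [LinearMap.range_eq_bot] at h2
      rw [h2]; rfl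
    have := congrFun (LinearMap.ker_eq_bot'.mp h1 1 h3) 0
    simp at this
  let rk : ℕ → ℕ := fun i => Nat.rec 0 (fun j _ => (seq j).1) i
  let mat : ∀ i, Matrix (Fin (rk i)) (Fin (rk (i + 1))) R := fun i =>
    Nat.rec 0 (fun j _ => LinearMap.toMatrix' (ψ j)) i
  have hmm : ∀ i, mat i * mat (i + 1) = 0 := by
    intro i
    cases i with
    | zero => exact Matrix.zero_mul _
    | succ i =>
      change LinearMap.toMatrix' (ψ i) * LinearMap.toMatrix' (ψ (i + 1)) = 0
      rw [← LinearMap.toMatrix'_comp, show ψ i ∘ₗ ψ (i + 1) = 0 from ?_, map_zero]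
      exact LinearMap.range_le_ker_iff.mp ((hψr (i + 1)).trans (hψk i).symm).le
  let G : FreeCx R := ⟨rk, mat, hmm⟩
  have hd : ∀ i, G.d R (i + 1) = ψ i := by
    intro i
    refine LinearMap.ext fun v => (G.d_eq_toLin' (i + 1) v).trans ?_
    change Matrix.toLin' (LinearMap.toMatrix' (ψ i)) v = _
    rw [Matrix.toLin'_toMatrix']
  refine ⟨G, π, rfl, ⟨l.length + 2, hzero⟩, fun i => ?_, hπ, ?_⟩
  · rw [FreeCx.subsingleton_T_iff]
    intro v hv
    rw [hd] at hv
    have : v ∈ LinearMap.range (ψ (i + 1)) := ((hψk i).trans (hψr (i + 1)).symm).le hv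
    rw [hd]
    exact this
  · rw [hd, hψr]
    rfl

/-- Exponents supported in `B` and bounded by `p`. -/
def reducedExponents {ι : Type*} (p : ℕ) (B : Set ι) : Set (ι →₀ ℕ) :=
  {s | ↑s.support ⊆ B ∧ ∀ i, s i < p}

/-- The monomial in the family `b` with the given exponents. -/
def monomialProd {ι A : Type*} [CommRing A] (b : ι → A) (s : ι →₀ ℕ) : A :=
  s.prod fun i e => b i ^ e

theorem monomialProd_zero {ι A : Type*} [CommRing A] (b : ι → A) : monomialProd b 0 = 1 :=
  Finsupp.prod_zero_index

theorem monomialProd_add {ι A : Type*} [CommRing A] (b : ι → A) (s t : ι →₀ ℕ) :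
    monomialProd b (s + t) = monomialProd b s * monomialProd b t := by
  classical
  exact Finsupp.prod_add_index' (fun _ => pow_zero _) fun _ _ _ => pow_add _ _ _

theorem monomialProd_single {ι A : Type*} [CommRing A] (b : ι → A) (i : ι) (e : ℕ) :
    monomialProd b (Finsupp.single i e) = b i ^ e :=
  Finsupp.prod_single_index (pow_zero _)

theorem map_monomialProd {ι A A' : Type*} [CommRing A] [CommRing A'] (f : A →+* A') (b : ι → A)
    (s : ι →₀ ℕ) : f (monomialProd b s) = monomialProd (fun i => f (b i)) s := by
  simp [monomialProd, Finsupp.prod, map_prod]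

/-- Every field of characteristic `p` has a `p`-basis. -/
theorem exists_pBasis (k : Type u) [Field k] (p : ℕ) [Fact p.Prime] [CharP k p] :
    ∃ B : Set k,
      LinearIndepOn (frobenius k p).fieldRange (monomialProd (id : k → k)) (reducedExponents p B) ∧
      Subring.closure ((Set.range fun x : k => x ^ p) ∪ B) = ⊤ := by
  classical
  have hp : p.Prime := Fact.out
  let kp := (frobenius k p).fieldRange
  obtain ⟨B, hB, hmax⟩ := zorn_subset
    {B : Set k | LinearIndepOn kp (monomialProd (id : k → k)) (reducedExponents p B)} (by
      intro c hc hch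
      refine ⟨⋃₀ c, ?_, fun s hs => Set.subset_sUnion_of_mem hs⟩
      rcases c.eq_empty_or_nonempty with rfl | hne
      · have : reducedExponents p (⋃₀ (∅ : Set (Set k))) ⊆ {0} := by
          intro s hs
          have := hs.1
          rw [Set.sUnion_empty, Set.subset_empty_iff, Finset.coe_eq_empty,
            Finsupp.support_eq_empty] at this
          exact this
        refine LinearIndepOn.mono (LinearIndepOn.singleton ?_) this
        rw [monomialProd_zero]
        exact one_ne_zero
      · have : reducedExponents p (⋃₀ c) ⊆ ⋃ B ∈ c, reducedExponents p B := by
          intro s hs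
          have h1 := hs.1
          rw [Set.sUnion_eq_biUnion] at h1
          obtain ⟨B, hB, h2⟩ := DirectedOn.exists_mem_subset_of_finset_subset_biUnion hne
            (fun a ha b hb => by
              rcases hch.total ha hb with h | h
              · exact ⟨b, hb, h, subset_rfl⟩
              · exact ⟨a, ha, subset_rfl, h⟩) h1
          exact Set.mem_biUnion hB ⟨h2, hs.2⟩
        refine LinearIndepOn.mono (linearIndepOn_biUnion_of_directed ?_ fun B hB => hc hB) this
        intro a ha b hb
        have hm : ∀ {a b : Set k}, a ⊆ b → reducedExponents p a ⊆ reducedExponents p b :=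
          fun h s hs => ⟨hs.1.trans h, hs.2⟩
        rcases hch.total ha hb with h | h
        · exact ⟨b, hb, hm h, subset_rfl⟩
        · exact ⟨a, ha, subset_rfl, hm h⟩)
  refine ⟨B, hB, ?_⟩
  have hpk : ∀ x : k, x ^ p ∈ kp := fun x => ⟨x, rfl⟩
  have halg : ∀ x : k, IsAlgebraic kp x := fun x => by
    refine ⟨Polynomial.X ^ p - Polynomial.C ⟨x ^ p, hpk x⟩,
      (Polynomial.monic_X_pow_sub_C _ hp.ne_zero).ne_zero, ?_⟩
    simp only [map_sub, map_pow, Polynomial.aeval_X, Polynomial.aeval_C]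
    exact sub_self _
  let L := IntermediateField.adjoin kp B
  have hL : ∀ x, x ∈ L → x ∈ Subring.closure ((Set.range fun x : k => x ^ p) ∪ B) := by
    intro x hx
    have h1 : x ∈ Algebra.adjoin kp B := by
      rw [← IntermediateField.adjoin_toSubalgebra_of_isAlgebraic fun x _ => halg x]
      exact hx
    clear hx
    induction h1 using Algebra.adjoin_induction with
    | mem x hx => exact Subring.subset_closure (Or.inr hx)
    | algebraMap r =>
      obtain ⟨r, y, rfl⟩ := r
      exact Subring.subset_closure (Or.inl ⟨y, rfl⟩)
    | add x y _ _ h1 h2 => exact add_mem h1 h2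
    | mul x y _ _ h1 h2 => exact mul_mem h1 h2
  rw [eq_top_iff]
  rintro x -
  refine hL x ?_
  by_contra hx
  have hirr : Irreducible (Polynomial.X ^ p - Polynomial.C (⟨x ^ p, L.algebraMap_mem ⟨_, hpk x⟩⟩ : L)) := by
    refine X_pow_sub_C_irreducible_of_prime hp fun y hy => hx ?_
    have : (y : k) ^ p = x ^ p := congrArg Subtype.val hy
    rw [← frobenius_inj k p this]
    exact y.2
  have hmin := minpoly.eq_of_irreducible_of_monic hirr (x := x) (by
    simp only [map_sub, map_pow, Polynomial.aeval_X, Polynomial.aeval_C]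
    exact sub_self _) (Polynomial.monic_X_pow_sub_C _ hp.ne_zero)
  have hdeg : (minpoly L x).natDegree = p := by rw [← hmin, Polynomial.natDegree_X_pow_sub_C]
  have hpow := linearIndependent_pow (K := L) x
  rw [hdeg] at hpow
  have hmem : ∀ s : reducedExponents p B, monomialProd (id : k → k) s.1 ∈ L := fun s =>
    prod_mem fun i hi => pow_mem (IntermediateField.subset_adjoin _ _ (s.2.1 hi)) _
  have hBL : LinearIndependent kp
      (fun s : reducedExponents p B => (⟨monomialProd (id : k → k) s.1, hmem s⟩ : L)) :=
    LinearIndependent.of_comp L.val.toLinearMap hB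
  have hprod := linearIndependent_smul hBL hpow
  have key : LinearIndepOn kp (monomialProd (id : k → k)) (reducedExponents p (insert x B)) := by
    have hxB : x ∉ B := fun h => hx (IntermediateField.subset_adjoin _ _ h)
    let f : reducedExponents p (insert x B) → reducedExponents p B × Fin p := fun s =>
      (⟨s.1.erase x, by
        constructor
        · intro i hi
          rw [Finsupp.support_erase, Finset.coe_erase] at hi
          exact (s.2.1 hi.1).resolve_left hi.2
        · intro i
          rw [Finsupp.erase_apply]
          split_ifs
          · exact hp.pos
          · exact s.2.2 i⟩, ⟨s.1 x, s.2.2 x⟩)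
    have hf : Function.Injective f := by
      intro s t h
      have h1 : s.1.erase x = t.1.erase x := congrArg (fun z => z.1.1) h
      have h2 : s.1 x = t.1 x := congrArg (fun z => z.2.1) h
      refine Subtype.ext ?_
      rw [← Finsupp.erase_add_single x s.1, ← Finsupp.erase_add_single x t.1, h1, h2]
    have h1 := hprod.comp f hf
    have h2 : (fun s : reducedExponents p (insert x B) => monomialProd (id : k → k) s.1) =
        (fun z : reducedExponents p B × Fin p =>
          (⟨monomialProd (id : k → k) z.1.1, hmem z.1⟩ : L) • x ^ (z.2 : ℕ)) ∘ f := by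
      funext s
      conv_lhs => rw [← Finsupp.erase_add_single x s.1, monomialProd_add, monomialProd_single]
      rfl
    change LinearIndependent kp fun s : reducedExponents p (insert x B) =>
      monomialProd (id : k → k) s.1
    rw [h2]
    exact h1
  exact hx (IntermediateField.subset_adjoin _ _
    (hmax key (Set.subset_insert x B) (Set.mem_insert x B)))

theorem exists_eq_sum_pow_mul_monomialProd {C ι : Type*} [CommRing C] {p : ℕ} [Fact p.Prime]
    [CharP C p] (b : ι → C) (B : Set ι) {x : C}
    (hx : x ∈ Subring.closure ((Set.range fun y : C => y ^ p) ∪ b '' B)) :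
    ∃ y : (ι →₀ ℕ) →₀ C, ↑y.support ⊆ reducedExponents p B ∧
      x = y.sum fun s a => a ^ p * monomialProd b s := by
  classical
  have hp : p.Prime := Fact.out
  let F := (frobenius C p).range
  have hclos : x ∈ Submodule.span F (Submonoid.closure (b '' B) : Set C) := by
    rw [← Algebra.adjoin_eq_span]
    have : Subring.closure ((Set.range fun y : C => y ^ p) ∪ b '' B) ≤
        (Algebra.adjoin F (b '' B)).toSubring := by
      rw [Subring.closure_le]
      rintro y (⟨z, rfl⟩ | hy)
      · exact (Algebra.adjoin F (b '' B)).algebraMap_mem ⟨z ^ p, z, rfl⟩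
      · exact Algebra.subset_adjoin hy
    exact this hx
  have hmon : ∀ y ∈ Submonoid.closure (b '' B), ∃ s : ι →₀ ℕ, ↑s.support ⊆ B ∧
      y = monomialProd b s := by
    intro y hy
    induction hy using Submonoid.closure_induction with
    | mem y hy =>
      obtain ⟨i, hi, rfl⟩ := hy
      refine ⟨Finsupp.single i 1, ?_, by rw [monomialProd_single, pow_one]⟩
      intro j hj
      rw [Finset.mem_coe, Finsupp.mem_support_single] at hj
      rwa [hj.1]
    | one => exact ⟨0, by simp, (monomialProd_zero b).symm⟩
    | mul y z _ _ hy hz =>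
      obtain ⟨s, hs, rfl⟩ := hy
      obtain ⟨t, ht, rfl⟩ := hz
      refine ⟨s + t, ?_, (monomialProd_add b s t).symm⟩
      exact (Finset.coe_subset.2 Finsupp.support_add).trans
        (by rw [Finset.coe_union]; exact Set.union_subset hs ht)
  have hspan : x ∈ Submodule.span F (monomialProd b '' reducedExponents p B) := by
    refine Submodule.span_le.2 ?_ hclos
    intro y hy
    obtain ⟨s, hs, rfl⟩ := hmon y hy
    let q : ι →₀ ℕ := s.mapRange (· / p) (Nat.zero_div p)
    let r : ι →₀ ℕ := s.mapRange (· % p) (Nat.zero_mod p)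
    have hsqr : s = p • q + r := by
      ext i
      simp [q, r, Nat.div_add_mod]
    have hpq : ∀ n : ℕ, monomialProd b (n • q) = monomialProd b q ^ n := by
      intro n
      induction n with
      | zero => simp [monomialProd_zero]
      | succ n ih => rw [succ_nsmul, monomialProd_add, ih, pow_succ]
    rw [hsqr, monomialProd_add, hpq]
    refine Submodule.smul_mem _ (⟨monomialProd b q ^ p, _, rfl⟩ : F) (Submodule.subset_span ⟨r, ?_, rfl⟩)
    refine ⟨fun i hi => hs ?_, fun i => Nat.mod_lt _ hp.pos⟩
    exact Finsupp.support_mapRange hi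
  obtain ⟨c, hc, hcx⟩ := (Finsupp.mem_span_image_iff_linearCombination F).1 hspan
  have hroot : ∀ f : F, ∃ y : C, y ^ p = f.1 := fun f => f.2
  choose ρ hρ using hroot
  let y : (ι →₀ ℕ) →₀ C := Finsupp.onFinset c.support (fun s => if s ∈ c.support then ρ (c s) else 0)
    (by intro s hs; by_contra h; simp [h] at hs)
  refine ⟨y, ?_, ?_⟩
  · exact (Finset.coe_subset.2 Finsupp.support_onFinset_subset).trans ((Finsupp.mem_supported _ _).1 hc)
  · rw [← hcx, Finsupp.linearCombination_apply, Finsupp.sum,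
      Finsupp.sum_of_support_subset y Finsupp.support_onFinset_subset _
        (by intro i _; rw [zero_pow hp.ne_zero, zero_mul])]
    refine Finset.sum_congr rfl fun s hs => ?_
    have : y s = ρ (c s) := by simp only [y, Finsupp.onFinset_apply, if_pos hs]
    rw [this, hρ]
    rfl

theorem exists_sub_sum_pow_mul_monomialProd_mem {W ι : Type*} [CommRing W] {p : ℕ}
    (hp : p.Prime) {I : Ideal W} (hI : I ≠ ⊤) (hpI : (p : W) ∈ I) (b : ι → W) (B : Set ι) {x : W}
    (hx : x ∈ Subring.closure ((Set.range fun y : W => y ^ p) ∪ b '' B ∪ I)) :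
    ∃ y : (ι →₀ ℕ) →₀ W, ↑y.support ⊆ reducedExponents p B ∧
      x - (y.sum fun s a => a ^ p * monomialProd b s) ∈ I := by
  classical
  have : Fact p.Prime := ⟨hp⟩
  have : Nontrivial (W ⧸ I) := Ideal.Quotient.nontrivial_iff.2 hI
  have : CharP (W ⧸ I) p := (CharP.charP_iff_prime_eq_zero hp).2 (by
    rw [← map_natCast (Ideal.Quotient.mk I)]
    exact Ideal.Quotient.eq_zero_iff_mem.2 hpI)
  let π := Ideal.Quotient.mk I
  have h1 : π x ∈ Subring.closure ((Set.range fun y : W ⧸ I => y ^ p) ∪ (fun i => π (b i)) '' B) := by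
    have : Subring.closure ((Set.range fun y : W => y ^ p) ∪ b '' B ∪ I) ≤
      (Subring.closure ((Set.range fun y : W ⧸ I => y ^ p) ∪ (fun i => π (b i)) '' B)).comap π := by
      rw [Subring.closure_le]
      rintro y ((⟨z, rfl⟩ | ⟨i, hi, rfl⟩) | hy)
      · exact Subring.subset_closure (Or.inl ⟨π z, (map_pow _ _ _).symm⟩)
      · exact Subring.subset_closure (Or.inr ⟨i, hi, rfl⟩)
      · have h0 : π y = 0 := Ideal.Quotient.eq_zero_iff_mem.2 hy
        rw [SetLike.mem_coe, Subring.mem_comap, h0]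
        exact zero_mem _
    exact this hx
  obtain ⟨y, hy, hxy⟩ := exists_eq_sum_pow_mul_monomialProd _ _ h1
  let σ : W ⧸ I → W := fun c => if c = 0 then 0 else Quotient.out c
  have hσ0 : σ 0 = 0 := if_pos rfl
  have hσ : ∀ c, π (σ c) = c := by
    intro c
    by_cases hc : c = 0
    · rw [hc, hσ0, map_zero]
    · simp only [σ, if_neg hc]
      exact Ideal.Quotient.mk_out c
  refine ⟨y.mapRange σ hσ0, (Finset.coe_subset.2 Finsupp.support_mapRange).trans hy, ?_⟩
  rw [← Ideal.Quotient.eq_zero_iff_mem, map_sub, sub_eq_zero]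
  change π x = π _
  rw [hxy, Finsupp.sum_mapRange_index (by intro s; rw [zero_pow hp.ne_zero, zero_mul]), Finsupp.sum,
    Finsupp.sum, map_sum]
  refine Finset.sum_congr rfl fun s _ => ?_
  rw [map_mul, map_pow, hσ, map_monomialProd]

theorem Ideal.pow_sub_pow_mem_pow_succ {A : Type*} [CommRing A] {I : Ideal A} {p : ℕ}
    (hp : (p : A) ∈ I) {j : ℕ} {x y : A} (h : x - y ∈ I ^ (j + 1)) :
    x ^ p - y ^ p ∈ I ^ (j + 2) := by
  rw [← geom_sum₂_mul, pow_succ' I (j + 1)]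
  refine Ideal.mul_mem_mul ?_ h
  have hxy : Ideal.Quotient.mk I x = Ideal.Quotient.mk I y :=
    Ideal.Quotient.eq.2 (Ideal.pow_le_self j.succ_ne_zero h)
  rw [← Ideal.Quotient.eq_zero_iff_mem, map_sum]
  simp only [map_mul, map_pow, hxy]
  rw [geom_sum₂_self, ← map_natCast (Ideal.Quotient.mk I), Ideal.Quotient.eq_zero_iff_mem.2 hp,
    zero_mul]

/-- The decreasing sequence of subrings whose intersection is a coefficient ring. -/
def coeffSubring {A ι : Type*} [CommRing A] (I : Ideal A) (p : ℕ) (β : ι → A) : ℕ → Subring A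
  | 0 => ⊤
  | n + 1 => Subring.closure ((((fun w => w ^ p) '' (coeffSubring I p β n : Set A)) ∪ Set.range β) ∪
      (((fun w => (p : A) * w) '' (coeffSubring I p β n : Set A)) ∪ ↑(I ^ (n + 2))))

section

variable {A ι : Type*} [CommRing A] {I : Ideal A} {p : ℕ} {β : ι → A}

theorem pow_mem_coeffSubring_succ {n : ℕ} {w : A} (hw : w ∈ coeffSubring I p β n) :
    w ^ p ∈ coeffSubring I p β (n + 1) :=
  Subring.subset_closure (Or.inl (Or.inl ⟨w, hw, rfl⟩))

theorem mul_mem_coeffSubring_succ {n : ℕ} {w : A} (hw : w ∈ coeffSubring I p β n) :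
    (p : A) * w ∈ coeffSubring I p β (n + 1) :=
  Subring.subset_closure (Or.inr (Or.inl ⟨w, hw, rfl⟩))

theorem mem_coeffSubring_of_mem_pow {n : ℕ} {w : A} (hw : w ∈ I ^ (n + 1)) :
    w ∈ coeffSubring I p β n := by
  cases n with
  | zero => exact Subring.mem_top w
  | succ n => exact Subring.subset_closure (Or.inr (Or.inr hw))

theorem apply_mem_coeffSubring (n : ℕ) (i : ι) : β i ∈ coeffSubring I p β n := by
  cases n with
  | zero => exact Subring.mem_top _
  | succ n => exact Subring.subset_closure (Or.inl (Or.inr ⟨i, rfl⟩))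

theorem monomialProd_mem_coeffSubring (n : ℕ) (s : ι →₀ ℕ) :
    monomialProd β s ∈ coeffSubring I p β n :=
  prod_mem fun i _ => pow_mem (apply_mem_coeffSubring n i) _

theorem coeffSubring_succ_le (n : ℕ) : coeffSubring I p β (n + 1) ≤ coeffSubring I p β n := by
  refine Subring.closure_le.2 ?_
  rintro x ((⟨w, hw, rfl⟩ | ⟨i, rfl⟩) | (⟨w, hw, rfl⟩ | hw))
  · exact pow_mem hw _
  · exact apply_mem_coeffSubring n i
  · exact mul_mem (natCast_mem _ p) hw
  · exact mem_coeffSubring_of_mem_pow (Ideal.pow_le_pow_right (Nat.le_succ _) hw)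

theorem coeffSubring_antitone : Antitone (coeffSubring I p β) :=
  antitone_nat_of_succ_le coeffSubring_succ_le

theorem exists_eq_of_mem_coeffSubring_succ (hp : p.Prime) (hI : I ≠ ⊤) (hpI : (p : A) ∈ I)
    {B : Set ι} (hβ : ∀ i, i ∉ B → β i = 0) {n : ℕ} {v : A}
    (hv : v ∈ coeffSubring I p β (n + 1)) :
    ∃ y : (ι →₀ ℕ) →₀ A, ↑y.support ⊆ reducedExponents p B ∧
      (∀ s, y s ∈ coeffSubring I p β n) ∧ ∃ a ∈ coeffSubring I p β n, ∃ z ∈ I ^ (n + 2),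
        v = (y.sum fun s a => a ^ p * monomialProd β s) + p * a + z := by
  classical
  let W := coeffSubring I p β n
  let b : ι → W := fun i => ⟨β i, apply_mem_coeffSubring n i⟩
  let J : Ideal W := Ideal.span {(p : W)} ⊔ (I ^ (n + 2)).comap W.subtype
  have hJI : J ≤ I.comap W.subtype := by
    refine sup_le ((Ideal.span_singleton_le_iff_mem _).2 ?_) (Ideal.comap_mono
      (Ideal.pow_le_self (Nat.succ_ne_zero _)))
    rw [Ideal.mem_comap, map_natCast]
    exact hpI
  have hJ : J ≠ ⊤ := fun h => hI ((Ideal.eq_top_iff_one _).2 (by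
    have := hJI (h ▸ Submodule.mem_top : (1 : W) ∈ J)
    rwa [Ideal.mem_comap, map_one] at this))
  have hpJ : (p : W) ∈ J := Ideal.mem_sup_left (Ideal.mem_span_singleton_self _)
  have hle : coeffSubring I p β (n + 1) ≤
      (Subring.closure ((Set.range fun y : W => y ^ p) ∪ b '' B ∪ J)).map W.subtype := by
    refine Subring.closure_le.2 ?_
    rintro x ((⟨w, hw, rfl⟩ | ⟨i, rfl⟩) | (⟨w, hw, rfl⟩ | hw))
    · exact ⟨⟨w, hw⟩ ^ p, Subring.subset_closure (Or.inl (Or.inl ⟨⟨w, hw⟩, rfl⟩)), rfl⟩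
    · by_cases hi : i ∈ B
      · exact ⟨b i, Subring.subset_closure (Or.inl (Or.inr ⟨i, hi, rfl⟩)), rfl⟩
      · rw [hβ i hi]
        exact zero_mem _
    · exact ⟨p * ⟨w, hw⟩, Subring.subset_closure (Or.inr (J.mul_mem_right _ hpJ)), by simp⟩
    · exact ⟨⟨x, mem_coeffSubring_of_mem_pow (Ideal.pow_le_pow_right (Nat.le_succ _) hw)⟩,
        Subring.subset_closure (Or.inr (Ideal.mem_sup_right hw)), rfl⟩
  obtain ⟨v', hv', rfl⟩ := hle hv
  obtain ⟨y, hy, hvy⟩ := exists_sub_sum_pow_mul_monomialProd_mem hp hJ hpJ b B hv'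
  obtain ⟨c, hc, z, hz, hcz⟩ := Submodule.mem_sup.1 hvy
  obtain ⟨a, rfl⟩ := Ideal.mem_span_singleton'.1 hc
  refine ⟨y.mapRange W.subtype (map_zero _),
    (Finset.coe_subset.2 Finsupp.support_mapRange).trans hy, fun s => (y s).2, a, a.2, z, hz, ?_⟩
  rw [Finsupp.sum_mapRange_index (by intro s; rw [zero_pow hp.ne_zero, zero_mul])]
  have h1 := congrArg W.subtype (eq_add_of_sub_eq hcz.symm)
  rw [h1, map_add, map_add, map_mul, map_natCast, Finsupp.sum, map_sum, Finsupp.sum]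
  simp only [map_mul, map_pow, map_monomialProd]
  change a.1 * p + z.1 + _ = _ + p * a.1 + z.1
  rw [mul_comm a.1]
  exact (add_comm _ _).trans (add_assoc _ _ _).symm

end

section

variable {A : Type*} [CommRing A] [IsLocalRing A] {p : ℕ} {β : ResidueField A → A}
  {B : Set (ResidueField A)}

theorem exists_mem_coeffSubring_residue_eq
    (hB : Subring.closure ((Set.range fun x : ResidueField A => x ^ p) ∪ B) = ⊤)
    (hβ : ∀ b ∈ B, residue A (β b) = b) (n : ℕ) (c : ResidueField A) :
    ∃ v ∈ coeffSubring (maximalIdeal A) p β n, residue A v = c := by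
  induction n generalizing c with
  | zero =>
    obtain ⟨v, rfl⟩ := residue_surjective c
    exact ⟨v, Subring.mem_top v, rfl⟩
  | succ n ih =>
    have hle : Subring.closure ((Set.range fun x : ResidueField A => x ^ p) ∪ B) ≤
        (coeffSubring (maximalIdeal A) p β (n + 1)).map (residue A) := by
      refine Subring.closure_le.2 ?_
      rintro x (⟨y, rfl⟩ | hx)
      · obtain ⟨v, hv, rfl⟩ := ih y
        exact ⟨v ^ p, pow_mem_coeffSubring_succ hv, map_pow _ _ _⟩
      · exact ⟨β x, apply_mem_coeffSubring _ x, hβ x hx⟩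
    exact hle (hB ▸ Subring.mem_top c)

theorem exists_eq_of_mem_coeffSubring_of_mem_maximalIdeal [Fact p.Prime] [CharP (ResidueField A) p]
    (hBi : LinearIndepOn (frobenius (ResidueField A) p).fieldRange
      (monomialProd (id : ResidueField A → _)) (reducedExponents p B))
    (hβ : ∀ b ∈ B, residue A (β b) = b) (hβ0 : ∀ b, b ∉ B → β b = 0) (n : ℕ) :
    ∀ v ∈ coeffSubring (maximalIdeal A) p β (n + 1), v ∈ maximalIdeal A →
      ∃ a ∈ coeffSubring (maximalIdeal A) p β n, v - p * a ∈ maximalIdeal A ^ (n + 2) := by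
  classical
  have hp : p.Prime := Fact.out
  have hpm : (p : A) ∈ maximalIdeal A := by
    rw [← residue_eq_zero_iff, map_natCast, CharP.cast_eq_zero]
  have hstep : ∀ n, (∀ y ∈ coeffSubring (maximalIdeal A) p β n, y ∈ maximalIdeal A →
      ∃ a ∈ coeffSubring (maximalIdeal A) p β n, y ^ p - p * a ∈ maximalIdeal A ^ (n + 2)) →
      ∀ v ∈ coeffSubring (maximalIdeal A) p β (n + 1), v ∈ maximalIdeal A →
      ∃ a ∈ coeffSubring (maximalIdeal A) p β n, v - p * a ∈ maximalIdeal A ^ (n + 2) := by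
    intro n hn v hv hvm
    obtain ⟨y, hy, hyV, a, ha, z, hz, rfl⟩ := exists_eq_of_mem_coeffSubring_succ hp
      (Ideal.IsPrime.ne_top inferInstance) hpm hβ0 hv
    have hmon : ∀ s ∈ y.support, residue A (monomialProd β s) =
        monomialProd (id : ResidueField A → _) s := by
      intro s hs
      rw [map_monomialProd]
      exact Finset.prod_congr rfl fun i hi => congrArg (· ^ s i) (hβ i ((hy hs).1 hi))
    have hy0 : ∀ s ∈ y.support, residue A (y s) = 0 := by
      have h0 := (residue_eq_zero_iff _).2 hvm
      rw [map_add, map_add, map_mul, map_natCast, CharP.cast_eq_zero, zero_mul, add_zero,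
        (residue_eq_zero_iff z).2 (Ideal.pow_le_self (Nat.succ_ne_zero _) hz), add_zero,
        Finsupp.sum, map_sum] at h0
      have h1 := linearIndepOn_iff'.1 hBi y.support
        (fun s => ⟨residue A (y s) ^ p, residue A (y s), rfl⟩) hy (by
          rw [← h0]
          refine Finset.sum_congr rfl fun s hs => ?_
          rw [map_mul, map_pow, hmon s hs]
          rfl)
      intro s hs
      have h2 := congrArg Subtype.val (h1 s hs)
      exact eq_zero_of_pow_eq_zero h2
    have hex : ∀ s, ∃ a ∈ coeffSubring (maximalIdeal A) p β n, s ∈ y.support →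
        y s ^ p - p * a ∈ maximalIdeal A ^ (n + 2) := by
      intro s
      by_cases hs : s ∈ y.support
      · obtain ⟨a, ha, h⟩ := hn (y s) (hyV s) ((residue_eq_zero_iff _).1 (hy0 s hs))
        exact ⟨a, ha, fun _ => h⟩
      · exact ⟨0, zero_mem _, fun h => absurd h hs⟩
    choose c hc hcy using hex
    refine ⟨(∑ s ∈ y.support, c s * monomialProd β s) + a,
      add_mem (sum_mem fun s _ => mul_mem (hc s) (monomialProd_mem_coeffSubring n s)) ha, ?_⟩
    have : (y.sum fun s a => a ^ p * monomialProd β s) + p * a + z -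
        p * ((∑ s ∈ y.support, c s * monomialProd β s) + a) =
        (∑ s ∈ y.support, (y s ^ p - p * c s) * monomialProd β s) + z := by
      simp only [sub_mul, Finset.sum_sub_distrib, mul_add, Finset.mul_sum, Finsupp.sum, mul_assoc]
      ring
    rw [this]
    exact add_mem (sum_mem fun s hs => Ideal.mul_mem_right _ _ (hcy s hs)) hz
  induction n with
  | zero =>
    refine hstep 0 fun y _ hy => ⟨0, zero_mem _, ?_⟩
    rw [mul_zero, sub_zero]
    exact Ideal.pow_le_pow_right hp.two_le (Ideal.pow_mem_pow hy p)
  | succ n ih =>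
    refine hstep (n + 1) fun y hy hym => ?_
    obtain ⟨a, ha, hz⟩ := ih y hy hym
    refine ⟨p ^ (p - 1) * a ^ p, mul_mem (pow_mem (natCast_mem _ p) _)
      (pow_mem_coeffSubring_succ ha), ?_⟩
    have := Ideal.pow_sub_pow_mem_pow_succ hpm hz
    rwa [mul_pow, show (p : A) ^ p = p * p ^ (p - 1) from (mul_pow_sub_one hp.ne_zero _).symm,
      mul_assoc] at this

theorem mem_coeffSubring_of_mul_eq_one {A ι : Type*} [CommRing A] {I : Ideal A} {p : ℕ}
    (hp : p.Prime) {β : ι → A} {x y : A} (hxy : x * y = 1) (n : ℕ) (hx : x ∈ coeffSubring I p β n) :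
    y ∈ coeffSubring I p β n := by
  induction n with
  | zero => exact Subring.mem_top y
  | succ n ih =>
    have h1 := pow_mem_coeffSubring_succ (ih (coeffSubring_succ_le n hx))
    have : y = y ^ p * x ^ (p - 1) := by
      rw [← mul_pow_sub_one hp.ne_zero y, mul_assoc, ← mul_pow, mul_comm y x, hxy, one_pow, mul_one]
    rw [this]
    exact mul_mem h1 (pow_mem hx _)

theorem exists_mem_coeffSubring_succ_sub_mem [Fact p.Prime] [CharP (ResidueField A) p]
    (hB : Subring.closure ((Set.range fun x : ResidueField A => x ^ p) ∪ B) = ⊤)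
    (hβ : ∀ b ∈ B, residue A (β b) = b) (hβ0 : ∀ b, b ∉ B → β b = 0) (n : ℕ) :
    ∀ v ∈ coeffSubring (maximalIdeal A) p β n, ∃ w ∈ coeffSubring (maximalIdeal A) p β (n + 1),
      v - w ∈ maximalIdeal A ^ (n + 1) := by
  classical
  have hp : p.Prime := Fact.out
  have hpm : (p : A) ∈ maximalIdeal A := by
    rw [← residue_eq_zero_iff, map_natCast, CharP.cast_eq_zero]
  induction n with
  | zero =>
    intro v _
    obtain ⟨w, hw, h⟩ := exists_mem_coeffSubring_residue_eq hB hβ 1 (residue A v)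
    refine ⟨w, hw, ?_⟩
    rw [zero_add, pow_one, ← residue_eq_zero_iff, map_sub, h, sub_self]
  | succ n ih =>
    intro v hv
    obtain ⟨y, hy, hyV, a, ha, z, hz, rfl⟩ := exists_eq_of_mem_coeffSubring_succ hp
      (Ideal.IsPrime.ne_top inferInstance) hpm hβ0 hv
    obtain ⟨a', ha', haa⟩ := ih a ha
    choose y' hy' hyy using fun s => ih (y s) (hyV s)
    refine ⟨(∑ s ∈ y.support, y' s ^ p * monomialProd β s) + p * a',
      add_mem (sum_mem fun s _ => mul_mem (pow_mem_coeffSubring_succ (hy' s))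
        (monomialProd_mem_coeffSubring _ s)) (mul_mem_coeffSubring_succ ha'), ?_⟩
    have : (y.sum fun s a => a ^ p * monomialProd β s) + p * a + z -
        ((∑ s ∈ y.support, y' s ^ p * monomialProd β s) + p * a') =
        (∑ s ∈ y.support, (y s ^ p - y' s ^ p) * monomialProd β s) + p * (a - a') + z := by
      simp only [sub_mul, Finset.sum_sub_distrib, Finsupp.sum, mul_sub]
      ring
    rw [this]
    refine add_mem (add_mem (sum_mem fun s hs => Ideal.mul_mem_right _ _
      (Ideal.pow_sub_pow_mem_pow_succ hpm (hyy s))) ?_) hz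
    rw [pow_succ']
    exact Ideal.mul_mem_mul hpm haa

end

theorem IsPrecomplete.exists_sub_mem_pow {A : Type*} [CommRing A] {I : Ideal A} [IsPrecomplete I A]
    (c : ℕ) (f : ℕ → A) (hf : ∀ j, f j - f (j + 1) ∈ I ^ (c + j)) :
    ∃ L, ∀ j, f j - L ∈ I ^ (c + j) := by
  have hf' : ∀ i j, i ≤ j → f i - f j ∈ I ^ (c + i) := by
    intro i j hij
    induction j, hij using Nat.le_induction with
    | base => rw [sub_self]; exact zero_mem _
    | succ j hij ih =>
      rw [← sub_add_sub_cancel _ (f j)]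
      exact add_mem ih (Ideal.pow_le_pow_right (by omega) (hf j))
  obtain ⟨L, hL⟩ := IsPrecomplete.prec (I := I) (M := A) inferInstance (f := f) (by
    intro i j hij
    rw [SModEq.sub_mem, smul_eq_mul, Ideal.mul_top]
    exact Ideal.pow_le_pow_right (by omega) (hf' i j hij))
  refine ⟨L, fun j => ?_⟩
  have h1 := hL (c + j)
  rw [SModEq.sub_mem, smul_eq_mul, Ideal.mul_top] at h1
  rw [← sub_add_sub_cancel _ (f (c + j))]
  exact add_mem (hf' _ _ (by omega)) h1

theorem IsHausdorff.eq_zero_of_forall_mem_pow {A : Type*} [CommRing A] {I : Ideal A}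
    [IsHausdorff I A] {x : A} (hx : ∀ n, x ∈ I ^ n) : x = 0 :=
  IsHausdorff.haus (I := I) (M := A) inferInstance x fun n => by
    rw [SModEq.sub_mem, sub_zero, smul_eq_mul, Ideal.mul_top]
    exact hx n

theorem exists_coefficient_subring {A : Type*} [CommRing A] [IsLocalRing A]
    [IsAdicComplete (maximalIdeal A) A] (p : ℕ) [Fact p.Prime] [CharP (ResidueField A) p]
    (h : (p : A) = 0 ∨ ∀ N, ∃ N', ∀ x : A, p * x ∈ maximalIdeal A ^ N' → x ∈ maximalIdeal A ^ N) :
    ∃ V : Subring A, (∀ c, ∃ v ∈ V, residue A v = c) ∧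
      (∀ v ∈ V, v ∈ maximalIdeal A → ∃ w ∈ V, v = p * w) ∧
      (∀ v ∈ V, ∀ y, v * y = 1 → y ∈ V) := by
  classical
  have hp : p.Prime := Fact.out
  have hpm : (p : A) ∈ maximalIdeal A := by
    rw [← residue_eq_zero_iff, map_natCast, CharP.cast_eq_zero]
  obtain ⟨B, hBi, hB⟩ := exists_pBasis (ResidueField A) p
  obtain ⟨σ, hσ⟩ := (residue_surjective (R := A)).hasRightInverse
  let β : ResidueField A → A := fun b => if b ∈ B then σ b else 0
  have hβ : ∀ b ∈ B, residue A (β b) = b := fun b hb => by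
    simp only [β, if_pos hb]; exact hσ b
  have hβ0 : ∀ b, b ∉ B → β b = 0 := fun b hb => if_neg hb
  let V := coeffSubring (maximalIdeal A) p β
  have happrox : ∀ n, ∀ v ∈ V n, ∃ w, (∀ n, w ∈ V n) ∧ v - w ∈ maximalIdeal A ^ (n + 1) := by
    intro n v hv
    choose r hr hvr using exists_mem_coeffSubring_succ_sub_mem hB hβ hβ0
    let f : ∀ j, V (n + j) := fun j =>
      Nat.rec (motive := fun j => V (n + j)) ⟨v, hv⟩ (fun j w => ⟨r (n + j) w.1 w.2, hr _ _ w.2⟩) j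
    obtain ⟨L, hL⟩ := IsPrecomplete.exists_sub_mem_pow (I := maximalIdeal A) (n + 1)
      (fun j => (f j).1) (fun j => by
        have := hvr (n + j) (f j).1 (f j).2
        rw [show n + 1 + j = n + j + 1 by omega]
        exact this)
    refine ⟨L, fun i => ?_, hL 0⟩
    have h1 : L ∈ V (n + i) := by
      have h2 := hL i
      rw [show n + 1 + i = n + i + 1 by omega] at h2
      rw [← sub_sub_cancel (f i).1 L]
      exact sub_mem (f i).2 (mem_coeffSubring_of_mem_pow h2)
    exact coeffSubring_antitone (Nat.le_add_left i n) h1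
  refine ⟨⨅ n, V n, ?_, ?_, ?_⟩
  · intro c
    obtain ⟨v, hv, rfl⟩ := exists_mem_coeffSubring_residue_eq hB hβ 0 c
    obtain ⟨w, hw, hvw⟩ := happrox 0 v hv
    refine ⟨w, Subring.mem_iInf.2 hw, ?_⟩
    rw [zero_add, pow_one, ← residue_eq_zero_iff, map_sub, sub_eq_zero] at hvw
    exact hvw.symm
  · intro v hv hvm
    have hv' := Subring.mem_iInf.1 hv
    have hex : ∀ n, ∃ w, (∀ n, w ∈ V n) ∧ v - p * w ∈ maximalIdeal A ^ n := by
      intro n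
      obtain ⟨a, ha, hva⟩ := exists_eq_of_mem_coeffSubring_of_mem_maximalIdeal hBi hβ hβ0 n v
        (hv' _) hvm
      obtain ⟨w, hw, haw⟩ := happrox n a ha
      refine ⟨w, hw, ?_⟩
      rw [show v - p * w = (v - p * a) + p * (a - w) by ring]
      exact add_mem (Ideal.pow_le_pow_right (by omega) hva)
        (Ideal.mul_mem_left _ _ (Ideal.pow_le_pow_right (by omega) haw))
    choose w hw hvw using hex
    rcases h with h | h
    · refine ⟨0, zero_mem _, ?_⟩
      rw [mul_zero]
      refine IsHausdorff.eq_zero_of_forall_mem_pow (I := maximalIdeal A) fun n => ?_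
      have := hvw n
      rwa [h, zero_mul, sub_zero] at this
    · choose N hN using h
      let φ : ℕ → ℕ := fun n => n + ∑ i ∈ Finset.range (n + 1), N i
      have hφ1 : ∀ n, n ≤ φ n := fun n => Nat.le_add_right _ _
      have hφ2 : ∀ n, N n ≤ φ n := fun n =>
        (Finset.single_le_sum (f := N) (fun _ _ => Nat.zero_le _)
          (Finset.self_mem_range_succ n)).trans (Nat.le_add_left _ _)
      have hφ3 : ∀ n, φ n ≤ φ (n + 1) := fun n => by
        simp only [φ]
        rw [Finset.sum_range_succ _ (n + 1)]
        omega
      obtain ⟨L, hL⟩ := IsPrecomplete.exists_sub_mem_pow (I := maximalIdeal A) 0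
        (fun j => w (φ j)) (fun j => by
          rw [zero_add]
          refine hN j _ ?_
          have h1 := Ideal.pow_le_pow_right (hφ2 j) (hvw (φ j))
          have h2 := Ideal.pow_le_pow_right ((hφ2 j).trans (hφ3 j)) (hvw (φ (j + 1)))
          have h3 := sub_mem h2 h1
          rwa [show v - p * w (φ (j + 1)) - (v - p * w (φ j)) = p * (w (φ j) - w (φ (j + 1))) by
            ring] at h3)
      refine ⟨L, Subring.mem_iInf.2 fun n => ?_, ?_⟩
      · rw [← sub_sub_cancel (w (φ (n + 1))) L]
        refine sub_mem (hw _ _) (mem_coeffSubring_of_mem_pow ?_)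
        have := hL (n + 1)
        rwa [zero_add] at this
      · rw [← sub_eq_zero]
        refine IsHausdorff.eq_zero_of_forall_mem_pow (I := maximalIdeal A) fun n => ?_
        have := hL n
        rw [zero_add] at this
        rw [show v - p * L = (v - p * w (φ n)) + p * (w (φ n) - L) by ring]
        exact add_mem (Ideal.pow_le_pow_right (hφ1 n) (hvw _)) (Ideal.mul_mem_left _ _ this)
  · intro v hv y hvy
    exact Subring.mem_iInf.2 fun n => mem_coeffSubring_of_mul_eq_one hp hvy n
      (Subring.mem_iInf.1 hv n)

/-- A discrete valuation ring, given with a uniformizer `π`, maps to `A` with `π` mapping into the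
maximal ideal, and onto the residue field of `A`. -/
def HasCoefficientRing (A : Type u) [CommRing A] [IsLocalRing A] : Prop :=
  ∃ (V : Type u) (_ : CommRing V) (_ : IsDomain V) (_ : IsLocalRing V) (_ : IsNoetherianRing V)
    (π : V) (ι : V →+* A), π ≠ 0 ∧ maximalIdeal V = Ideal.span {π} ∧ ι π ∈ maximalIdeal A ∧
      ∀ a, ∃ v, a - ι v ∈ maximalIdeal A

theorem HasCoefficientRing.of_field {A : Type u} [CommRing A] [IsLocalRing A] (K : Type u) [Field K]
    (j : K →+* A) (hj : ∀ a, ∃ x, a - j x ∈ maximalIdeal A) : HasCoefficientRing A := by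
  refine ⟨PowerSeries K, inferInstance, inferInstance, inferInstance, inferInstance, PowerSeries.X,
    j.comp PowerSeries.constantCoeff, PowerSeries.X_ne_zero, PowerSeries.maximalIdeal_eq_span_X,
    ?_, fun a => ?_⟩
  · rw [RingHom.comp_apply, PowerSeries.constantCoeff_X, map_zero]
    exact zero_mem _
  · obtain ⟨x, hx⟩ := hj a
    refine ⟨PowerSeries.C x, ?_⟩
    rwa [RingHom.comp_apply, PowerSeries.constantCoeff_C]

theorem Algebra.FormallySmooth.of_rat (L : Type*) [Field L] [Algebra ℚ L] :
    Algebra.FormallySmooth ℚ L := by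
  obtain ⟨s, hs⟩ := exists_isTranscendenceBasis ℚ L
  have := hs.isAlgebraic_field
  have : CharZero (IntermediateField.adjoin ℚ (Set.range ((↑) : s → L))) :=
    algebraRat.charZero _
  exact .of_algebraicIndependent_of_isSeparable hs.1

theorem HasCoefficientRing.of_algebraRat {A : Type u} [CommRing A] [IsLocalRing A] [Algebra ℚ A]
    [IsAdicComplete (maximalIdeal A) A] : HasCoefficientRing A := by
  have : Algebra.FormallySmooth ℚ (ResidueField A) := .of_rat _
  obtain ⟨g, hg⟩ := Algebra.FormallySmooth.exists_mkₐ_comp_eq_of_isAdicComplete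
    (I := maximalIdeal A) (AlgHom.id ℚ (ResidueField A))
  refine .of_field (ResidueField A) g.toRingHom fun a => ⟨residue A a, ?_⟩
  rw [← residue_eq_zero_iff, map_sub, sub_eq_zero]
  exact (AlgHom.congr_fun hg (residue A a)).symm

theorem HasCoefficientRing.of_isAdicComplete {A : Type u} [CommRing A] [IsLocalRing A]
    [IsAdicComplete (maximalIdeal A) A]
    (h : ∀ p : ℕ, p.Prime → (p : A) ∈ maximalIdeal A → (p : A) = 0 ∨
      ((∀ x : A, p * x = 0 → x = 0) ∧
        ∀ N, ∃ N', ∀ x : A, p * x ∈ maximalIdeal A ^ N' → x ∈ maximalIdeal A ^ N)) :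
    HasCoefficientRing A := by
  obtain ⟨p, hpk⟩ := CharP.exists (ResidueField A)
  rcases CharP.char_is_prime_or_zero (ResidueField A) p with hp | rfl
  · have : Fact p.Prime := ⟨hp⟩
    have hpm : (p : A) ∈ maximalIdeal A := by
      rw [← residue_eq_zero_iff, map_natCast, CharP.cast_eq_zero]
    obtain ⟨V, hVk, hVm, hVu⟩ := exists_coefficient_subring (A := A) p ((h p hp hpm).imp_right (·.2))
    have hsurj : ∀ a, ∃ v : V, a - V.subtype v ∈ maximalIdeal A := fun a => by
      obtain ⟨v, hv, hva⟩ := hVk (residue A a)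
      refine ⟨⟨v, hv⟩, ?_⟩
      rw [← residue_eq_zero_iff, map_sub]
      exact sub_eq_zero.2 hva.symm
    have hunit : ∀ v : V, (v : A) ∉ maximalIdeal A → IsUnit v := fun v hv => by
      obtain ⟨y, hy⟩ := (notMem_maximalIdeal.1 hv).exists_right_inv
      exact IsUnit.of_mul_eq_one ⟨y, hVu v v.2 y hy⟩ (Subtype.ext hy)
    have hunit' : ∀ v : V, IsUnit v → (v : A) ∉ maximalIdeal A := fun v hv =>
      notMem_maximalIdeal.2 (hv.map V.subtype)
    have : IsLocalRing V := .of_nonunits_add fun a b ha hb hab => hunit' _ hab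
      (add_mem (by_contra fun h => ha (hunit _ h)) (by_contra fun h => hb (hunit _ h)))
    have hmax : maximalIdeal V = Ideal.span {(p : V)} := by
      refine le_antisymm (fun v hv => ?_) ((Ideal.span_singleton_le_iff_mem _).2 ?_)
      · obtain ⟨w, hw, hvw⟩ := hVm v v.2 (by_contra fun h => hv (hunit v h))
        exact Ideal.mem_span_singleton'.2 ⟨⟨w, hw⟩, Subtype.ext (by simp [hvw, mul_comm])⟩
      · exact fun h => hunit' _ h (by simpa using hpm)
    rcases h p hp hpm with hp0 | ⟨hpr, -⟩
    · have hF : IsField V := by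
        rw [isField_iff_maximalIdeal_eq, hmax, Ideal.span_singleton_eq_bot]
        exact Subtype.ext (by simpa using hp0)
      let _ := hF.toField
      exact .of_field V V.subtype hsurj
    · have hp0 : (p : V) ≠ 0 := fun h => one_ne_zero (hpr 1 (by
        have := congrArg V.subtype h
        rw [mul_one]
        simpa using this))
      have hpr' : ∀ n (x : A), (p : A) ^ n * x = 0 → x = 0 := by
        intro n
        induction n with
        | zero => intro x hx; simpa using hx
        | succ n ih =>
          intro x hx
          rw [pow_succ, mul_assoc] at hx
          exact hpr _ (ih _ hx)
      have hfac : ∀ x : V, x ≠ 0 → ∃ n, Associated ((p : V) ^ n) x := by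
        intro x hx
        have hex : ∃ n, ¬ (p : V) ^ n ∣ x := by
          by_contra! hcon
          refine hx (Subtype.ext (IsHausdorff.eq_zero_of_forall_mem_pow (I := maximalIdeal A)
            fun n => ?_))
          obtain ⟨w, rfl⟩ := hcon n
          have : ((((p : V) ^ n * w : V)) : A) = (p : A) ^ n * w := by simp
          rw [this]
          exact Ideal.mul_mem_right _ _ (Ideal.pow_mem_pow hpm n)
        classical
        obtain ⟨n, hn⟩ : ∃ n, Nat.find hex = n + 1 :=
          Nat.exists_eq_succ_of_ne_zero fun h0 => by
            have := Nat.find_spec hex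
            rw [h0, pow_zero] at this
            exact this (one_dvd x)
        have h1 : (p : V) ^ n ∣ x := by
          by_contra hcon
          exact absurd (Nat.find_min' hex hcon) (by omega)
        have h2 : ¬ (p : V) ^ (n + 1) ∣ x := hn ▸ Nat.find_spec hex
        obtain ⟨w, rfl⟩ := h1
        have hw : IsUnit w := by
          by_contra hw
          have : w ∈ maximalIdeal V := hw
          rw [hmax, Ideal.mem_span_singleton] at this
          exact h2 (pow_succ (p : V) n ▸ mul_dvd_mul_left _ this)
        exact ⟨n, hw.unit, rfl⟩
      have : NoZeroDivisors V := ⟨fun {x y} hxy => by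
        by_contra! hcon
        obtain ⟨n, u, rfl⟩ := hfac x hcon.1
        obtain ⟨m, v, rfl⟩ := hfac y hcon.2
        have h1 : (p : V) ^ (n + m) = 0 := by
          have : (p : V) ^ (n + m) * (u * v : Vˣ) = 0 := by
            rw [← hxy, pow_add, Units.val_mul]; ring
          rwa [Units.mul_left_eq_zero] at this
        refine one_ne_zero (hpr' (n + m) (1 : A) ?_)
        have := congrArg V.subtype h1
        rw [mul_one]
        simpa using this⟩
      have : IsDomain V := NoZeroDivisors.to_isDomain V
      have hirr : Irreducible (p : V) :=
        ((Ideal.span_singleton_prime hp0).1 (hmax ▸ inferInstance)).irreducible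
      have : IsDiscreteValuationRing V :=
        IsDiscreteValuationRing.ofHasUnitMulPowIrreducibleFactorization ⟨p, hirr, hfac _⟩
      exact ⟨V, inferInstance, inferInstance, inferInstance, inferInstance, p, V.subtype, hp0, hmax,
        by simpa using hpm, hsurj⟩
  · have hc : CharZero (ResidueField A) := CharP.charP_to_charZero _
    have : Nonempty (Algebra ℚ A) := by
      rw [EqualCharZero.nonempty_algebraRat_iff]
      intro I hI
      refine charZero_of_inj_zero fun n hn => ?_
      rw [← map_natCast (Ideal.Quotient.mk I), Ideal.Quotient.eq_zero_iff_mem] at hn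
      have h1 := (residue_eq_zero_iff _).2 (le_maximalIdeal hI hn)
      rw [map_natCast] at h1
      exact_mod_cast h1
    obtain ⟨_⟩ := this
    exact .of_algebraRat

theorem RingHom.ker_eq_bot_of_isWeaklyRegular {S A : Type*} [CommRing S] [IsNoetherianRing S]
    [IsLocalRing S] [CommRing A] (φ : S →+* A) (hφ : Function.Surjective φ) (rs : List S)
    (hrs : Ideal.ofList rs ≤ maximalIdeal S)
    (hreg : RingTheory.Sequence.IsWeaklyRegular A (rs.map φ))
    (hker : RingHom.ker φ ≤ Ideal.ofList rs) : RingHom.ker φ = ⊥ := by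
  let _ := φ.toAlgebra
  have hreg' : RingTheory.Sequence.IsWeaklyRegular A rs :=
    (RingTheory.Sequence.isWeaklyRegular_map_algebraMap_iff A A rs).1 hreg
  let K := RingHom.ker φ
  have hex := RingTheory.Sequence.map_first_exact_on_four_term_right_exact_of_isSMulRegular_last
    (f₁ := (0 : PUnit →ₗ[S] K)) (f₂ := K.subtype) (f₃ := Algebra.linearMap S A)
    (by
      intro x
      constructor
      · intro h
        exact ⟨0, (Subtype.ext h.symm)⟩
      · rintro ⟨y, rfl⟩
        rfl)
    (by
      intro x
      constructor
      · intro h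
        exact ⟨⟨x, h⟩, rfl⟩
      · rintro ⟨y, rfl⟩
        exact y.2) hφ hreg'
  have htop : (⊤ : Submodule S K) ≤ Ideal.ofList rs • ⊤ := by
    rintro x -
    have h1 : Submodule.Quotient.mk x ∈ Set.range (Submodule.mapQ (Ideal.ofList rs • ⊤)
        (Ideal.ofList rs • ⊤) (0 : PUnit →ₗ[S] K)
        (Submodule.smul_top_le_comap_smul_top (Ideal.ofList rs) (0 : PUnit →ₗ[S] K))) := by
      refine (hex _).1 ?_
      rw [Submodule.mapQ_apply, Submodule.Quotient.mk_eq_zero, smul_eq_mul, Ideal.mul_top]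
      exact hker x.2
    obtain ⟨y, hy⟩ := h1
    obtain ⟨y, rfl⟩ := Submodule.Quotient.mk_surjective _ y
    rw [Submodule.mapQ_apply, LinearMap.zero_apply, Submodule.Quotient.mk_zero, eq_comm,
      Submodule.Quotient.mk_eq_zero] at hy
    exact hy
  have h0 := Submodule.eq_bot_of_le_smul_of_le_jacobson_bot (Ideal.ofList rs) (⊤ : Submodule S K)
    (IsNoetherian.noetherian _) htop (hrs.trans (maximalIdeal_le_jacobson _))
  rw [eq_bot_iff]
  intro x hx
  have h1 : (⟨x, hx⟩ : K) ∈ (⊥ : Submodule S K) := h0 ▸ Submodule.mem_top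
  exact congrArg Subtype.val ((Submodule.mem_bot S).1 h1)

theorem MvPowerSeries.exists_ringHom_of_isAdicComplete {V A : Type*} [CommRing V] [CommRing A]
    {I : Ideal A} [IsAdicComplete I A] (ι : V →+* A) {d : ℕ} (a : Fin d → A) (ha : ∀ i, a i ∈ I) :
    ∃ θ : MvPowerSeries (Fin d) V →+* A, (∀ v, θ (C v) = ι v) ∧ ∀ i, θ (X i) = a i := by
  let _ : TopologicalSpace A := I.adicTopology
  have hI : IsAdic I := rfl
  have : IsTopologicalRing A := I.ringFilterBasis.isTopologicalRing
  let _ : UniformSpace A := IsTopologicalAddGroup.rightUniformSpace A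
  have : IsUniformAddGroup A := isUniformAddGroup_of_addCommGroup
  obtain ⟨_, _⟩ := hI.isAdicComplete_iff.1 inferInstance
  have : IsLinearTopology A A := I.isLinearTopology
  let _ : UniformSpace V := ⊥
  have : DiscreteUniformity V := ⟨rfl⟩
  have : DiscreteTopology V := inferInstance
  have hev : HasEval a := by
    refine ⟨fun i => ?_, ?_⟩
    · refine hI.hasBasis_nhds_zero.tendsto_right_iff.2 fun n _ => ?_
      filter_upwards [Filter.eventually_ge_atTop n] with m hm
      exact Ideal.pow_le_pow_right hm (Ideal.pow_mem_pow (ha i) m)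
    · rw [Filter.cofinite_eq_bot]
      exact Filter.tendsto_bot
  refine ⟨eval₂Hom (continuous_of_discreteTopology (f := ι)) hev, fun v => ?_, fun i => ?_⟩
  · rw [coe_eval₂Hom, eval₂_C]
  · rw [coe_eval₂Hom, eval₂_X]

theorem HasCoefficientRing.exists_ringEquiv {A : Type u} [CommRing A] [IsLocalRing A]
    [IsAdicComplete (maximalIdeal A) A] (hA : HasCoefficientRing A) (l : List A)
    (hl : Ideal.ofList l = maximalIdeal A) (hreg : RingTheory.Sequence.IsWeaklyRegular A l) :
    ∃ (V : Type u) (_ : CommRing V) (_ : IsDomain V) (_ : IsLocalRing V) (_ : IsNoetherianRing V)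
      (d : ℕ) (g : MvPowerSeries (Fin d) V), MvPowerSeries.constantCoeff g ≠ 0 ∧
      Ideal.span {MvPowerSeries.constantCoeff g} = maximalIdeal V ∧
      Nonempty ((MvPowerSeries (Fin d) V ⧸ Ideal.span {g}) ≃+* A) := by
  obtain ⟨V, _, _, _, _, π, ι, hπ0, hπ, hιπ, hι⟩ := hA
  have hlm : ∀ i, l.get i ∈ maximalIdeal A := fun i => by
    rw [← hl]
    exact Ideal.subset_span (List.get_mem l i)
  obtain ⟨θ, hθC, hθX⟩ := MvPowerSeries.exists_ringHom_of_isAdicComplete ι l.get hlm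
  let d := l.length
  let S := MvPowerSeries (Fin d) V
  let Xs : List S := (List.finRange d).map MvPowerSeries.X
  have hXs : Xs.map θ = l := by
    rw [List.map_map]
    refine (List.map_congr_left (g := l.get) fun i _ => hθX i).trans ?_
    simp [d]
  have hXmap : (Ideal.ofList Xs).map θ = maximalIdeal A := by
    rw [Ideal.map_ofList, hXs, hl]
  have hsurj : Function.Surjective θ := by
    have hrange : Ideal.span (Set.range MvPowerSeries.X) = Ideal.ofList Xs := by
      congr 1
      ext x
      simp only [Set.mem_range, Xs, List.mem_map, List.mem_finRange, true_and]
      rfl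
    have : IsPrecomplete (Ideal.ofList Xs) S := by
      rw [← hrange]
      infer_instance
    have : IsHausdorff ((Ideal.ofList Xs).map θ) A := by
      rw [hXmap]
      infer_instance
    refine surjective_of_mk_map_comp_surjective (I := Ideal.ofList Xs) θ fun y => ?_
    obtain ⟨y, rfl⟩ := Ideal.Quotient.mk_surjective y
    obtain ⟨v, hv⟩ := hι y
    refine ⟨MvPowerSeries.C v, ?_⟩
    rw [RingHom.comp_apply, hθC, eq_comm, Ideal.Quotient.eq, hXmap]
    exact hv
  obtain ⟨f, hf, hfπ⟩ := (Ideal.mem_map_iff_of_surjective θ hsurj).1 (hXmap ▸ hιπ)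
  have hall : ∀ i : Fin d, i ∈ List.finRange d := List.mem_finRange
  have hf0 := (MvPowerSeries.mem_ofList_X_iff hall f).1 hf
  let g : S := MvPowerSeries.C π - f
  have hg : MvPowerSeries.constantCoeff g = π := by
    rw [map_sub, MvPowerSeries.constantCoeff_C, hf0, sub_zero]
  have hθg : θ g = 0 := by rw [map_sub, hθC, hfπ, sub_self]
  have hgunit : ¬ IsUnit g := fun h => by
    have := h.map θ
    rw [hθg] at this
    exact not_isUnit_zero this
  have : Nontrivial (S ⧸ Ideal.span {g}) := Ideal.Quotient.nontrivial_iff.2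
    (by rwa [Ne, Ideal.span_singleton_eq_top])
  have : IsLocalRing (S ⧸ Ideal.span {g}) := .of_surjective' _ Ideal.Quotient.mk_surjective
  have hgker : ∀ x ∈ Ideal.span {g}, θ x = 0 := fun x hx => by
    obtain ⟨y, rfl⟩ := Ideal.mem_span_singleton'.1 hx
    rw [map_mul, hθg, mul_zero]
  let θ' : S ⧸ Ideal.span {g} →+* A := Ideal.Quotient.lift _ θ hgker
  have hθ' : Function.Surjective θ' := Ideal.Quotient.lift_surjective_of_surjective _ _ hsurj
  have hgm : Ideal.span {MvPowerSeries.constantCoeff g} = maximalIdeal V := by rw [hg, hπ]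
  have hker : RingHom.ker θ' = ⊥ := by
    refine RingHom.ker_eq_bot_of_isWeaklyRegular θ' hθ' (Xs.map (Ideal.Quotient.mk _)) ?_ ?_ ?_
    · exact (MvPowerSeries.ofList_X_map_mk hgm).le
    · rw [List.map_map]
      have : Xs.map (θ' ∘ Ideal.Quotient.mk _) = l := hXs
      rw [this]
      exact hreg
    · rw [MvPowerSeries.ofList_X_map_mk hgm]
      exact le_maximalIdeal (RingHom.ker_ne_top _)
  exact ⟨V, inferInstance, inferInstance, inferInstance, inferInstance, d, g, by rwa [hg], hgm,
    ⟨RingEquiv.ofBijective θ' ⟨(RingHom.injective_iff_ker_eq_bot θ').2 hker, hθ'⟩⟩⟩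

section

namespace AdicCompletion

variable {R : Type u} [CommRing R] [IsLocalRing R] [IsNoetherianRing R]

lemma mem_maximalIdeal_pow_iff (n : ℕ) (x : AdicCompletion (maximalIdeal R) R) :
    x ∈ maximalIdeal (AdicCompletion (maximalIdeal R) R) ^ n ↔
      eval (maximalIdeal R) R n x = 0 := by
  rw [maximalIdeal_eq_map, ← Ideal.map_pow, ← Submodule.restrictScalars_mem R,
    ← Ideal.smul_top_eq_map, pow_smul_top_eq_ker_eval (maximalIdeal R).fg_of_isNoetherianRing]
  rfl

lemma algebraMap_mem_maximalIdeal_pow_iff (n : ℕ) (r : R) :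
    algebraMap R (AdicCompletion (maximalIdeal R) R) r ∈
      maximalIdeal (AdicCompletion (maximalIdeal R) R) ^ n ↔ r ∈ maximalIdeal R ^ n := by
  rw [mem_maximalIdeal_pow_iff, show algebraMap R (AdicCompletion (maximalIdeal R) R) r =
    of _ R r from rfl, eval_of]
  simp [Ideal.Quotient.eq_zero_iff_mem, Ideal.mul_top]

lemma exists_sub_algebraMap_mem (n : ℕ) (x : AdicCompletion (maximalIdeal R) R) :
    ∃ r : R, x - algebraMap R (AdicCompletion (maximalIdeal R) R) r ∈
      maximalIdeal (AdicCompletion (maximalIdeal R) R) ^ n := by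
  obtain ⟨r, hr⟩ := Submodule.mkQ_surjective _ (eval (maximalIdeal R) R n x)
  refine ⟨r, ?_⟩
  rw [mem_maximalIdeal_pow_iff, map_sub, show algebraMap R (AdicCompletion (maximalIdeal R) R) r =
    of _ R r from rfl, eval_of, hr, sub_self]

end AdicCompletion

lemma Ideal.exists_mem_pow_of_mul_mem_pow {R : Type*} [CommRing R] [IsNoetherianRing R]
    [IsDomain R] (I : Ideal R) {a : R} (ha : a ≠ 0)
    (N : ℕ) : ∃ N', N ≤ N' ∧ ∀ r, a * r ∈ I ^ N' → r ∈ I ^ N := by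
  obtain ⟨k, hk⟩ := I.exists_pow_inf_eq_pow_smul (Ideal.span {a} : Submodule R R)
  refine ⟨N + k, by omega, fun r hr => ?_⟩
  have h := hk (N + k) (by omega)
  have hmem : a * r ∈ (I ^ (N + k) • ⊤ ⊓ Ideal.span {a} : Submodule R R) :=
    ⟨by simpa using hr, Ideal.mem_span_singleton.2 ⟨r, rfl⟩⟩
  rw [h, Nat.add_sub_cancel] at hmem
  have hle : (I ^ N • (I ^ k • ⊤ ⊓ Ideal.span {a}) : Submodule R R) ≤
      I ^ N • (Ideal.span {a} : Ideal R) := smul_mono_right _ inf_le_right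
  have h2 := hle hmem
  rw [smul_eq_mul, mul_comm, Ideal.mem_span_singleton_mul] at h2
  obtain ⟨z, hz, hza⟩ := h2
  rwa [mul_left_cancel₀ ha hza] at hz

variable {R : Type u} [CommRing R] [IsLocalRing R] [IsNoetherianRing R]

open AdicCompletion in
theorem AdicCompletion.hasCoefficientRing [IsDomain R] :
    HasCoefficientRing (AdicCompletion (maximalIdeal R) R) := by
  refine HasCoefficientRing.of_isAdicComplete fun p _ _ => ?_
  by_cases hp : (p : R) = 0
  · left
    rw [← map_natCast (algebraMap R (AdicCompletion (maximalIdeal R) R)), hp, _root_.map_zero]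
  right
  have hreg : IsSMulRegular (AdicCompletion (maximalIdeal R) R)
      (algebraMap R (AdicCompletion (maximalIdeal R) R) p) :=
    .of_flat (.of_ne_zero hp)
  refine ⟨fun x hx => ?_, fun N => ?_⟩
  · refine hreg.right_eq_zero_of_smul ?_
    rw [smul_eq_mul, map_natCast, hx]
  · obtain ⟨N', hN, h⟩ := (maximalIdeal R).exists_mem_pow_of_mul_mem_pow hp N
    refine ⟨N', fun x hx => ?_⟩
    obtain ⟨r, hr⟩ := exists_sub_algebraMap_mem N' x
    have h1 : algebraMap R (AdicCompletion (maximalIdeal R) R) (p * r) ∈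
        maximalIdeal (AdicCompletion (maximalIdeal R) R) ^ N' := by
      have : algebraMap R (AdicCompletion (maximalIdeal R) R) (p * r) =
          p * x - p * (x - algebraMap R _ r) := by rw [map_mul, map_natCast]; ring
      rw [this]
      exact sub_mem hx (Ideal.mul_mem_left _ _ hr)
    have h2 := (algebraMap_mem_maximalIdeal_pow_iff N r).2
      (h r ((algebraMap_mem_maximalIdeal_pow_iff N' _).1 h1))
    have := add_mem (Ideal.pow_le_pow_right hN hr) h2
    rwa [sub_add_cancel] at this

/-- A domain that is Noetherian local with maximal ideal generated by a regular sequence is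
dominated, faithfully flatly, by a hypersurface in a power series ring over a discrete valuation
ring. -/
theorem exists_faithfullyFlat_hypersurface [IsDomain R] (l : List R)
    (hl : Ideal.ofList l = maximalIdeal R) (hreg : RingTheory.Sequence.IsWeaklyRegular R l) :
    ∃ (V : Type u) (_ : CommRing V) (_ : IsDomain V) (_ : IsLocalRing V)
      (_ : IsNoetherianRing V) (d : ℕ) (g : MvPowerSeries (Fin d) V),
      MvPowerSeries.constantCoeff g ≠ 0 ∧
      Ideal.span {MvPowerSeries.constantCoeff g} = maximalIdeal V ∧
      ∃ _ : Algebra R (MvPowerSeries (Fin d) V ⧸ Ideal.span {g}),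
        Module.FaithfullyFlat R (MvPowerSeries (Fin d) V ⧸ Ideal.span {g}) := by
  have hl' : Ideal.ofList (l.map (algebraMap R (AdicCompletion (maximalIdeal R) R))) =
      maximalIdeal (AdicCompletion (maximalIdeal R) R) := by
    rw [← Ideal.map_ofList, hl, AdicCompletion.maximalIdeal_eq_map]
  obtain ⟨V, _, _, _, _, d, g, h0, hg, ⟨e⟩⟩ :=
    AdicCompletion.hasCoefficientRing.exists_ringEquiv _ hl'
      (hreg.of_flat (S := AdicCompletion (maximalIdeal R) R))
  refine ⟨V, _, ‹_›, ‹_›, ‹_›, d, g, h0, hg,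
    (e.symm.toRingHom.comp (algebraMap R (AdicCompletion (maximalIdeal R) R))).toAlgebra, ?_⟩
  let _ := (e.symm.toRingHom.comp (algebraMap R (AdicCompletion (maximalIdeal R) R))).toAlgebra
  have : Module.FaithfullyFlat R (AdicCompletion (maximalIdeal R) R) :=
    Module.FaithfullyFlat.of_flat_of_isLocalHom
  let e' : AdicCompletion (maximalIdeal R) R ≃ₐ[R] (MvPowerSeries (Fin d) V ⧸ Ideal.span {g}) :=
    AlgEquiv.ofRingEquiv (f := e.symm) fun r => rfl
  exact Module.FaithfullyFlat.of_linearEquiv _ _ e'.toLinearEquiv.symm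

end

namespace FreeCx

open TensorProduct in
lemma piRight_lTensor_d {R : Type*} [CommRing R] (G : FreeCx R) (A : Type*) [AddCommGroup A]
    [Module R A] (D : Type*) [AddCommGroup D] [Module R D] (i : ℕ)
    (t : A ⊗[R] (Fin (G.rk (i + 1)) → D)) :
    piRight R R A (fun _ => D) ((G.d D i).lTensor A t) =
      G.d (A ⊗[R] D) i (piRight R R A (fun _ => D) t) := by
  induction t using TensorProduct.induction_on with
  | zero => simp
  | tmul a v =>
    ext j
    simp [d_apply, TensorProduct.tmul_sum]
  | add s t hs ht => simp only [map_add, hs, ht]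

lemma subsingleton_T_iff_exact {R : Type*} [CommRing R] (G : FreeCx R) (i : ℕ) (A : Type*)
    [AddCommGroup A] [Module R A] :
    Subsingleton (G.T A i) ↔ Function.Exact (G.d A (i + 1)) (G.d A i) :=
  G.subsingleton_T_iff.trans ⟨fun h v => ⟨h v, by rintro ⟨w, rfl⟩; exact G.d_d i w⟩,
    fun h v hv => (h v).1 hv⟩

open TensorProduct in
lemma subsingleton_T_tensorProduct_iff {R : Type*} [CommRing R] (G : FreeCx R) {i : ℕ}
    (A : Type*) [AddCommGroup A] [Module R A] [Module.FaithfullyFlat R A]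
    (D : Type*) [AddCommGroup D] [Module R D] :
    Subsingleton (G.T (A ⊗[R] D) i) ↔ Subsingleton (G.T D i) := by
  rw [subsingleton_T_iff_exact, subsingleton_T_iff_exact,
    ← Module.FaithfullyFlat.lTensor_exact_iff_exact R A (G.d D (i + 1))]
  have h (i : ℕ) : G.d (A ⊗[R] D) i ∘ₗ (piRight R R A fun _ => D).toLinearMap =
      (piRight R R A fun _ => D).toLinearMap ∘ₗ (G.d D i).lTensor A :=
    LinearMap.ext fun t => (G.piRight_lTensor_d A D i t).symm
  exact Function.Exact.iff_of_ladder_linearEquiv (h (i + 1)) (h i)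

open TensorProduct in
/-- Tor rigidity over regular local rings. -/
theorem subsingleton_T_of_regular {R : Type u} [CommRing R] [IsLocalRing R] [IsNoetherianRing R]
    [IsDomain R] {l : List R} (hl : Ideal.ofList l = maximalIdeal R)
    (hreg : RingTheory.Sequence.IsWeaklyRegular R l)
    {D : Type u} [AddCommGroup D] [Module R D] [Module.Finite R D] (G : FreeCx R)
    (h0 : G.rk 0 = 0) {K : ℕ} (hK : ∀ i, K ≤ i → G.rk (i + 1) = 0)
    (hTR : ∀ i, Subsingleton (G.T R (i + 1))) (hT1 : Subsingleton (G.T D 1)) (i : ℕ) :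
    Subsingleton (G.T D (i + 1)) := by
  obtain ⟨V, _, _, _, _, d, g, hg0, hg, _, _⟩ := exists_faithfullyFlat_hypersurface l hl hreg
  rw [← G.subsingleton_T_tensorProduct_iff (MvPowerSeries (Fin d) V ⧸ Ideal.span {g}),
    ← G.subsingleton_baseChange_T_iff (Q := MvPowerSeries (Fin d) V ⧸ Ideal.span {g})] at hT1 ⊢
  refine subsingleton_T_of_hypersurface hg0 hg (G.baseChange _) h0 hK (fun i => ?_) hT1 i
  rw [G.subsingleton_baseChange_T_iff]
  exact G.subsingleton_T_of_flat (hTR i) _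

end FreeCx

namespace FreeCx

section Dual

variable {R : Type*} [CommRing R] (F : FreeCx R) (X : Type*) [AddCommGroup X] [Module R X]

/-- The differential of `Hom(F, X)`. -/
def dT (i : ℕ) : (Fin (F.rk i) → X) →ₗ[R] (Fin (F.rk (i + 1)) → X) :=
  LinearMap.pi fun k => ∑ j, F.mat i j k • LinearMap.proj j

variable {X}

lemma dT_apply (i : ℕ) (v : Fin (F.rk i) → X) (k : Fin (F.rk (i + 1))) :
    F.dT X i v k = ∑ j, F.mat i j k • v j := by
  simp [dT, LinearMap.sum_apply]

lemma dT_dT (i : ℕ) (v : Fin (F.rk i) → X) : F.dT X (i + 1) (F.dT X i v) = 0 := by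
  ext j
  simp only [dT_apply, Finset.smul_sum, smul_smul, Pi.zero_apply]
  rw [Finset.sum_comm]
  refine Finset.sum_eq_zero fun k _ => ?_
  rw [← Finset.sum_smul, Finset.sum_congr rfl fun l _ => mul_comm _ _, ← Matrix.mul_apply,
    F.mul_mat, Matrix.zero_apply, zero_smul]

/-- The cokernel of the dual differential. -/
abbrev dualCoker (i : ℕ) : Type _ := (Fin (F.rk (i + 1)) → R) ⧸ LinearMap.range (F.dT R i)

/-- The map from the cokernel of a dual differential induced by the next one. -/
def dualCokerMap (i : ℕ) : F.dualCoker i →ₗ[R] (Fin (F.rk (i + 1 + 1)) → R) :=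
  Submodule.liftQ _ (F.dT R (i + 1)) (by
    rintro _ ⟨v, rfl⟩
    exact F.dT_dT i v)

lemma dualCokerMap_mk (i : ℕ) (v : Fin (F.rk (i + 1)) → R) :
    F.dualCokerMap i (Submodule.Quotient.mk v) = F.dT R (i + 1) v := rfl

lemma range_dualCokerMap (i : ℕ) :
    LinearMap.range (F.dualCokerMap i) = LinearMap.range (F.dT R (i + 1)) :=
  Submodule.range_liftQ _ _ _

variable (X) in
/-- Exactness of `Hom(F, X)` at the spot `i + 1`. -/
def DualExact (i : ℕ) : Prop := ∀ v, F.dT X (i + 1) v = 0 → ∃ w, F.dT X i w = v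

lemma dualCokerMap_injective {i : ℕ} (h : F.DualExact R i) :
    Function.Injective (F.dualCokerMap i) := by
  rw [← LinearMap.ker_eq_bot, LinearMap.ker_eq_bot']
  intro c hc
  obtain ⟨v, rfl⟩ := Submodule.Quotient.mk_surjective _ c
  exact (Submodule.Quotient.mk_eq_zero _).2 (h v hc)

variable {N : Type*} [AddCommGroup N] [Module R N] (G : FreeCx R) (π : (Fin (G.rk 1) → R) →ₗ[R] N)

/-- A matrix of generators of a free module, sent to a vector over the module `G` resolves. -/
def evalRows (k : ℕ) : (Fin (G.rk 1) → Fin k → R) →ₗ[R] (Fin k → N) :=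
  LinearMap.pi fun j => π ∘ₗ LinearMap.pi fun a => LinearMap.proj j ∘ₗ LinearMap.proj a

lemma evalRows_apply (k : ℕ) (u : Fin (G.rk 1) → Fin k → R) (j : Fin k) :
    G.evalRows π k u j = π fun a => u a j := rfl

lemma evalRows_dT (i : ℕ) (u : Fin (G.rk 1) → Fin (F.rk i) → R) :
    G.evalRows π _ (F.dT R i ∘ u) = F.dT N i (G.evalRows π _ u) := by
  ext k
  simp only [evalRows_apply, dT_apply, ← map_smul, ← map_sum, Function.comp_apply]
  congr 1
  ext a
  simp

variable {π} in
lemma evalRows_surjective (hπ : Function.Surjective π) (k : ℕ) :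
    Function.Surjective (G.evalRows π k) := by
  intro v
  choose w hw using fun j => hπ (v j)
  exact ⟨fun a j => w j a, funext fun j => hw j⟩

variable {π} in
lemma evalRows_eq_zero_iff (hker : LinearMap.ker π = LinearMap.range (G.d R 1)) (k : ℕ)
    (u : Fin (G.rk 1) → Fin k → R) :
    G.evalRows π k u = 0 ↔ ∃ w, G.d (Fin k → R) 1 w = u := by
  constructor
  · intro h
    have : ∀ j, ∃ w, G.d R 1 w = fun a => u a j := fun j => by
      have : (fun a => u a j) ∈ LinearMap.ker π := congrFun h j
      rwa [hker] at this
    choose w hw using this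
    refine ⟨fun b j => w j b, ?_⟩
    ext a j
    rw [← congrFun (hw j) a]
    simp [d_apply]
  · rintro ⟨w, rfl⟩
    ext j
    have : (fun a => G.d (Fin k → R) 1 w a j) ∈ LinearMap.ker π := by
      rw [hker]
      exact ⟨fun b => w b j, by ext a; simp [d_apply]⟩
    exact this

variable {G π} in
lemma dualExact_iff (h0 : G.rk 0 = 0) (hπ : Function.Surjective π)
    (hker : LinearMap.ker π = LinearMap.range (G.d R 1)) (i : ℕ) :
    F.DualExact N i ↔ Function.Injective (G.map (F.dualCokerMap i) 0) := by
  have hcyc {A : Type _} [AddCommGroup A] [Module R A] (v : Fin (G.rk 1) → A) : G.d A 0 v = 0 :=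
    funext fun j => ((h0 ▸ j : Fin 0)).elim0
  rw [← LinearMap.ker_eq_bot, LinearMap.ker_eq_bot']
  constructor
  · intro h t ht
    obtain ⟨u', hu', rfl⟩ := G.exists_cls t
    choose u hu using fun a => Submodule.Quotient.mk_surjective _ (u' a)
    rw [map_cls, cls_eq_zero] at ht
    have hψ : F.dualCokerMap i ∘ u' = F.dT R (i + 1) ∘ u := by
      ext1 a
      rw [Function.comp_apply, ← hu, dualCokerMap_mk]; rfl
    rw [hψ] at ht
    replace ht := (evalRows_eq_zero_iff G hker _ _).2 ht
    rw [evalRows_dT] at ht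
    obtain ⟨z', hz'⟩ := h _ ht
    obtain ⟨z, rfl⟩ := G.evalRows_surjective hπ _ z'
    rw [← evalRows_dT, ← sub_eq_zero, ← map_sub, evalRows_eq_zero_iff G hker] at hz'
    obtain ⟨w, hw⟩ := hz'
    rw [cls_eq_zero]
    refine ⟨-(Submodule.mkQ _ ∘ w), ?_⟩
    rw [map_neg]
    refine (congrArg Neg.neg (G.d_map _ 1 w)).trans ?_
    rw [hw]
    ext1 a
    simp only [Pi.neg_apply, Function.comp_apply, Pi.sub_apply, map_sub, Submodule.mkQ_apply, hu]
    rw [(Submodule.Quotient.mk_eq_zero (LinearMap.range (F.dT R i))).2 ⟨z a, rfl⟩]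
    simp
  · intro h v hv
    obtain ⟨u, rfl⟩ := G.evalRows_surjective hπ _ v
    rw [← evalRows_dT, evalRows_eq_zero_iff G hker] at hv
    have := h (G.cls 0 (Submodule.mkQ _ ∘ u) (hcyc _)) (by
      rw [map_cls, cls_eq_zero]
      exact hv)
    rw [cls_eq_zero] at this
    obtain ⟨w', hw'⟩ := this
    choose w hw using fun a => Submodule.Quotient.mk_surjective _ (w' a)
    have h1 : Submodule.mkQ _ ∘ (u - G.d _ 1 w) = (0 : Fin (G.rk 1) → F.dualCoker i) := by
      have h2 := G.d_map (Submodule.mkQ (LinearMap.range (F.dT R i))) 1 w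
      have h3 : Submodule.mkQ (LinearMap.range (F.dT R i)) ∘ w = w' := funext hw
      rw [h3] at h2
      ext1 a
      have h4 := congrFun (h2.symm.trans hw') a
      simp only [Function.comp_apply] at h4
      simp only [Function.comp_apply, Pi.sub_apply, map_sub, h4, sub_self, Pi.zero_apply]
    choose z hz using fun a => (Submodule.Quotient.mk_eq_zero _).1 (congrFun h1 a)
    refine ⟨G.evalRows π _ z, ?_⟩
    rw [← evalRows_dT, show F.dT R i ∘ z = u - G.d _ 1 w from funext hz, map_sub,
      (evalRows_eq_zero_iff G hker _ _).2 ⟨w, rfl⟩, sub_zero]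

end Dual

end FreeCx

open TensorProduct in
lemma IsLocalRing.subsingleton_or_subsingleton_of_tensorProduct {R : Type*} [CommRing R]
    [IsLocalRing R] (E N : Type*) [AddCommGroup E] [Module R E] [Module.Finite R E]
    [AddCommGroup N] [Module R N] [Module.Finite R N] (h : Subsingleton (E ⊗[R] N)) :
    Subsingleton E ∨ Subsingleton N := by
  rw [← IsLocalRing.subsingleton_tensorProduct (R := R) (M := E),
    ← IsLocalRing.subsingleton_tensorProduct (R := R) (M := N)]
  have h1 : Subsingleton ((ResidueField R ⊗[R] E) ⊗[ResidueField R] (ResidueField R ⊗[R] N)) :=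
    (AlgebraTensorModule.distribBaseChange R (ResidueField R) E N).symm.toEquiv.subsingleton
  by_contra! hc
  obtain ⟨hE, hN⟩ := hc
  have : Nontrivial ((ResidueField R ⊗[R] E) ⊗[ResidueField R] (ResidueField R ⊗[R] N)) :=
    inferInstance
  exact not_subsingleton _ h1

namespace FreeCx

section LongExact

variable {R : Type*} [CommRing R] (G : FreeCx R) {A B C : Type*} [AddCommGroup A] [Module R A]
  [AddCommGroup B] [Module R B] [AddCommGroup C] [Module R C] {f : A →ₗ[R] B} {g : B →ₗ[R] C}
  (hf : Function.Injective f) (hg : Function.Surjective g) (hfg : Function.Exact f g) {i : ℕ}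

include hf hg hfg

lemma map_injective_of_subsingleton (h : Subsingleton (G.T C (i + 1))) :
    Function.Injective (G.map f i) := by
  obtain ⟨δ, -, h2⟩ := G.exists_delta f g hf hg hfg i
  rw [← LinearMap.ker_eq_bot, LinearMap.ker_eq_bot']
  intro t ht
  obtain ⟨s, rfl⟩ := (h2 t).1 ht
  rw [Subsingleton.elim s 0, map_zero]

lemma subsingleton_T_left (hC : Subsingleton (G.T C (i + 1))) (hB : Subsingleton (G.T B i)) :
    Subsingleton (G.T A i) :=
  (G.map_injective_of_subsingleton hf hg hfg hC).subsingleton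

lemma subsingleton_T_middle (hA : Subsingleton (G.T A i)) (hC : Subsingleton (G.T C i)) :
    Subsingleton (G.T B i) := by
  refine subsingleton_of_forall_eq 0 fun t => ?_
  obtain ⟨s, rfl⟩ := (G.exact_map f g hf hg hfg i t).1 (Subsingleton.elim _ _)
  rw [Subsingleton.elim s 0, map_zero]

lemma subsingleton_T_right (hB : Subsingleton (G.T B (i + 1)))
    (hA : Function.Injective (G.map f i)) : Subsingleton (G.T C (i + 1)) := by
  obtain ⟨δ, h1, h2⟩ := G.exists_delta f g hf hg hfg i
  refine subsingleton_of_forall_eq 0 fun t => ?_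
  have h3 : G.map f i (δ t) = 0 := (h2 _).2 ⟨t, rfl⟩
  obtain ⟨s, rfl⟩ := (h1 t).1 (hA (h3.trans (map_zero _).symm))
  rw [Subsingleton.elim s 0, map_zero]

end LongExact

section Main

open TensorProduct in
lemma subsingleton_tensorProduct_of_T {R : Type*} [CommRing R] {G : FreeCx R} (h0 : G.rk 0 = 0)
    {N : Type*} [AddCommGroup N] [Module R N]
    {π : (Fin (G.rk 1) → R) →ₗ[R] N} (hπ : Function.Surjective π)
    (hker : LinearMap.ker π = LinearMap.range (G.d R 1)) {E : Type*} [AddCommGroup E] [Module R E]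
    (h : Subsingleton (G.T E 0)) : Subsingleton (E ⊗[R] N) := by
  rw [subsingleton_T_iff] at h
  refine subsingleton_of_forall_eq 0 fun x => ?_
  obtain ⟨t, rfl⟩ := LinearMap.lTensor_surjective E hπ x
  obtain ⟨w, hw⟩ := h (piScalarRight R R E _ t) (funext fun j => ((h0 ▸ j : Fin 0)).elim0)
  have h1 : (G.d R 1).lTensor E ((piScalarRight R R E _).symm w) = t := by
    apply (piScalarRight R R E _).injective
    rw [piScalarRight_lTensor_d, LinearEquiv.apply_symm_apply]
    exact hw
  rw [← h1, ← LinearMap.comp_apply, ← LinearMap.lTensor_comp,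
    (LinearMap.exact_iff.2 hker).linearMap_comp_eq_zero, LinearMap.lTensor_zero,
    LinearMap.zero_apply]

variable {R : Type u} [CommRing R]

lemma dualExact_of_subsingleton (F : FreeCx R) (N : Type*) [AddCommGroup N] [Module R N]
    [Subsingleton N] (i : ℕ) : F.DualExact N i := fun _ _ => ⟨0, Subsingleton.elim _ _⟩

lemma exact_dualCokerMap_mkQ (F : FreeCx R) (i : ℕ) :
    Function.Exact (F.dualCokerMap i)
      (Submodule.mkQ (LinearMap.range (F.dT R (i + 1)))) := by
  rw [LinearMap.exact_iff, Submodule.ker_mkQ, range_dualCokerMap]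

/-- Ext rigidity from Tor rigidity, for modules resolved by `F` and `G`. -/
theorem dualExact_of_le [IsLocalRing R] [IsNoetherianRing R] [IsDomain R] {l : List R}
    (hl : Ideal.ofList l = maximalIdeal R) (hreg : RingTheory.Sequence.IsWeaklyRegular R l)
    (F G : FreeCx R) (h0 : G.rk 0 = 0) {K : ℕ} (hK : ∀ i, K ≤ i → G.rk (i + 1) = 0)
    (hTR : ∀ i, Subsingleton (G.T R (i + 1)))
    {N : Type*} [AddCommGroup N] [Module R N] [Module.Finite R N]
    {π : (Fin (G.rk 1) → R) →ₗ[R] N} (hπ : Function.Surjective π)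
    (hker : LinearMap.ker π = LinearMap.range (G.d R 1)) {n : ℕ}
    (hF : ∀ i < n, F.DualExact R i) (hN : F.DualExact N n) {i : ℕ} (hi : i ≤ n) :
    F.DualExact N i := by
  rcases subsingleton_or_nontrivial N with hN0 | hN0
  · exact F.dualExact_of_subsingleton N i
  have hfree (k i : ℕ) : Subsingleton (G.T (Fin k → R) (i + 1)) := G.subsingleton_T_pi (hTR i)
  have hCn (j : ℕ) : Subsingleton (G.T (F.dualCoker n) (j + 1)) := by
    have hmap := (F.dualExact_iff h0 hπ hker n).1 hN
    obtain ⟨ψ, hψ⟩ : ∃ ψ, ψ = F.dualCokerMap n := ⟨_, rfl⟩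
    rw [← hψ] at hmap
    have hcomp : ∀ t, G.map (LinearMap.range ψ).subtype 0 (G.map ψ.rangeRestrict 0 t) =
        G.map ψ 0 t := fun t => by rw [map_map]; rfl
    have hB0 : Function.Injective (G.map ψ.rangeRestrict 0) := fun s t hst =>
      hmap (by rw [← hcomp, hst, hcomp])
    have hBs : Function.Surjective (G.map ψ.rangeRestrict 0) :=
      G.map_zero_surjective _ ψ.surjective_rangeRestrict h0
    have hincl : Function.Injective (G.map (LinearMap.range ψ).subtype 0) := fun s t hst => by
      obtain ⟨s, rfl⟩ := hBs s
      obtain ⟨t, rfl⟩ := hBs t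
      rw [hcomp, hcomp] at hst
      rw [hmap hst]
    have hex : Function.Exact (LinearMap.range ψ).subtype (LinearMap.range ψ).mkQ := by
      rw [LinearMap.exact_iff, Submodule.ker_mkQ, Submodule.range_subtype]
    have hD := G.subsingleton_T_of_regular hl hreg h0 hK hTR
      (G.subsingleton_T_right Subtype.val_injective (Submodule.mkQ_surjective _) hex
        (hfree _ 0) hincl)
    have hB (j : ℕ) : Subsingleton (G.T (LinearMap.range ψ) (j + 1)) :=
      G.subsingleton_T_left Subtype.val_injective (Submodule.mkQ_surjective _) hex (hD (j + 1))
        (hfree _ j)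
    have hex' : Function.Exact (LinearMap.ker ψ).subtype ψ.rangeRestrict := by
      rw [LinearMap.exact_iff, LinearMap.ker_rangeRestrict, Submodule.range_subtype]
    have hE0 : Subsingleton (G.T (LinearMap.ker ψ) 0) := by
      refine subsingleton_of_forall_eq 0 fun t => ?_
      refine G.map_injective_of_subsingleton Subtype.val_injective ψ.surjective_rangeRestrict hex'
        (hB 0) (hB0 ?_)
      rw [map_zero, map_zero]
      exact (G.exact_map _ _ Subtype.val_injective ψ.surjective_rangeRestrict hex' 0 _).2 ⟨t, rfl⟩
    have hE : Subsingleton (LinearMap.ker ψ) :=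
      (subsingleton_or_subsingleton_of_tensorProduct (LinearMap.ker ψ) N
        (subsingleton_tensorProduct_of_T h0 hπ hker hE0)).resolve_right (not_subsingleton N)
    exact G.subsingleton_T_middle Subtype.val_injective ψ.surjective_rangeRestrict hex'
      (G.subsingleton_of_subsingleton _) (hB j)
  have hC (k : ℕ) : k ≤ n → ∀ j, Subsingleton (G.T (F.dualCoker (n - k)) (j + 1)) := by
    induction k with
    | zero => exact fun _ => hCn
    | succ k ih =>
      intro hk j
      have h1 := ih (by omega) (j + 1)
      obtain ⟨m, hm⟩ : ∃ m, n - (k + 1) = m := ⟨_, rfl⟩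
      rw [show n - k = m + 1 by omega] at h1
      rw [hm]
      exact G.subsingleton_T_left (F.dualCokerMap_injective (hF m (by omega)))
        (Submodule.mkQ_surjective _) (F.exact_dualCokerMap_mkQ m) h1 (hfree _ j)
  rcases hi.eq_or_lt with rfl | hi
  · exact hN
  · rw [F.dualExact_iff h0 hπ hker]
    have h1 := hC (n - (i + 1)) (by omega) 0
    rw [show n - (n - (i + 1)) = i + 1 by omega] at h1
    exact G.map_injective_of_subsingleton (F.dualCokerMap_injective (hF i hi))
      (Submodule.mkQ_surjective _) (F.exact_dualCokerMap_mkQ i) h1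

end Main

end FreeCx

namespace FreeCx

section Ext

variable {R : Type u} [CommRing R] (F : FreeCx R)

/-- The chain complex of modules given by a complex of matrices, with the ranks shifted by one. -/
noncomputable abbrev chainComplex : ChainComplex (ModuleCat.{u} R) ℕ :=
  ChainComplex.of (fun i => ModuleCat.of R (Fin (F.rk (i + 1)) → R))
    (fun i => ModuleCat.ofHom (F.d R (i + 1))) fun i => by
      ext1
      exact LinearMap.ext fun v => F.d_d (i + 1) v

lemma chainComplex_d (i : ℕ) :
    F.chainComplex.d (i + 1) i = ModuleCat.ofHom (F.d R (i + 1)) :=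
  ChainComplex.of_d (fun i => ModuleCat.of R (Fin (F.rk (i + 1)) → R))
    (fun i => ModuleCat.ofHom (F.d R (i + 1))) i

variable {M : Type u} [AddCommGroup M] [Module R M] {π : (Fin (F.rk 1) → R) →ₗ[R] M}

variable {F} in
/-- The projective resolution given by an acyclic complex of matrices. -/
noncomputable def projectiveResolution (hF : ∀ i, Subsingleton (F.T R (i + 1)))
    (hπ : Function.Surjective π) (hker : LinearMap.ker π = LinearMap.range (F.d R 1)) :
    ProjectiveResolution (ModuleCat.of R M) where
  complex := F.chainComplex
  projective i := ModuleCat.projective_of_free (Pi.basisFun R (Fin (F.rk (i + 1))))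
  π := (ChainComplex.toSingle₀Equiv _ _).symm ⟨ModuleCat.ofHom π, by
    rw [F.chainComplex_d 0]
    ext1
    exact (LinearMap.exact_iff.2 hker).linearMap_comp_eq_zero⟩
  quasiIso := ⟨fun i => by
    cases i with
    | zero =>
      rw [ChainComplex.quasiIsoAt₀_iff, ShortComplex.quasiIso_iff_of_zeros' _ rfl rfl rfl]
      constructor
      · rw [ShortComplex.moduleCat_exact_iff]
        intro v hv
        obtain ⟨w, hw⟩ : v ∈ LinearMap.range (F.d R 1) := hker.le hv
        refine ⟨w, ?_⟩
        refine (congrArg (fun f => f.hom w) (F.chainComplex_d 0)).trans hw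
      · exact (ModuleCat.epi_iff_surjective _).2 hπ
    | succ i =>
      refine (quasiIsoAt_iff_exactAt' _ _ (ChainComplex.exactAt_succ_single_obj _ _)).2 ?_
      rw [HomologicalComplex.exactAt_iff' _ (i + 1 + 1) (i + 1) i (by simp) (by simp),
        ShortComplex.moduleCat_exact_iff]
      intro v hv
      have hv' : F.d R (i + 1) v = 0 :=
        (congrArg (fun f => f.hom v) (F.chainComplex_d i)).symm.trans hv
      obtain ⟨w, hw⟩ := F.subsingleton_T_iff.1 (hF i) v hv'
      exact ⟨w, (congrArg (fun f => f.hom w) (F.chainComplex_d (i + 1))).trans hw⟩⟩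

/-- Maps out of a free module, as vectors. -/
lemma exists_hom_eq_sum {N : Type u} [AddCommGroup N] [Module R N] {k : ℕ} (v : Fin k → N) :
    ∃ f : (Fin k → R) →ₗ[R] N, ∀ j, f (Pi.single j 1) = v j :=
  ⟨(Pi.basisFun R (Fin k)).constr R v, fun j => by
    rw [← Pi.basisFun_apply, Module.Basis.constr_basis]⟩

lemma comp_d_eq_iff {N : Type u} [AddCommGroup N] [Module R N] {i : ℕ}
    (f : (Fin (F.rk i) → R) →ₗ[R] N) (g : (Fin (F.rk (i + 1)) → R) →ₗ[R] N) :
    f ∘ₗ F.d R i = g ↔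
      F.dT N i (fun j => f (Pi.single j 1)) = fun j => g (Pi.single j 1) := by
  have h : ∀ k, F.dT N i (fun j => f (Pi.single j 1)) k = f (F.d R i (Pi.single k 1)) := by
    intro k
    rw [dT_apply, ← Finset.univ_sum_single (F.d R i (Pi.single k 1)), map_sum]
    refine Finset.sum_congr rfl fun j _ => ?_
    rw [d_apply, ← map_smul, ← Pi.single_smul]
    simp [Pi.single_apply]
  constructor
  · rintro rfl
    exact funext h
  · intro hfg
    refine (Pi.basisFun R _).ext fun k => ?_
    rw [Pi.basisFun_apply]
    exact (h k).symm.trans (congrFun hfg k)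

lemma linearYonedaObj_d_eq_iff {N : Type u} [AddCommGroup N] [Module R N] {i : ℕ}
    (f : (Fin (F.rk (i + 1)) → R) →ₗ[R] N) (g : (Fin (F.rk (i + 1 + 1)) → R) →ₗ[R] N) :
    ((F.chainComplex.linearYonedaObj R (ModuleCat.of R N)).d i (i + 1)).hom (ModuleCat.ofHom f) =
      ModuleCat.ofHom g ↔
      F.dT N (i + 1) (fun j => f (Pi.single j 1)) = fun j => g (Pi.single j 1) := by
  rw [← comp_d_eq_iff]
  have : ((F.chainComplex.linearYonedaObj R (ModuleCat.of R N)).d i (i + 1)).hom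
      (ModuleCat.ofHom f) = F.chainComplex.d (i + 1) i ≫ ModuleCat.ofHom f := rfl
  rw [this, chainComplex_d, ← ModuleCat.ofHom_comp]
  exact ⟨fun h => congrArg ModuleCat.Hom.hom h, fun h => congrArg ModuleCat.ofHom h⟩

variable {F} in
lemma subsingleton_extMod_iff (h0 : F.rk 0 = 0) (hF : ∀ i, Subsingleton (F.T R (i + 1)))
    (hπ : Function.Surjective π) (hker : LinearMap.ker π = LinearMap.range (F.d R 1))
    (N : Type u) [AddCommGroup N] [Module R N] (i : ℕ) :
    Subsingleton (extMod R i M N) ↔ F.DualExact N i := by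
  have e := (projectiveResolution hF hπ hker).isoExt (R := R) i (ModuleCat.of R N)
  have hK : (projectiveResolution hF hπ hker).complex = F.chainComplex := rfl
  rw [hK] at e
  have key : (F.chainComplex.linearYonedaObj R (ModuleCat.of R N)).ExactAt i ↔
      F.DualExact N i := by
    cases i with
    | zero =>
      rw [HomologicalComplex.exactAt_iff' _ 0 0 1 (by simp) (by simp),
        ShortComplex.moduleCat_exact_iff]
      constructor
      · intro h v hv
        obtain ⟨f, hf⟩ := exists_hom_eq_sum (R := R) v
        obtain ⟨w, hw⟩ := h (ModuleCat.ofHom f)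
          ((F.linearYonedaObj_d_eq_iff f 0).2 ((congrArg (F.dT N _) (funext hf)).trans hv))
        have h1 : (ModuleCat.ofHom f) = 0 := hw.symm.trans
          (congrArg (fun f => ModuleCat.Hom.hom f w) ((F.chainComplex.linearYonedaObj R
            (ModuleCat.of R N)).shape 0 0 (by simp)))
        refine ⟨0, ?_⟩
        rw [map_zero]
        ext j
        rw [← hf]
        exact (congrArg (fun f => f.hom (Pi.single j 1)) h1).symm
      · intro h x hx
        obtain ⟨w, hw⟩ := h (fun j => x.hom (Pi.single j 1))
          ((F.linearYonedaObj_d_eq_iff x.hom 0).1 hx)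
        have hw0 : w = 0 := funext fun j => ((h0 ▸ j : Fin 0)).elim0
        rw [hw0, map_zero] at hw
        refine ⟨0, (map_zero _).trans ?_⟩
        refine congrArg ModuleCat.ofHom (a₁ := (0 : (Fin (F.rk 1) → R) →ₗ[R] N))
          (a₂ := ModuleCat.Hom.hom x) ((Pi.basisFun R _).ext fun k => ?_)
        rw [Pi.basisFun_apply]
        exact congrFun hw k
    | succ i =>
      rw [HomologicalComplex.exactAt_iff' _ i (i + 1) (i + 1 + 1) (by simp) (by simp),
        ShortComplex.moduleCat_exact_iff]
      constructor
      · intro h v hv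
        obtain ⟨f, hf⟩ := exists_hom_eq_sum (R := R) v
        obtain ⟨w, hw⟩ := h (ModuleCat.ofHom f)
          ((F.linearYonedaObj_d_eq_iff f 0).2 ((congrArg (F.dT N _) (funext hf)).trans hv))
        refine ⟨fun j => ModuleCat.Hom.hom w (Pi.single j 1), ?_⟩
        rw [(F.linearYonedaObj_d_eq_iff (ModuleCat.Hom.hom w) f).1 hw]
        exact funext hf
      · intro h x hx
        obtain ⟨w, hw⟩ := h (fun j => ModuleCat.Hom.hom x (Pi.single j 1))
          ((F.linearYonedaObj_d_eq_iff (ModuleCat.Hom.hom x) 0).1 hx)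
        obtain ⟨f, hf⟩ := exists_hom_eq_sum (R := R) w
        refine ⟨ModuleCat.ofHom f, (F.linearYonedaObj_d_eq_iff f (ModuleCat.Hom.hom x)).2 ?_⟩
        simpa only [hf] using hw
  rw [← key, HomologicalComplex.exactAt_iff_isZero_homology]
  exact (ModuleCat.isZero_iff_subsingleton (M := extMod R i M N)).symm.trans e.isZero_iff

end Ext

end FreeCx

/-- Over a regular local ring, every nonzero finitely generated module `M` is Ext rigid:
if `Ext^n(M, N) = 0` for some `n ≤ grade M` and finitely generated `N`, then
`Ext^i(M, N) = 0` for all `i ≤ n`. -/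
theorem ext_rigid_of_regular (R : Type u) [CommRing R] [IsLocalRing R] [IsNoetherianRing R]
    (hreg : IsRegularLocal R)
    (M : Type u) [AddCommGroup M] [Module R M] [Module.Finite R M] (hM : Nontrivial M)
    (N : Type u) [AddCommGroup N] [Module R N] [Module.Finite R N]
    (n : ℕ) (hn : n ≤ moduleGrade R M)
    (hvanish : Subsingleton (extMod R n M N)) :
    ∀ i ≤ n, Subsingleton (extMod R i M N) := by
  obtain ⟨_, s, hs, hdim⟩ := hreg
  have hofList : Ideal.ofList s.toList = maximalIdeal R := by
    rw [← hs, Ideal.ofList]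
    congr 1
    ext r
    simp
  obtain ⟨_, hl⟩ := IsLocalRing.isDomain_and_isWeaklyRegular_of_length_le s.card R s.toList
    s.length_toList hofList (le_of_eq hdim)
  obtain ⟨F, πM, hF0, _, hFT, hFπ, hFk⟩ := FreeCx.exists_resolution hofList hl M
  obtain ⟨G, πN, hG0, ⟨K, hK⟩, hGT, hGπ, hGk⟩ := FreeCx.exists_resolution hofList hl N
  intro i hi
  rw [FreeCx.subsingleton_extMod_iff hF0 hFT hFπ hFk] at hvanish ⊢
  exact FreeCx.dualExact_of_le hofList hl F G hG0 hK hGT hGπ hGk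
    (fun j hj => (FreeCx.subsingleton_extMod_iff hF0 hFT hFπ hFk R j).1
      (by_contra fun h => Nat.notMem_of_lt_sInf (lt_of_lt_of_le hj hn) h)) hvanish hi
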